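/- arXiv:math/9807029 — 2 statements merged into one kernel-verified Lean document; each statement's English description precedes it below -/
import Mathlib

section
/- Let d be an odd integer with d ≥ 11, let σ = 2^{(d+1)/2}, and let γ = 2^{(3d+1)/4} if d ≡ 1 (mod 4) and γ = 2^{(d+1)/4} if d ≡ 3 (mod 4). Then the four subsets D_{2,d}, D_{6,d}, D_{σ+γ,d}, and D_{3σ+4,d} of F_{2^d}^* (arising respectively from the regular, Segre, Glynn type (I), and Glynn type (II) hyperovals) are pairwise inequivalent as difference sets. -/
/-- `Dset k d = τ(F_{2^d}) \ {0}` viewed inside `F_{2^d}ˣ`, where `τ(x) = x + x^k`. -/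
def Dset (k d : ℕ) : Set (GaloisField 2 d)ˣ :=
  {u | ∃ x : GaloisField 2 d, x + x ^ k = (u : GaloisField 2 d)}

/-- Two subsets of the cyclic group `F_{2^d}ˣ` are equivalent as difference sets if one
is obtained from the other by applying `x ↦ x^t` (with `gcd(t, 2^d - 1) = 1`) and
translating by a group element. -/
def EquivDS {d : ℕ} (D₁ D₂ : Set (GaloisField 2 d)ˣ) : Prop :=
  ∃ t : ℤ, t.gcd (2 ^ d - 1) = 1 ∧ ∃ a : (GaloisField 2 d)ˣ,
    D₁ = (fun x => x ^ t * a) '' D₂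

set_option linter.unusedSectionVars false
set_option linter.style.haveILetI false
namespace GD
open Finset

variable {d : ℕ} [NeZero d]

/-- The power of two sitting at position `n`. -/
def P (g n : ZMod d) : ℕ := 2 ^ (g * n).val

/-- The exponent attached to a word. -/
def ex (g : ZMod d) (A : Finset (ZMod d)) : ℕ := ∑ n ∈ A, P g n

lemma P_pos (g n : ZMod d) : 0 < P g n := by unfold P; positivity

lemma P_zero (g : ZMod d) : P g 0 = 1 := by simp [P]

lemma two_pow_ge (d : ℕ) : 1 ≤ 2 ^ d := Nat.one_le_two_pow

lemma two_pow_mod (a : ℕ) : 2 ^ (a % d) ≡ 2 ^ a [MOD (2 ^ d - 1)] := by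
  have h1 : 2 ^ d ≡ 1 [MOD (2 ^ d - 1)] := by
    have : 2 ^ d = 1 + (2 ^ d - 1) := by have := two_pow_ge d; omega
    conv_lhs => rw [this]
    simp [Nat.ModEq]
  conv_rhs => rw [← Nat.div_add_mod a d, pow_add, pow_mul]
  have := (h1.pow (a / d)).mul_right (2 ^ (a % d))
  simpa using this.symm

lemma P_add (g i j : ZMod d) : P g (i + j) ≡ P g i * P g j [MOD (2 ^ d - 1)] := by
  unfold P
  rw [← pow_add, mul_add, ZMod.val_add]
  exact two_pow_mod _

lemma P_step {g : ZMod d} {p : ZMod d} (hgp : g * p = 1) (n : ZMod d) :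
    2 * P g (n - p) = P g n + if n = 0 then 2 ^ d - 1 else 0 := by
  unfold P
  have hn : g * n = 0 ↔ n = 0 := by
    constructor
    · intro h
      have : p * (g * n) = 0 := by rw [h, mul_zero]
      rw [← mul_assoc, mul_comm p g, hgp, one_mul] at this
      exact this
    · rintro rfl; simp
  have e : g * (n - p) = g * n - 1 := by rw [mul_sub, hgp]
  rw [e]
  have hd : d ≠ 0 := NeZero.ne d
  obtain ⟨D, rfl⟩ : ∃ D, d = D + 1 := ⟨d - 1, by omega⟩
  split_ifs with h
  · rw [hn.2 h, zero_sub, ZMod.val_neg_one, ZMod.val_zero, pow_succ]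
    have := two_pow_ge D
    omega
  · have h0 : g * n ≠ 0 := fun h' => h (hn.1 h')
    have hv : (g * n).val ≠ 0 := by simpa [ZMod.val_eq_zero] using h0
    have : (g * n - 1).val = (g * n).val - 1 := by
      have hone : D + 1 ≠ 1 := by
        rintro h1
        have : D = 0 := by omega
        subst this
        exact h0 (Subsingleton.elim (α := ZMod 1) _ _)
      haveI : Fact (1 < D + 1) := ⟨by omega⟩
      rw [ZMod.val_sub]
      · rw [ZMod.val_one]
      · rw [ZMod.val_one]; omega
    rw [this, add_zero, ← pow_succ']
    congr 1; omega

lemma P_step_mod {g : ZMod d} {p : ZMod d} (hgp : g * p = 1) (n : ZMod d) :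
    P g n ≡ 2 * P g (n - p) [MOD (2 ^ d - 1)] := by
  rw [P_step hgp]
  split_ifs <;> simp [Nat.ModEq]

lemma mul_inj {g p : ZMod d} (hgp : g * p = 1) : Function.Injective (fun n : ZMod d => (g * n).val) := by
  intro a b h
  have h' := ZMod.val_injective d h
  have : p * (g * a) = p * (g * b) := by rw [h']
  rwa [← mul_assoc, ← mul_assoc, mul_comm p g, hgp, one_mul, one_mul] at this

lemma ex_inj {g p : ZMod d} (hgp : g * p = 1) : Function.Injective (ex g) := by
  intro A B h
  have key : ∀ A : Finset (ZMod d), ex g A = ∑ i ∈ A.map ⟨_, mul_inj hgp⟩, 2 ^ i := by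
    intro A; rw [Finset.sum_map]; rfl
  rw [key, key] at h
  have := Finset.geomSum_injective (le_refl 2) h
  exact Finset.map_injective _ this

lemma ex_univ {g p : ZMod d} (hgp : g * p = 1) : ex g univ = 2 ^ d - 1 := by
  have key : ex g univ = ∑ i ∈ (univ : Finset (ZMod d)).map ⟨_, mul_inj hgp⟩, 2 ^ i := by
    rw [Finset.sum_map]; rfl
  rw [key]
  have : (univ : Finset (ZMod d)).map ⟨_, mul_inj hgp⟩ = range d := by
    apply Finset.eq_of_subset_of_card_le
    · intro x hx
      simp only [mem_map, mem_univ, true_and, Function.Embedding.coeFn_mk] at hx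
      obtain ⟨a, rfl⟩ := hx
      exact mem_range.2 (ZMod.val_lt _)
    · simp
  rw [this, Nat.geomSum_eq (le_refl 2)]; simp

lemma ex_le {g p : ZMod d} (hgp : g * p = 1) (A : Finset (ZMod d)) : ex g A ≤ 2 ^ d - 1 := by
  rw [← ex_univ hgp]; exact Finset.sum_le_sum_of_subset (subset_univ _)

lemma ex_empty (g : ZMod d) : ex g ∅ = 0 := by simp [ex]

lemma ex_surj {g p : ZMod d} (hgp : g * p = 1) (m : ℕ) (hm : m ≤ 2 ^ d - 1) : ∃ A, ex g A = m := by
  have hle : ∀ A : Finset (ZMod d), ex g A < 2 ^ d := fun A => by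
    have := ex_le hgp A; have := two_pow_ge d; omega
  let f : Finset (ZMod d) → Fin (2 ^ d) := fun A => ⟨ex g A, hle A⟩
  have hf : Function.Bijective f := by
    rw [Fintype.bijective_iff_injective_and_card]
    refine ⟨fun A B h => ex_inj hgp (by simpa [f] using h), by simp [ZMod.card]⟩
  obtain ⟨A, hA⟩ := hf.2 ⟨m, by have := two_pow_ge d; omega⟩
  exact ⟨A, by simpa [f] using hA⟩

lemma ex_modEq {g p : ZMod d} (hgp : g * p = 1) {A B : Finset (ZMod d)} (hA : A ≠ univ) (hB : B ≠ univ)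
    (h : ex g A ≡ ex g B [MOD (2 ^ d - 1)]) : A = B := by
  apply ex_inj hgp
  have h1 : ∀ A : Finset (ZMod d), A ≠ univ → ex g A < 2 ^ d - 1 := fun A hA =>
    lt_of_le_of_ne (ex_le hgp A) (fun h => hA (ex_inj hgp (h.trans (ex_univ hgp).symm)))
  exact Nat.ModEq.eq_of_lt_of_lt h (h1 A hA) (h1 B hB)

lemma ex_compl {g p : ZMod d} (hgp : g * p = 1) (A : Finset (ZMod d)) :
    ex g A + ex g Aᶜ = 2 ^ d - 1 := by
  rw [← ex_univ hgp]; exact Finset.sum_add_sum_compl A _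

lemma ex_not_dvd {g p : ZMod d} (hgp : g * p = 1) {A : Finset (ZMod d)} (hA : A ≠ univ) (hB : A ≠ ∅) :
    ¬ (2 ^ d - 1) ∣ ex g A := by
  intro h
  apply hB
  by_cases hne : (∅ : Finset (ZMod d)) = univ
  · exact absurd (Finset.univ_eq_empty_iff.1 hne.symm) (not_isEmpty_of_nonempty _)
  apply ex_modEq hgp hA hne
  rw [ex_empty]
  exact (Nat.modEq_zero_iff_dvd).2 h

lemma ex_insert (g : ZMod d) {A : Finset (ZMod d)} {i} (h : i ∉ A) : ex g (insert i A) = P g i + ex g A :=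
  Finset.sum_insert h

lemma ex_erase (g : ZMod d) {A : Finset (ZMod d)} {i} (h : i ∈ A) : P g i + ex g (A.erase i) = ex g A :=
  Finset.add_sum_erase A _ h

end GD

namespace GD
open Finset

/-- Existence of the length two Witt ring with its Teichmueller map. -/
lemma exists_ring (F : Type) [Field F] [Fintype F] [CharP F 2] :
    ∃ (R : Type) (_ : CommRing R) (ρ : R →+* F) (t : F →* R), (∀ x, ρ (t x) = x) ∧ (4 : R) = 0 ∧
      t 0 = 0 ∧
      (∀ z, ρ z = 0 → ∃ w, z = 2 * w) ∧ (∀ z, 2 * z = 0 → ρ z = 0) := by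
  let W := WittVector 2 F
  let I : Ideal W := Ideal.span {(4 : W)}
  have h2 : ((2 : ℕ) : W) = 2 := by norm_cast
  have h20 : (2 : W) ≠ 0 := by rw [← h2]; exact WittVector.p_nonzero 2 F
  have hρ2 : (WittVector.constantCoeff (p := 2) (R := F)) 2 = 0 := by
    rw [map_ofNat]; exact CharTwo.two_eq_zero
  have hI : ∀ a ∈ I, (WittVector.constantCoeff (p := 2) (R := F)) a = 0 := by
    intro a ha
    obtain ⟨b, rfl⟩ := Ideal.mem_span_singleton.1 ha
    have : (4 : W) = 2 * 2 := by norm_num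
    rw [map_mul, this, map_mul, hρ2]; simp
  have hker : ∀ z : W, (WittVector.constantCoeff (p := 2) (R := F)) z = 0 → ∃ w, z = 2 * w := by
    intro z hz
    have := (WittVector.mem_span_p_iff_coeff_zero_eq_zero (p := 2) z).2 hz
    obtain ⟨w, hw⟩ := Ideal.mem_span_singleton.1 this
    exact ⟨w, by rw [hw, h2]⟩
  refine ⟨W ⧸ I, inferInstance, Ideal.Quotient.lift I WittVector.constantCoeff hI,
    (Ideal.Quotient.mk I : W →* W ⧸ I).comp (WittVector.teichmuller 2), ?_, ?_, ?_, ?_, ?_⟩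
  · intro x
    simp [WittVector.constantCoeff]
    exact WittVector.teichmuller_coeff_zero 2 x
  · have : (4 : W ⧸ I) = Ideal.Quotient.mk I (4 : W) := by rw [map_ofNat]
    rw [this, Ideal.Quotient.eq_zero_iff_mem]
    exact Ideal.mem_span_singleton_self _
  · show (Ideal.Quotient.mk I) ((WittVector.teichmuller 2) 0) = 0
    rw [WittVector.teichmuller_zero, map_zero]
  · intro z
    obtain ⟨z, rfl⟩ := Ideal.Quotient.mk_surjective z
    intro hz
    rw [Ideal.Quotient.lift_mk] at hz
    obtain ⟨w, rfl⟩ := hker z hz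
    exact ⟨Ideal.Quotient.mk I w, by rw [map_mul, map_ofNat]⟩
  · intro z
    obtain ⟨z, rfl⟩ := Ideal.Quotient.mk_surjective z
    intro hz
    rw [Ideal.Quotient.lift_mk]
    have h : (2 : W ⧸ I) = Ideal.Quotient.mk I (2 : W) := by rw [map_ofNat]
    rw [h, ← map_mul, Ideal.Quotient.eq_zero_iff_mem] at hz
    obtain ⟨w, hw⟩ := Ideal.mem_span_singleton.1 hz
    have h4 : (2 : W) * z = 2 * (2 * w) := by rw [hw]; ring
    have := mul_left_cancel₀ h20 h4
    rw [this, map_mul, hρ2, zero_mul]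

section
variable {F : Type} [Field F] [Fintype F] [CharP F 2] {R : Type} [CommRing R] {ρ : R →+* F} {t : F →* R}

lemma t_add_sq (h1 : ∀ x, ρ (t x) = x) (h4 : (4 : R) = 0)
    (h2 : ∀ z, ρ z = 0 → ∃ w, z = 2 * w) (x y : F) :
    t (x + y) ^ 2 = t x ^ 2 + t y ^ 2 + 2 * t (x * y) := by
  obtain ⟨w, hw⟩ := h2 (t (x + y) - t x - t y) (by simp [h1])
  have : t (x + y) = t x + t y + 2 * w := by linear_combination hw
  rw [this, map_mul]
  linear_combination (w ^ 2 + (t x + t y) * w) * h4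

lemma sum_t_pow (h1 : ∀ x, ρ (t x) = x) (h4 : (4 : R) = 0) (h0 : t 0 = 0)
    (h2 : ∀ z, ρ z = 0 → ∃ w, z = 2 * w) {M : ℕ} (hM : Fintype.card F = M + 1) (hM4 : M % 4 = 3)
    (E : ℕ) (hE : 0 < E) :
    ∑ x : F, t x ^ E = if M ∣ E then -1 else 0 := by
  classical
  have hM1 : Fintype.card F - 1 = M := by omega
  split_ifs with h
  · have : ∀ x : F, t x ^ E = if x = 0 then 0 else 1 := by
      intro x
      split_ifs with hx
      · rw [hx, h0, zero_pow hE.ne']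
      · obtain ⟨j, rfl⟩ := h
        rw [← map_pow, pow_mul, ← hM1, FiniteField.pow_card_sub_one_eq_one x hx, one_pow, map_one]
    rw [Finset.sum_congr rfl (fun x _ => this x)]
    have h' : ∀ x : F, (if x = 0 then (0 : R) else 1) = 1 - if x = 0 then 1 else 0 := by
      intro x; split_ifs <;> simp
    rw [Finset.sum_congr rfl (fun x _ => h' x), Finset.sum_sub_distrib]
    simp only [sum_const, card_univ, hM, sum_ite_eq', mem_univ, if_true]
    have hq : M = 4 * (M / 4) + 3 := by omega
    rw [hq]
    simp only [nsmul_eq_mul, mul_one]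
    push_cast
    linear_combination ((M / 4 : ℕ) + 1 : R) * h4
  · obtain ⟨g, hg⟩ := IsCyclic.exists_generator (α := Fˣ)
    have hg1 : (g : F) ^ E ≠ 1 := by
      intro hh
      apply h
      have : g ^ E = 1 := by ext; simpa using hh
      have := orderOf_dvd_of_pow_eq_one this
      rwa [orderOf_eq_card_of_forall_mem_zpowers hg, Nat.card_eq_fintype_card,
        Fintype.card_units, hM1] at this
    set S := ∑ x : F, t x ^ E with hS
    have hz : (t (g ^ E : F) - 1) * S = 0 := by
      have : t (g ^ E : F) * S = S := by
        rw [hS, Finset.mul_sum]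
        rw [← Equiv.sum_comp (Units.mulLeft g : F ≃ F) (fun x => t x ^ E)]
        apply Finset.sum_congr rfl
        intro x _
        simp [mul_pow]
      rw [sub_mul, this]; ring
    have hne : (g : F) ^ E - 1 ≠ 0 := sub_ne_zero.2 hg1
    obtain ⟨r, hr⟩ := h2 (t (((g : F) ^ E - 1)⁻¹) * (t (g ^ E : F) - 1) - 1) (by
      rw [map_sub, map_mul, map_sub, h1, h1, map_one, inv_mul_cancel₀ hne, sub_self])
    have e : (1 + 2 * r) * S = 0 := by
      have : (1 + 2 * r) = t (((g : F) ^ E - 1)⁻¹) * (t (g ^ E : F) - 1) := by linear_combination -hr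
      rw [this, mul_assoc, hz, mul_zero]
    linear_combination (1 - 2 * r) * e + r ^ 2 * S * h4

lemma prod_add_two {ι : Type} [DecidableEq ι] (h4 : (4 : R) = 0) (s : Finset ι) (u w : ι → R) :
    ∏ n ∈ s, (u n + 2 * w n) = ∏ n ∈ s, u n + 2 * ∑ i ∈ s, w i * ∏ n ∈ s.erase i, u n := by
  induction s using Finset.induction_on with
  | empty => simp
  | insert a s ha ih =>
    rw [Finset.prod_insert ha, Finset.prod_insert ha, Finset.sum_insert ha, ih,
      Finset.erase_insert ha]
    have : ∑ i ∈ s, w i * ∏ n ∈ (insert a s).erase i, u n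
        = u a * ∑ i ∈ s, w i * ∏ n ∈ s.erase i, u n := by
      rw [Finset.mul_sum]
      apply Finset.sum_congr rfl
      intro i hi
      have hai : a ≠ i := by rintro rfl; exact ha hi
      rw [Finset.erase_insert_of_ne hai, Finset.prod_insert (by simp [ha])]
      ring
    rw [this]
    linear_combination (w a * ∑ i ∈ s, w i * ∏ n ∈ s.erase i, u n) * h4
end
end GD

set_option linter.unusedSectionVars false
namespace GD
open Finset

def ZL {d : ℕ} (g : ZMod d) (k : ℕ) [NeZero d] : Prop := ∀ A B : Finset (ZMod d), Disjoint A B →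
  (2 ^ d - 1) ∣ ex g A + k * ex g B → B = ∅ ∨ B = univ

section
variable {d : ℕ} [NeZero d] {g p : ZMod d} {k : ℕ}

lemma ZL_coprime (hd : 2 ≤ d) (hgp : g * p = 1) (hk : 1 ≤ k) (hz : ZL g k) :
    Nat.Coprime (k - 1) (2 ^ d - 1) := by
  have hM : 0 < 2 ^ d - 1 := by
    have : 2 ^ 2 ≤ 2 ^ d := Nat.pow_le_pow_right (by norm_num) hd
    omega
  set M := 2 ^ d - 1 with hMd
  set o := Nat.gcd (k - 1) M with ho
  have ho0 : 0 < o := Nat.gcd_pos_of_pos_right _ hM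
  obtain ⟨j, hj⟩ : o ∣ M := Nat.gcd_dvd_right _ _
  obtain ⟨s, hs⟩ : o ∣ k - 1 := Nat.gcd_dvd_left _ _
  have hjM : j ≤ M := by rw [hj]; exact Nat.le_mul_of_pos_left _ ho0
  obtain ⟨B, hB⟩ := ex_surj hgp j hjM
  have h1 := hz Bᶜ B (disjoint_compl_left) (by
    have e := ex_compl hgp B
    rw [hB] at e ⊢
    have : ex g Bᶜ + k * j = (j + ex g Bᶜ) + (k - 1) * j := by
      obtain ⟨k', rfl⟩ := Nat.exists_eq_add_of_le hk
      simp; ring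
    rw [this, e, hs]
    have : (2 ^ d - 1) + o * s * j = M * (1 + s) := by
      rw [← hMd, mul_add, mul_one]
      congr 1
      calc o * s * j = (o * j) * s := by ring
        _ = M * s := by rw [← hj]
    rw [this]; exact dvd_mul_right _ _)
  rcases h1 with h | h
  · rw [h, ex_empty] at hB
    rw [← hB] at hj; omega
  · rw [h, ex_univ hgp] at hB
    rw [← hB] at hj
    have : M * 1 = M * o := by rw [mul_comm M o, mul_one]; exact hj
    exact (Nat.eq_of_mul_eq_mul_left hM this).symm

variable {F : Type} [Field F] [Fintype F] [CharP F 2] {R : Type} [CommRing R] {ρ : R →+* F} {t : F →* R}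

lemma t_pow_P (h1 : ∀ x, ρ (t x) = x) (h4 : (4 : R) = 0)
    (h2 : ∀ z, ρ z = 0 → ∃ w, z = 2 * w) (hgp : g * p = 1) (hF : Fintype.card F = 2 ^ d)
    (x y : F) (n : ZMod d) :
    t (x + y) ^ P g n = t x ^ P g n + t y ^ P g n + 2 * t (x * y) ^ P g (n - p) := by
  have key : ∀ z : F, t z ^ P g n = (t (z ^ P g (n - p))) ^ 2 := by
    intro z
    rw [← map_pow, ← map_pow, ← pow_mul, mul_comm _ 2, P_step hgp]
    split_ifs with h
    · rw [h, P_zero]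
      have : 1 + (2 ^ d - 1) = 2 ^ d := by have := two_pow_ge d; omega
      rw [this, ← hF, FiniteField.pow_card, pow_one]
    · rw [add_zero]
  rw [key, key, key]
  have : (x + y) ^ P g (n - p) = x ^ P g (n - p) + y ^ P g (n - p) := by
    unfold P; exact add_pow_char_pow x y 2 _
  rw [this, t_add_sq h1 h4 h2, ← map_pow t (x * y), mul_pow]

def Y (g p : ZMod d) (k : ℕ) (μ : Finset (ZMod d)) : Finset (Σ _ : ZMod d, Finset (ZMod d)) :=
  (μ.sigma fun i => (μ.erase i).powerset).filter fun q =>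
    (2 ^ d - 1) ∣ (1 + k) * P g (q.1 - p) + ex g (μ.erase q.1 \ q.2) + k * ex g q.2

lemma prod_u (s : Finset (ZMod d)) (x : F) :
    ∏ n ∈ s, (t x ^ P g n + t (x ^ k) ^ P g n)
      = ∑ B ∈ s.powerset, t x ^ (ex g (s \ B) + k * ex g B) := by
  have : ∀ n, t x ^ P g n + t (x ^ k) ^ P g n = t x ^ (k * P g n) + t x ^ P g n := by
    intro n; rw [map_pow, ← pow_mul]; ring
  simp_rw [this]
  rw [Finset.prod_add]
  apply Finset.sum_congr rfl
  intro B _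
  rw [Finset.prod_pow_eq_pow_sum, Finset.prod_pow_eq_pow_sum, ← pow_add, ex, ex, Finset.mul_sum,
    add_comm]

lemma sum_tau (h1 : ∀ x, ρ (t x) = x) (h4 : (4 : R) = 0) (h0 : t 0 = 0)
    (h2 : ∀ z, ρ z = 0 → ∃ w, z = 2 * w) (hgp : g * p = 1) (hF : Fintype.card F = 2 ^ d)
    (hd : 2 ≤ d) (hk : 1 ≤ k) (hz : ZL g k) (μ : Finset (ZMod d)) (hμ : μ ≠ ∅) (hμ' : μ ≠ univ) :
    ∑ x : F, t (x + x ^ k) ^ ex g μ = 2 * ((Y g p k μ).card : R) := by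
  have hM4 : (2 ^ d - 1) % 4 = 3 := by
    obtain ⟨e, rfl⟩ := Nat.exists_eq_add_of_le hd
    have := two_pow_ge e
    rw [pow_add]; omega
  have hM : Fintype.card F = (2 ^ d - 1) + 1 := by rw [hF]; have := two_pow_ge d; omega
  have e1 : ∀ x : F, t (x + x ^ k) ^ ex g μ =
      ∑ B ∈ μ.powerset, t x ^ (ex g (μ \ B) + k * ex g B) +
      2 * ∑ q ∈ μ.sigma (fun i => (μ.erase i).powerset),
        t x ^ ((1 + k) * P g (q.1 - p) + ex g (μ.erase q.1 \ q.2) + k * ex g q.2) := by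
    intro x
    rw [ex, ← Finset.prod_pow_eq_pow_sum]
    simp_rw [t_pow_P h1 h4 h2 hgp hF]
    rw [prod_add_two h4, prod_u, Finset.sum_sigma]
    congr 2
    apply Finset.sum_congr rfl
    intro i _
    rw [prod_u, Finset.mul_sum]
    apply Finset.sum_congr rfl
    intro B _
    rw [← pow_succ', map_pow, ← pow_mul, ← pow_add]
    congr 1; ring
  simp_rw [e1]
  rw [Finset.sum_add_distrib, ← Finset.mul_sum, Finset.sum_comm, Finset.sum_comm (s := univ)]
  have expos : ∀ B ⊆ μ, 0 < ex g (μ \ B) + k * ex g B := by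
    intro B hB
    have : ex g (μ \ B) + ex g B = ex g μ := Finset.sum_sdiff hB
    have h3 : 0 < ex g μ := Finset.sum_pos (fun n _ => P_pos g n) (nonempty_iff_ne_empty.2 hμ)
    have h5 : ex g B ≤ k * ex g B := Nat.le_mul_of_pos_left _ hk
    omega
  rw [Finset.sum_eq_zero, zero_add]
  · rw [Finset.sum_congr rfl (fun q _ => sum_t_pow h1 h4 h0 h2 hM hM4 _ ?_)]
    · rw [← Finset.sum_filter]
      rw [Finset.sum_const]
      rw [Y, nsmul_eq_mul]
      linear_combination (-(#{q ∈ μ.sigma fun i => (μ.erase i).powerset | (2 ^ d - 1) ∣ (1 + k) * P g (q.1 - p) + ex g (μ.erase q.1 \ q.2) + k * ex g q.2} : R)) * h4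
    · have := P_pos g (q.1 - p)
      have : 0 < (1 + k) * P g (q.1 - p) := by positivity
      omega
  · intro B hB
    rw [Finset.mem_powerset] at hB
    rw [sum_t_pow h1 h4 h0 h2 hM hM4 _ (expos B hB), if_neg]
    intro hdv
    rcases hz _ _ (disjoint_sdiff_self_left) hdv with h | h
    · rw [h, ex_empty, sdiff_empty, mul_zero, add_zero] at hdv
      exact ex_not_dvd hgp hμ' hμ hdv
    · apply hμ'; rw [h] at hB; exact univ_subset_iff.1 hB
end
end GD

set_option linter.unusedSectionVars false
namespace GD
open Finset

section
variable {d : ℕ} [NeZero d] {g p : ZMod d} {k : ℕ}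
variable {F : Type} [Field F] [Fintype F] [DecidableEq F] [CharP F 2]

lemma pow_inj_of_coprime {n : ℕ} (hF : Fintype.card F = 2 ^ d) (hc : Nat.Coprime n (2 ^ d - 1))
    {x y : F} (hx : x ≠ 0) (hy : y ≠ 0) (h : x ^ n = y ^ n) : x = y := by
  have h1 : (x / y) ^ n = 1 := by rw [div_pow, h, div_self (pow_ne_zero _ hy)]
  have h2 : (x / y) ^ (2 ^ d - 1) = 1 := by
    rw [← hF]; exact FiniteField.pow_card_sub_one_eq_one _ (div_ne_zero hx hy)
  have h3 := Nat.dvd_gcd (orderOf_dvd_of_pow_eq_one h1) (orderOf_dvd_of_pow_eq_one h2)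
  rw [hc, Nat.dvd_one, orderOf_eq_one_iff] at h3
  exact (div_eq_one_iff_eq hy).1 h3

/-- pair count bound -/
lemma pair_count (hF : Fintype.card F = 2 ^ d) (hk : 1 ≤ k) (hc : Nat.Coprime (k - 1) (2 ^ d - 1)) :
    (univ.filter fun q : F × F => q.1 + q.1 ^ k = q.2 + q.2 ^ k).card ≤ 2 * 2 ^ d := by
  have hsplit := Finset.card_filter_add_card_filter_not
    (s := univ.filter fun q : F × F => q.1 + q.1 ^ k = q.2 + q.2 ^ k) (fun q => q.1 = q.2)
  rw [← hsplit, two_mul]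
  apply add_le_add
  · rw [← hF, ← Finset.card_univ]
    apply Finset.card_le_card_of_injOn (fun q => q.1) (by intro q _; simp)
    intro a ha b hb hab
    simp only [coe_filter, mem_filter, mem_univ, true_and, Set.mem_ofPred_eq] at ha hb hab
    ext
    · exact hab
    · rw [← ha.2, ← hb.2]; exact hab
  · rw [← hF, ← Finset.card_univ]
    apply Finset.card_le_card_of_injOn (fun q => q.1 / (q.1 + q.2)) (by intro q _; simp)
    have key : ∀ q : F × F, q.1 + q.1 ^ k = q.2 + q.2 ^ k → q.1 ≠ q.2 → q.1 + q.2 ≠ 0 ∧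
        (q.1 + q.2) ^ (k - 1) * ((q.1 / (q.1 + q.2)) ^ k + (q.1 / (q.1 + q.2) + 1) ^ k) = 1 := by
      rintro ⟨x, y⟩ h hne
      simp only at h hne ⊢
      have hz : x + y ≠ 0 := by rwa [Ne, CharTwo.add_eq_zero]
      refine ⟨hz, ?_⟩
      have e1 : x / (x + y) + 1 = y / (x + y) := by
        rw [div_add_one hz]; congr 1
        rw [← add_assoc, CharTwo.add_self_eq_zero, zero_add]
      have e2 : (x + y) * ((x + y) ^ (k - 1) * ((x / (x + y)) ^ k + (x / (x + y) + 1) ^ k)) = x + y := by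
        rw [e1, div_pow, div_pow, ← mul_assoc, ← pow_succ', Nat.sub_add_cancel hk, ← add_div,
          mul_div_cancel₀ _ (pow_ne_zero _ hz)]
        have h3 := CharTwo.add_self_eq_zero (y + y ^ k)
        have h4 := CharTwo.add_self_eq_zero (x)
        have h5 := CharTwo.add_self_eq_zero (y)
        linear_combination h + h5 - h4 - h5 + (h3 - h5)
      exact mul_left_cancel₀ hz (e2.trans (mul_one _).symm)
    intro a ha b hb hab
    simp only [coe_filter, mem_filter, mem_univ, true_and, Set.mem_ofPred_eq] at ha hb hab
    obtain ⟨ha1, ha2⟩ := key a ha.1 ha.2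
    obtain ⟨hb1, hb2⟩ := key b hb.1 hb.2
    rw [← hab] at hb2
    have hne : ((a.1 / (a.1 + a.2)) ^ k + (a.1 / (a.1 + a.2) + 1) ^ k) ≠ 0 := by
      intro h0; rw [h0, mul_zero] at ha2; exact zero_ne_one ha2
    have hzz := pow_inj_of_coprime hF hc ha1 hb1 (mul_right_cancel₀ hne (ha2.trans hb2.symm))
    rw [← hzz] at hab
    have hx : a.1 = b.1 := by
      have := congrArg (· * (a.1 + a.2)) hab
      simpa [div_mul_cancel₀ _ ha1] using this
    ext
    · exact hx
    · rw [hx] at hzz; exact add_left_cancel hzz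

def fib (k : ℕ) (y : F) : ℕ := (univ.filter fun x : F => x + x ^ k = y).card

lemma fib_zero (hF : Fintype.card F = 2 ^ d) (hk : 1 ≤ k) (hc : Nat.Coprime (k - 1) (2 ^ d - 1)) :
    fib k (0 : F) = 2 := by
  have : (univ.filter fun x : F => x + x ^ k = 0) = {0, 1} := by
    ext x
    simp only [mem_filter, mem_univ, true_and, mem_insert, mem_singleton]
    constructor
    · intro h
      by_cases hx : x = 0
      · exact Or.inl hx
      · right
        apply pow_inj_of_coprime hF hc hx one_ne_zero
        rw [CharTwo.add_eq_zero] at h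
        apply mul_left_cancel₀ hx
        rw [← pow_succ', Nat.sub_add_cancel hk, ← h]; simp
    · rintro (rfl | rfl)
      · rw [zero_pow (by omega), add_zero]
      · rw [one_pow]; exact CharTwo.add_self_eq_zero 1
  rw [fib, this, card_pair zero_ne_one]

lemma fib_even (hF : Fintype.card F = 2 ^ d) (hd : 2 ≤ d) (hk : 1 ≤ k)
    (hc : Nat.Coprime (k - 1) (2 ^ d - 1))
    (hs : ∀ j, 0 < j → j < 2 ^ d - 1 → ∑ x : F, (x + x ^ k) ^ j = 0) (y : F) : Even (fib k y) := by
  have hq0 : ((2 ^ d : ℕ) : F) = 0 := by rw [← hF]; exact FiniteField.cast_card_eq_zero F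
  have hM : 0 < 2 ^ d - 1 := by
    have : 2 ^ 2 ≤ 2 ^ d := Nat.pow_le_pow_right (by norm_num) hd
    omega
  have ind : ∀ z : F, z ^ (2 ^ d - 1) = 1 - if z = 0 then 1 else 0 := by
    intro z
    split_ifs with h
    · rw [h, zero_pow hM.ne', sub_self]
    · rw [← hF, FiniteField.pow_card_sub_one_eq_one z h, sub_zero]
  have hsum : ∀ y : F, (fib k y : F) = ∑ x : F, (x + x ^ k - y) ^ (2 ^ d - 1) := by
    intro y
    simp_rw [ind, sub_eq_zero]
    rw [Finset.sum_sub_distrib, fib, Finset.card_filter]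
    have e0 : ∑ _x : F, (1 : F) = 0 := by
      rw [Finset.sum_const, Finset.card_univ, hF, nsmul_eq_mul, hq0, zero_mul]
    rw [e0, zero_sub, CharTwo.neg_eq]
    push_cast
    rfl
  have hM' : ∑ x : F, (x + x ^ k) ^ (2 ^ d - 1) = 0 := by
    have := hsum 0
    rw [fib_zero hF hk hc] at this
    simp only [sub_zero] at this
    rw [← this]; exact CharTwo.two_eq_zero
  have h0 : (fib k y : F) = 0 := by
    rw [hsum]
    rw [Finset.sum_congr rfl (fun x _ => by rw [sub_eq_add_neg, add_pow (x + x ^ k)]),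
      Finset.sum_comm]
    apply Finset.sum_eq_zero
    intro j hj
    rw [← Finset.sum_mul, ← Finset.sum_mul]
    have : ∑ x : F, (x + x ^ k) ^ j = 0 := by
      rcases Nat.eq_zero_or_pos j with rfl | h
      · simp_rw [pow_zero]
        rw [Finset.sum_const, Finset.card_univ, hF, nsmul_eq_mul, hq0, zero_mul]
      · rcases Nat.lt_or_ge j (2 ^ d - 1) with h' | h'
        · exact hs j h h'
        · have : j = 2 ^ d - 1 := by
            have := Finset.mem_range.1 hj; omega
          rw [this]; exact hM'
    rw [this]; ring
  exact even_iff_two_dvd.2 ((CharP.cast_eq_zero_iff F 2 _).1 h0)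

lemma fib_two (hF : Fintype.card F = 2 ^ d) (hd : 2 ≤ d) (hk : 1 ≤ k)
    (hc : Nat.Coprime (k - 1) (2 ^ d - 1))
    (hs : ∀ j, 0 < j → j < 2 ^ d - 1 → ∑ x : F, (x + x ^ k) ^ j = 0) (y : F) : fib k y = 0 ∨ fib k y = 2 := by
  have h1 : ∑ y : F, fib k y = 2 ^ d := by
    rw [← hF, ← Finset.card_univ]
    exact (Finset.card_eq_sum_card_fiberwise (f := fun x : F => x + x ^ k) (t := univ) (by simp)).symm
  have h2 : ∑ y : F, fib k y * fib k y ≤ 2 * 2 ^ d := by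
    refine le_trans (le_of_eq ?_) (pair_count (F := F) hF hk hc)
    rw [Finset.card_eq_sum_card_fiberwise (f := fun q : F × F => q.1 + q.1 ^ k) (t := univ) (by simp)]
    apply Finset.sum_congr rfl
    intro y _
    rw [fib, ← Finset.card_product]
    congr 1
    ext q
    simp only [mem_product, mem_filter, mem_univ, true_and]
    constructor
    · rintro ⟨a, b⟩; exact ⟨a.trans b.symm, a⟩
    · rintro ⟨a, b⟩; exact ⟨b, a.symm.trans b⟩
  have h3 : ∀ y : F, 2 * fib k y ≤ fib k y * fib k y := by
    intro y
    obtain ⟨m, hm⟩ := fib_even hF hd hk hc hs y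
    rw [hm]
    rcases Nat.eq_zero_or_pos m with rfl | h
    · simp
    · apply Nat.mul_le_mul_right; omega
  have h4 : ∑ y : F, 2 * fib k y = ∑ y : F, fib k y * fib k y := by
    apply le_antisymm (Finset.sum_le_sum fun y _ => h3 y)
    rw [← Finset.mul_sum, h1]; exact h2
  have h5 := (Finset.sum_eq_sum_iff_of_le (fun y _ => h3 y)).1 h4 y (mem_univ y)
  rcases Nat.eq_zero_or_pos (fib k y) with h | h
  · exact Or.inl h
  · exact Or.inr (Nat.eq_of_mul_eq_mul_right h h5).symm

/-- The power sums of the image. -/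
lemma sum_D (hF : Fintype.card F = 2 ^ d) (hd : 2 ≤ d) (hk : 1 ≤ k) (hgp : g * p = 1) (hz : ZL g k)
    (μ : Finset (ZMod d)) (hμ : μ ≠ ∅) (hμ' : μ ≠ univ) :
    ∑ y ∈ univ.image (fun x : F => x + x ^ k), y ^ ex g μ = ((Y g p k μ).card : F) := by
  obtain ⟨R, _, ρ, t, h1, h4, h0, h2, h3⟩ := exists_ring F
  have hc := ZL_coprime hd hgp hk hz
  have ρ2 : ρ 2 = 0 := by rw [map_ofNat]; exact CharTwo.two_eq_zero
  have hs : ∀ j, 0 < j → j < 2 ^ d - 1 → ∑ x : F, (x + x ^ k) ^ j = 0 := by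
    intro j hj hj'
    obtain ⟨ν, hν⟩ := ex_surj hgp j hj'.le
    have := congrArg ρ (sum_tau h1 h4 h0 h2 hgp hF hd hk hz ν
      (by rintro rfl; rw [ex_empty] at hν; omega) (by rintro rfl; rw [ex_univ hgp] at hν; omega))
    rw [map_sum, map_mul, ρ2, zero_mul, hν] at this
    simpa [h1] using this
  have hE : 0 < ex g μ := Finset.sum_pos (fun n _ => P_pos g n) (nonempty_iff_ne_empty.2 hμ)
  have e := sum_tau h1 h4 h0 h2 hgp hF hd hk hz μ hμ hμ'
  have e2 : ∑ x : F, t (x + x ^ k) ^ ex g μ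
      = 2 * ∑ y ∈ univ.image (fun x : F => x + x ^ k), t y ^ ex g μ := by
    rw [← Finset.sum_fiberwise_of_maps_to (s := univ) (t := univ.image (fun x : F => x + x ^ k))
      (g := fun x : F => x + x ^ k) (fun x _ => mem_image_of_mem _ (mem_univ x)), Finset.mul_sum]
    apply Finset.sum_congr rfl
    intro y hy
    rw [Finset.sum_congr rfl (g := fun _ => t y ^ ex g μ) (by
      intro x hx; rw [(mem_filter.1 hx).2]), Finset.sum_const]
    have h5 : (univ.filter fun x : F => x + x ^ k = y).card = 2 := by
      rcases fib_two hF hd hk hc hs y with h | h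
      · exfalso
        obtain ⟨x, _, hx⟩ := mem_image.1 hy
        rw [fib, Finset.card_eq_zero] at h
        have : x ∈ (univ.filter fun x : F => x + x ^ k = y) := by simp [hx]
        rw [h] at this; simp at this
      · exact h
    rw [h5, nsmul_eq_mul]; norm_num
  rw [e2] at e
  have e3 := h3 (∑ y ∈ univ.image (fun x : F => x + x ^ k), t y ^ ex g μ - (Y g p k μ).card) (by
    rw [mul_sub, e, sub_self])
  rw [map_sub, map_natCast, map_sum, sub_eq_zero] at e3
  simpa [h1] using e3
end
end GD

set_option linter.unusedSectionVars false
namespace GD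
open Finset

section
variable {d : ℕ} [NeZero d] {g p : ZMod d} {k : ℕ}

lemma mem_Y {μ : Finset (ZMod d)} {i : ZMod d} {B : Finset (ZMod d)} : (⟨i, B⟩ : Σ _ : ZMod d, Finset (ZMod d)) ∈ Y g p k μ ↔
    i ∈ μ ∧ B ⊆ μ.erase i ∧
    (2 ^ d - 1) ∣ (1 + k) * P g (i - p) + ex g (μ.erase i \ B) + k * ex g B := by
  simp only [Y, mem_filter, mem_sigma, mem_powerset, and_assoc]

lemma p_ne_zero (hd : 2 ≤ d) (hgp : g * p = 1) : p ≠ 0 := by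
  rintro rfl
  rw [mul_zero] at hgp
  have : Fact (1 < d) := ⟨hd⟩
  exact zero_ne_one hgp

lemma sub_p_ne (hd : 2 ≤ d) (hgp : g * p = 1) (i : ZMod d) : i - p ≠ i := by
  intro h
  exact p_ne_zero hd hgp (by simpa using h)

/-- `i - p` is not in the word. -/
lemma Y_not_mem (hd : 2 ≤ d) (hgp : g * p = 1) (hz : ZL g k) {μ : Finset (ZMod d)} {i : ZMod d}
    {B : Finset (ZMod d)} (h : (⟨i, B⟩ : Σ _ : ZMod d, Finset (ZMod d)) ∈ Y g p k μ) : i - p ∉ μ := by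
  rw [mem_Y] at h
  obtain ⟨hi, hB, hdv⟩ := h
  intro hip
  have hne := sub_p_ne hd hgp i
  have hiB : i ∉ B := fun h => (notMem_erase i μ) (hB h)
  set A := μ.erase i \ B with hA
  have hiA : i ∉ A := by simp [hA]
  have hdAB : Disjoint A B := disjoint_sdiff_self_left
  have hPm := P_step_mod hgp i
  by_cases hb : i - p ∈ B
  · -- move
    have hbA : i - p ∉ A := fun h => (Finset.disjoint_left.1 hdAB h) hb
    have := hz (insert (i - p) A) (insert i (B.erase (i - p))) (by
      rw [Finset.disjoint_insert_right, Finset.disjoint_insert_left]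
      refine ⟨by simp [hne.symm, hiA], by simp, hdAB.mono_right (erase_subset _ _)⟩) (by
      rw [ex_insert g hbA, ex_insert g (by simp [hiB])]
      have e := ex_erase g hb
      refine (Nat.ModEq.dvd_iff ?_ (dvd_refl _)).2 hdv
      rw [← e]
      calc P g (i - p) + ex g A + k * (P g i + ex g (B.erase (i - p)))
          ≡ P g (i - p) + ex g A + k * (2 * P g (i - p) + ex g (B.erase (i - p))) [MOD 2 ^ d - 1] := by
            gcongr
        _ = _ := by ring)
    rcases this with h | h
    · exact insert_ne_empty _ _ h
    · have : i - p ∈ insert i (B.erase (i - p)) := by rw [h]; exact mem_univ _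
      simp [hne] at this
  · have hbA : i - p ∈ A := by simp [hA, hb, hne, hip]
    have := hz (insert i (A.erase (i - p))) (insert (i - p) B) (by
      rw [Finset.disjoint_insert_left, Finset.disjoint_insert_right]
      refine ⟨by simp [hne.symm, hiB], by simp, hdAB.mono_left (erase_subset _ _)⟩) (by
      rw [ex_insert g hb, ex_insert g (by simp [hiA])]
      have e := ex_erase g hbA
      refine (Nat.ModEq.dvd_iff ?_ (dvd_refl _)).2 hdv
      rw [← e]
      calc P g i + ex g (A.erase (i - p)) + k * (P g (i - p) + ex g B)
          ≡ 2 * P g (i - p) + ex g (A.erase (i - p)) + k * (P g (i - p) + ex g B) [MOD 2 ^ d - 1] := by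
            gcongr
        _ = _ := by ring)
    rcases this with h | h
    · exact insert_ne_empty _ _ h
    · have : i ∈ insert (i - p) B := by rw [h]; exact mem_univ _
      simp [hne.symm, hiB] at this

lemma Y_unique (hd : 2 ≤ d) (hgp : g * p = 1) (hk : 1 ≤ k) (hz : ZL g k) {μ : Finset (ZMod d)}
    {i i' : ZMod d} {B B' : Finset (ZMod d)} (h : (⟨i, B⟩ : Σ _ : ZMod d, Finset (ZMod d)) ∈ Y g p k μ)
    (h' : (⟨i', B'⟩ : Σ _ : ZMod d, Finset (ZMod d)) ∈ Y g p k μ) : i = i' ∧ B = B' := by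
  have key : ∀ (i : ZMod d) (B : Finset (ZMod d)), (⟨i, B⟩ : Σ _ : ZMod d, Finset (ZMod d)) ∈ Y g p k μ →
      ∃ A1 B1 : Finset (ZMod d), A1 ∩ B1 = {i - p} ∧ B = B1.erase (i - p) ∧ A1 ≠ univ ∧ B1 ≠ univ ∧
      ex g A1 + ex g B1 ≡ ex g μ [MOD (2 ^ d - 1)] ∧
      ex g μ + (k - 1) * ex g B1 ≡ 0 [MOD (2 ^ d - 1)] := by
    intro i B h
    have hip := Y_not_mem hd hgp hz h
    rw [mem_Y] at h
    obtain ⟨hi, hB, hdv⟩ := h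
    have hne := sub_p_ne hd hgp i
    have hiB : i ∉ B := fun h => (notMem_erase i μ) (hB h)
    set A := μ.erase i \ B with hA
    have hiA : i ∉ A := by simp [hA]
    have hipB : i - p ∉ B := fun h => hip (mem_of_mem_erase (hB h))
    have hipA : i - p ∉ A := by simp [hA, hip]
    have hdAB : Disjoint A B := disjoint_sdiff_self_left
    have hPm := P_step_mod hgp i
    have hmu : ex g A + ex g B + P g i = ex g μ := by
      rw [← ex_erase g hi, add_comm]; congr 1; exact Finset.sum_sdiff hB
    have e1 : ex g (insert (i - p) A) + ex g (insert (i - p) B) ≡ ex g μ [MOD (2 ^ d - 1)] := by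
      rw [ex_insert g hipA, ex_insert g hipB, ← hmu]
      calc P g (i - p) + ex g A + (P g (i - p) + ex g B) = ex g A + ex g B + 2 * P g (i - p) := by ring
        _ ≡ _ [MOD 2 ^ d - 1] := by gcongr
    refine ⟨insert (i - p) A, insert (i - p) B, ?_, by simp [hipB], ?_, ?_, e1, ?_⟩
    · rw [← Finset.insert_inter_distrib, Finset.disjoint_iff_inter_eq_empty.1 hdAB]; rfl
    · intro h
      have : i ∈ insert (i - p) A := by rw [h]; exact mem_univ _
      simp [hne.symm, hiA] at this
    · intro h
      have : i ∈ insert (i - p) B := by rw [h]; exact mem_univ _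
      simp [hne.symm, hiB] at this
    · refine ((Nat.ModEq.add_right _ e1).symm).trans ?_
      rw [Nat.modEq_zero_iff_dvd]
      convert hdv using 1
      rw [ex_insert g hipA, ex_insert g hipB]
      obtain ⟨k', rfl⟩ := Nat.exists_eq_add_of_le hk
      simp only [Nat.add_sub_cancel_left]; ring
  obtain ⟨A1, B1, hi1, hb1, ha1u, hb1u, h1, h1'⟩ := key i B h
  obtain ⟨A2, B2, hi2, hb2, ha2u, hb2u, h2, h2'⟩ := key i' B' h'
  have hc := ZL_coprime hd hgp hk hz
  have eB : B1 = B2 := by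
    apply ex_modEq hgp hb1u hb2u
    apply Nat.ModEq.cancel_left_of_coprime (c := k - 1)
    · rw [Nat.gcd_comm]; exact hc
    · exact Nat.ModEq.add_left_cancel' (ex g μ) (h1'.trans h2'.symm)
  subst eB
  have eA : A1 = A2 := by
    apply ex_modEq hgp ha1u ha2u
    exact Nat.ModEq.add_right_cancel' (ex g B1) (h1.trans h2.symm)
  subst eA
  have : i - p = i' - p := by rw [hi1] at hi2; simpa using hi2
  have hii : i = i' := by simpa using this
  exact ⟨hii, by rw [hb1, hb2, this]⟩

def sh (j : ZMod d) (A : Finset (ZMod d)) : Finset (ZMod d) := A.map (Equiv.addRight j).toEmbedding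

lemma mem_sh {j x : ZMod d} {A : Finset (ZMod d)} : x ∈ sh j A ↔ x - j ∈ A := by
  simp [sh, Finset.mem_map_equiv, sub_eq_add_neg]

lemma sh_inj {j : ZMod d} {A B : Finset (ZMod d)} (h : sh j A = sh j B) : A = B := by
  ext x
  have := congrArg (fun s => x + j ∈ s) h
  simpa [mem_sh] using this

lemma ex_sh (j : ZMod d) (A : Finset (ZMod d)) : ex g (sh j A) ≡ P g j * ex g A [MOD (2 ^ d - 1)] := by
  rw [ex, sh, Finset.sum_map, ex, Finset.mul_sum]
  apply Nat.ModEq.sum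
  intro n _
  simp only [Equiv.coe_toEmbedding, Equiv.coe_addRight]
  rw [mul_comm]; exact P_add g n j

def Sol (g p : ZMod d) (k : ℕ) : Finset (Finset (ZMod d) × Finset (ZMod d)) :=
  univ.filter fun q => Disjoint q.1 q.2 ∧ (0 ∉ q.1 ∧ 0 ∉ q.2) ∧ (p ∉ q.1 ∧ p ∉ q.2) ∧
    (2 ^ d - 1) ∣ (1 + k) + ex g q.1 + k * ex g q.2

lemma card_Y (hd : 2 ≤ d) (hgp : g * p = 1) (hk : 1 ≤ k) (hz : ZL g k) :
    (univ.filter fun μ : Finset (ZMod d) => (Y g p k μ).Nonempty).card = d * (Sol g p k).card := by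
  have : d * (Sol g p k).card = ((univ : Finset (ZMod d)) ×ˢ Sol g p k).card := by
    rw [card_product, card_univ, ZMod.card]
  rw [this]
  symm
  have inY : ∀ q ∈ ((univ : Finset (ZMod d)) ×ˢ Sol g p k),
      (⟨p + q.1, sh q.1 q.2.2⟩ : Σ _ : ZMod d, Finset (ZMod d)) ∈ Y g p k (insert (p + q.1) (sh q.1 q.2.1 ∪ sh q.1 q.2.2)) ∧
      (insert (p + q.1) (sh q.1 q.2.1 ∪ sh q.1 q.2.2)).erase (p + q.1) \ sh q.1 q.2.2 = sh q.1 q.2.1 := by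
    rintro ⟨j, A, B⟩ h
    simp only [Sol, mem_product, mem_univ, mem_filter, true_and] at h ⊢
    obtain ⟨hAB, ⟨h0A, h0B⟩, ⟨hpA, hpB⟩, hdv⟩ := h
    have hAB' : Disjoint (sh j A) (sh j B) := by
      rw [Finset.disjoint_left] at hAB ⊢
      intro x; rw [mem_sh, mem_sh]; exact @hAB _
    have hnot : p + j ∉ sh j A ∪ sh j B := by simp [mem_sh, hpA, hpB]
    have e : (insert (p + j) (sh j A ∪ sh j B)).erase (p + j) \ sh j B = sh j A := by
      rw [erase_insert hnot, union_sdiff_right, sdiff_eq_self_of_disjoint hAB']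
    refine ⟨?_, e⟩
    rw [mem_Y]
    refine ⟨mem_insert_self _ _, by rw [erase_insert hnot]; exact subset_union_right, ?_⟩
    rw [e, add_sub_cancel_left]
    refine (Nat.ModEq.dvd_iff ?_ (dvd_refl _)).2 (hdv.mul_left (P g j))
    calc (1 + k) * P g j + ex g (sh j A) + k * ex g (sh j B)
        ≡ (1 + k) * P g j + P g j * ex g A + k * (P g j * ex g B) [MOD 2 ^ d - 1] := by
          gcongr <;> exact ex_sh j _
      _ = _ := by ring
  apply Finset.card_nbij (fun q => insert (p + q.1) (sh q.1 q.2.1 ∪ sh q.1 q.2.2))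
  · intro q hq
    simp only [coe_filter, mem_univ, true_and, Set.mem_ofPred_eq]
    exact ⟨_, (inY q hq).1⟩
  · intro q hq q' hq' he
    obtain ⟨h1, h1'⟩ := inY q hq
    obtain ⟨h2, h2'⟩ := inY q' hq'
    simp only at he
    rw [← he] at h2 h2'
    obtain ⟨e1, e2⟩ := Y_unique hd hgp hk hz h1 h2
    obtain ⟨j, A, B⟩ := q
    obtain ⟨j', A', B'⟩ := q'
    simp only at *
    have hj : j = j' := by simpa using e1
    subst hj
    have hB := sh_inj e2
    subst hB
    have hA := sh_inj (h1'.symm.trans h2')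
    rw [hA]
  · intro μ hμ
    simp only [coe_filter, mem_univ, true_and, Set.mem_ofPred_eq] at hμ
    obtain ⟨⟨i, B⟩, hq⟩ := hμ
    have hip := Y_not_mem hd hgp hz hq
    rw [mem_Y] at hq
    obtain ⟨hi, hB, hdv⟩ := hq
    have hiB : i ∉ B := fun h => (notMem_erase i μ) (hB h)
    set A := μ.erase i \ B with hA
    have hiA : i ∉ A := by simp [hA]
    have hipB : i - p ∉ B := fun h => hip (mem_of_mem_erase (hB h))
    have hipA : i - p ∉ A := by simp [hA, hip]
    have hdAB : Disjoint A B := disjoint_sdiff_self_left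
    have hs : ∀ C : Finset (ZMod d), sh (i - p) (sh (-(i - p)) C) = C := by
      intro C; ext x; rw [mem_sh, mem_sh]; simp only [sub_neg_eq_add, sub_add_cancel]
    refine ⟨⟨i - p, sh (-(i - p)) A, sh (-(i - p)) B⟩, ?_, ?_⟩
    · simp only [Sol, coe_product, coe_filter, Set.mem_prod, coe_univ, Set.mem_univ, mem_univ, true_and,
        Set.mem_ofPred_eq]
      refine ⟨?_, ⟨?_, ?_⟩, ⟨?_, ?_⟩, ?_⟩
      · rw [Finset.disjoint_left] at hdAB ⊢
        intro x; rw [mem_sh, mem_sh]; exact @hdAB _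
      · simpa [mem_sh] using hipA
      · simpa [mem_sh] using hipB
      · simpa [mem_sh] using hiA
      · simpa [mem_sh] using hiB
      · refine (Nat.ModEq.dvd_iff ?_ (dvd_refl _)).2 (hdv.mul_left (P g (-(i - p))))
        have h1 : P g (-(i - p)) * P g (i - p) ≡ 1 [MOD 2 ^ d - 1] := by
          have := P_add g (-(i - p)) (i - p)
          rw [neg_add_cancel, P_zero] at this
          exact this.symm
        calc (1 + k) + ex g (sh (-(i - p)) A) + k * ex g (sh (-(i - p)) B)
            ≡ (1 + k) * 1 + P g (-(i - p)) * ex g A + k * (P g (-(i - p)) * ex g B) [MOD 2 ^ d - 1] := by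
              rw [mul_one]
              gcongr <;> exact ex_sh _ _
          _ ≡ (1 + k) * (P g (-(i - p)) * P g (i - p)) + P g (-(i - p)) * ex g A + k * (P g (-(i - p)) * ex g B) [MOD 2 ^ d - 1] := by
              gcongr
          _ = _ := by ring
    · simp only [hs]
      rw [hA, sdiff_union_of_subset hB, add_sub_cancel, insert_erase hi]
end

section
variable {d : ℕ} [NeZero d] {g p : ZMod d} {k : ℕ}
variable {F : Type} [Field F] [Fintype F] [DecidableEq F] [CharP F 2]

open Classical in
/-- Exponents with nonvanishing power sum. -/
noncomputable def supp (M : ℕ) [NeZero M] (D : Set Fˣ) : Finset (ZMod M) :=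
  univ.filter fun m => m ≠ 0 ∧ ∑ u ∈ univ.filter (fun u : Fˣ => u ∈ D), (u : F) ^ m.val ≠ 0

lemma card_supp (hd : 2 ≤ d) [NeZero (2 ^ d - 1)] (hF : Fintype.card F = 2 ^ d) (hk : 1 ≤ k) (hgp : g * p = 1)
    (hz : ZL g k) :
    (supp (2 ^ d - 1) {u : Fˣ | ∃ x : F, x + x ^ k = (u : F)}).card = d * (Sol g p k).card := by
  classical
  rw [← card_Y hd hgp hk hz]
  have hM : 0 < 2 ^ d - 1 := Nat.pos_of_ne_zero (NeZero.ne _)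
  -- the sum over units is the sum over the image
  have hsum : ∀ E, 0 < E → ∑ u ∈ univ.filter (fun u : Fˣ => u ∈ {u : Fˣ | ∃ x : F, x + x ^ k = (u : F)}), (u : F) ^ E
      = ∑ y ∈ univ.image (fun x : F => x + x ^ k), y ^ E := by
    intro E hE
    rw [← Finset.sum_filter_of_ne (s := univ.image (fun x : F => x + x ^ k)) (p := fun y => y ≠ 0)]
    · apply Finset.sum_bij (fun (u : Fˣ) _ => (u : F))
      · intro u hu
        simp only [mem_filter, mem_univ, true_and, Set.mem_ofPred_eq] at hu
        simpa using hu
      · intro a _ b _ h; exact Units.ext h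
      · intro y hy
        simp only [mem_filter, mem_image, mem_univ, true_and] at hy
        exact ⟨Units.mk0 y hy.2, by simpa using hy.1, rfl⟩
      · intro a _; rfl
    · intro y _ h
      rintro rfl
      rw [zero_pow hE.ne'] at h; exact h rfl
  have hval : ∀ μ : Finset (ZMod d), μ ≠ univ → ((ex g μ : ℕ) : ZMod (2 ^ d - 1)).val = ex g μ := by
    intro μ hμ
    apply ZMod.val_cast_of_lt
    exact lt_of_le_of_ne (ex_le hgp μ) (fun h => hμ (ex_inj hgp (h.trans (ex_univ hgp).symm)))
  have hprop : ∀ μ : Finset (ZMod d), (Y g p k μ).Nonempty → μ ≠ ∅ ∧ μ ≠ univ := by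
    rintro μ ⟨⟨i, B⟩, h⟩
    have h1 := Y_not_mem hd hgp hz h
    constructor
    · rintro rfl; rw [mem_Y] at h; simp at h
    · rintro rfl; exact h1 (mem_univ _)
  have hcard : ∀ μ : Finset (ZMod d), ((Y g p k μ).card : F) ≠ 0 ↔ (Y g p k μ).Nonempty := by
    intro μ
    constructor
    · intro h
      rw [nonempty_iff_ne_empty]; rintro h'; rw [h'] at h; simp at h
    · intro h
      have : (Y g p k μ).card = 1 := by
        rw [Finset.card_eq_one]
        obtain ⟨⟨i, B⟩, hq⟩ := h
        refine ⟨⟨i, B⟩, Finset.eq_singleton_iff_unique_mem.2 ⟨hq, ?_⟩⟩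
        rintro ⟨i', B'⟩ h'
        obtain ⟨rfl, rfl⟩ := Y_unique hd hgp hk hz hq h'
        rfl
      rw [this]; simp
  have hpos : ∀ μ : Finset (ZMod d), μ ≠ ∅ → 0 < ex g μ := fun μ h1 =>
    Finset.sum_pos (fun n _ => P_pos g n) (nonempty_iff_ne_empty.2 h1)
  simp only [Set.mem_ofPred_eq] at hsum
  have hcast : ∀ μ : Finset (ZMod d), μ ≠ ∅ → μ ≠ univ → ((ex g μ : ℕ) : ZMod (2 ^ d - 1)) ≠ 0 := by
    intro μ h1 h2 h3
    have := hval μ h2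
    rw [h3, ZMod.val_zero] at this
    exact ex_not_dvd hgp h2 h1 (by rw [← this]; exact dvd_zero _)
  symm
  apply Finset.card_nbij (fun μ => ((ex g μ : ℕ) : ZMod (2 ^ d - 1)))
  · intro μ hμ
    simp only [coe_filter, mem_univ, true_and, Set.mem_ofPred_eq] at hμ
    obtain ⟨h1, h2⟩ := hprop μ hμ
    simp only [supp, coe_filter, mem_univ, true_and, Set.mem_ofPred_eq]
    refine ⟨hcast μ h1 h2, ?_⟩
    rw [hval μ h2, hsum _ (hpos μ h1),
      sum_D hF hd hk hgp hz μ h1 h2]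
    exact (hcard μ).2 hμ
  · intro μ hμ ν hν h
    simp only [coe_filter, mem_univ, true_and, Set.mem_ofPred_eq] at hμ hν h
    have := congrArg ZMod.val h
    rw [hval μ (hprop μ hμ).2, hval ν (hprop ν hν).2] at this
    exact ex_inj hgp this
  · intro m hm
    simp only [supp, coe_filter, mem_univ, true_and, Set.mem_ofPred_eq] at hm
    obtain ⟨hm0, hms⟩ := hm
    obtain ⟨μ, hμ⟩ := ex_surj hgp m.val (ZMod.val_lt m).le
    have h1 : μ ≠ ∅ := by
      rintro rfl; rw [ex_empty] at hμ; exact hm0 ((ZMod.val_eq_zero m).1 hμ.symm)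
    have h2 : μ ≠ univ := by
      rintro rfl; rw [ex_univ hgp] at hμ; have := ZMod.val_lt m; omega
    refine ⟨μ, ?_, ?_⟩
    · simp only [coe_filter, mem_univ, true_and, Set.mem_ofPred_eq]
      rw [← hcard, ← sum_D hF hd hk hgp hz μ h1 h2, ← hsum _ (hpos μ h1), hμ]
      exact hms
    · simp only; rw [hμ]; exact ZMod.natCast_zmod_val m

lemma supp_equiv (hd : 2 ≤ d) [NeZero (2 ^ d - 1)] (hF : Fintype.card F = 2 ^ d) (D₁ D₂ : Set Fˣ)
    (t : ℤ) (ht : t.gcd (2 ^ d - 1) = 1) (a : Fˣ) (h : D₁ = (fun x => x ^ t * a) '' D₂) :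
    (supp (2 ^ d - 1) D₁).card = (supp (2 ^ d - 1) D₂).card := by
  classical
  have hM : 0 < 2 ^ d - 1 := Nat.pos_of_ne_zero (NeZero.ne _)
  have hMc : (((2 ^ d - 1 : ℕ)) : ℤ) = 2 ^ d - 1 := by
    rw [Nat.cast_sub (two_pow_ge d)]; push_cast; rfl
  have hord : ∀ u : Fˣ, u ^ (2 ^ d - 1) = 1 := by
    intro u
    have := pow_card_eq_one (x := u)
    rwa [Fintype.card_units, hF] at this
  have hz : ∀ (u : Fˣ) (x y : ℤ), ((x : ℤ) : ZMod (2 ^ d - 1)) = y → u ^ x = u ^ y := by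
    intro u x y hxy
    rw [ZMod.intCast_eq_intCast_iff_dvd_sub] at hxy
    obtain ⟨c, hc⟩ := hxy
    have : y = x + ((2 ^ d - 1 : ℕ) : ℤ) * c := by rw [← hc]; ring
    rw [this, zpow_add, zpow_mul, zpow_natCast, hord, one_zpow, mul_one]
  have htu : IsUnit ((t : ZMod (2 ^ d - 1))) := by
    rw [ZMod.coe_int_isUnit_iff_isCoprime, hMc, isCoprime_comm, Int.isCoprime_iff_gcd_eq_one]
    exact ht
  have hinj : Function.Injective (fun x : Fˣ => x ^ t * a) := by
    intro x y hxy
    have hxy : x ^ t = y ^ t := mul_right_cancel hxy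
    obtain ⟨s, hs⟩ := htu.exists_right_inv
    obtain ⟨s', rfl⟩ := ZMod.intCast_surjective s
    have h1 : ∀ x : Fˣ, (x ^ t) ^ s' = x := by
      intro x
      rw [← zpow_mul, hz x (t * s') 1 (by push_cast; exact hs), zpow_one]
    rw [← h1 x, hxy, h1]
  have hsum : ∀ m : ZMod (2 ^ d - 1), ∑ u ∈ univ.filter (fun u : Fˣ => u ∈ D₁), (u : F) ^ m.val
      = (a : F) ^ m.val * ∑ u ∈ univ.filter (fun u : Fˣ => u ∈ D₂), (u : F) ^ ((t : ZMod (2 ^ d - 1)) * m).val := by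
    intro m
    have e : univ.filter (fun u : Fˣ => u ∈ D₁) = (univ.filter (fun u : Fˣ => u ∈ D₂)).image (fun x => x ^ t * a) := by
      ext u; simp [h]
    rw [e, Finset.sum_image (fun x _ y _ hxy => hinj hxy), Finset.mul_sum]
    apply Finset.sum_congr rfl
    intro u _
    rw [← Units.val_pow_eq_pow_val, ← Units.val_pow_eq_pow_val, ← Units.val_pow_eq_pow_val, ← Units.val_mul]
    congr 1
    rw [mul_pow, mul_comm]
    congr 1
    rw [← zpow_natCast, ← zpow_natCast, ← zpow_mul]
    apply hz
    push_cast
    simp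
  apply Finset.card_nbij (fun m => (t : ZMod (2 ^ d - 1)) * m)
  · intro m hm
    simp only [supp, coe_filter, mem_univ, true_and, Set.mem_ofPred_eq] at hm ⊢
    refine ⟨?_, ?_⟩
    · intro h0; exact hm.1 ((htu.mul_right_eq_zero).1 h0)
    · rw [hsum] at hm; exact right_ne_zero_of_mul hm.2
  · intro m _ m' _ he
    exact htu.mul_left_cancel he
  · intro m hm
    simp only [supp, coe_filter, mem_univ, true_and, Set.mem_ofPred_eq] at hm
    obtain ⟨s, hs⟩ := htu.exists_right_inv
    have e : (t : ZMod (2 ^ d - 1)) * (s * m) = m := by rw [← mul_assoc, hs, one_mul]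
    refine ⟨s * m, ?_, e⟩
    simp only [supp, coe_filter, mem_univ, true_and, Set.mem_ofPred_eq]
    refine ⟨?_, ?_⟩
    · intro h0; rw [h0, mul_zero] at e; exact hm.1 e.symm
    · rw [hsum, e]; exact mul_ne_zero (pow_ne_zero _ (Units.ne_zero a)) hm.2
end
end GD

set_option linter.unusedSectionVars false
namespace GD
open Finset

section
variable {d : ℕ} [NeZero d] {g p : ZMod d} {k : ℕ}

/-- integer version of `2^d - 1` -/
def MZ (d : ℕ) : ℤ := ((2 ^ d - 1 : ℕ) : ℤ)

lemma MZ_pos (hd : 2 ≤ d) : 0 < MZ d := by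
  have : 2 ^ 2 ≤ 2 ^ d := Nat.pow_le_pow_right (by norm_num) hd
  unfold MZ; omega

lemma PZ_step (hgp : g * p = 1) (n : ZMod d) :
    2 * (P g (n - p) : ℤ) = P g n + if n = 0 then MZ d else 0 := by
  have := P_step hgp n
  split_ifs at this ⊢
  · unfold MZ; exact_mod_cast this
  · exact_mod_cast this

lemma kernel_sum (hgp : g * p = 1) (f e : ZMod d → ℤ) (h : ∀ n, f n = 2 * e (n + p) - e n) (i : ZMod d) :
    ∑ j, f (i + j) * P g j = MZ d * e i := by
  have e1 : ∑ j, e (i + j + p) * (2 * (P g j : ℤ)) = ∑ j, e (i + j) * (2 * (P g (j - p) : ℤ)) := by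
    rw [← Equiv.sum_comp (Equiv.subRight p)]
    apply Finset.sum_congr rfl
    intro j _
    simp only [Equiv.subRight_apply]
    congr 2; ring
  calc ∑ j, f (i + j) * P g j = ∑ j, (e (i + j + p) * (2 * (P g j : ℤ)) - e (i + j) * P g j) := by
        apply Finset.sum_congr rfl; intro j _; rw [h]; ring
    _ = ∑ j, e (i + j) * (if j = 0 then MZ d else 0) := by
        rw [Finset.sum_sub_distrib, e1, ← Finset.sum_sub_distrib]
        apply Finset.sum_congr rfl; intro j _; rw [PZ_step hgp]; ring
    _ = _ := by simp [mul_comm]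

lemma PZ_add (i j : ZMod d) : MZ d ∣ (P g (i + j) : ℤ) - P g i * P g j := by
  have := (Nat.modEq_iff_dvd.1 (P_add g i j))
  rw [← neg_sub, dvd_neg]; push_cast at this; exact this

lemma shift_sum (f : ZMod d → ℤ) (i : ZMod d) :
    MZ d ∣ ∑ n, f (n - i) * P g n - P g i * ∑ n, f n * P g n := by
  rw [← Equiv.sum_comp (Equiv.addRight i), Finset.mul_sum, ← Finset.sum_sub_distrib]
  apply Finset.dvd_sum
  intro n _
  simp only [Equiv.coe_addRight, add_sub_cancel_right]
  have := (PZ_add (g := g) n i).mul_left (f n)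
  convert this using 1; ring

lemma kernel_exists (hd : 2 ≤ d) (hgp : g * p = 1) (f : ZMod d → ℤ) (h : MZ d ∣ ∑ n, f n * P g n) :
    ∃ e : ZMod d → ℤ, (∀ n, f n = 2 * e (n + p) - e n) ∧ ∀ i, ∑ j, f (i + j) * P g j = MZ d * e i := by
  have hM := MZ_pos hd
  have h1 : ∀ i, MZ d ∣ ∑ j, f (i + j) * P g j := by
    intro i
    have h2 := shift_sum (g := g) f (-i)
    have h3 : ∑ n, f (n - -i) * P g n = ∑ j, f (i + j) * P g j := by
      apply Finset.sum_congr rfl; intro j _; rw [sub_neg_eq_add, add_comm]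
    rw [h3] at h2
    exact (dvd_sub_left (h.mul_left _)).1 h2
  choose e he using h1
  refine ⟨e, ?_, he⟩
  intro n
  have e1 : ∑ j, f (n + p + j) * (2 * (P g j : ℤ)) = ∑ j, f (n + j) * (2 * (P g (j - p) : ℤ)) := by
    rw [← Equiv.sum_comp (Equiv.subRight p)]
    apply Finset.sum_congr rfl
    intro j _
    simp only [Equiv.subRight_apply]
    congr 2; ring
  have e2 : 2 * (MZ d * e (n + p)) = MZ d * e n + MZ d * f n := by
    rw [← he, ← he, Finset.mul_sum]
    calc ∑ j, 2 * (f (n + p + j) * (P g j : ℤ)) = ∑ j, f (n + p + j) * (2 * (P g j : ℤ)) := by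
          apply Finset.sum_congr rfl; intro j _; ring
      _ = ∑ j, (f (n + j) * P g j + f (n + j) * (if j = 0 then MZ d else 0)) := by
          rw [e1]; apply Finset.sum_congr rfl; intro j _; rw [PZ_step hgp]; ring
      _ = _ := by rw [Finset.sum_add_distrib]; simp [mul_comm]
  apply mul_left_cancel₀ hM.ne'
  linear_combination -e2

lemma sum_PZ (hgp : g * p = 1) : ∑ j : ZMod d, (P g j : ℤ) = MZ d := by
  have := ex_univ (d := d) hgp
  rw [ex] at this
  unfold MZ; rw [← this]; push_cast; rfl

lemma e_bound (hd : 2 ≤ d) (hgp : g * p = 1) (f e : ZMod d → ℤ) (w : ℤ)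
    (he : ∀ i, ∑ j, f (i + j) * P g j = MZ d * e i) (hl : ∀ n, -1 ≤ f n) (hu : ∀ n, f n ≤ w)
    (hl' : ∃ n, f n ≠ -1) (hu' : ∃ n, f n ≠ w) (i : ZMod d) : 0 ≤ e i ∧ e i < w := by
  have hM := MZ_pos hd
  have hP : ∀ j : ZMod d, (0 : ℤ) < P g j := fun j => by exact_mod_cast P_pos g j
  constructor
  · obtain ⟨n, hn⟩ := hl'
    have : ∑ j : ZMod d, (-1) * (P g j : ℤ) < ∑ j, f (i + j) * P g j := by
      apply Finset.sum_lt_sum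
      · intro j _; exact mul_le_mul_of_nonneg_right (hl _) (hP j).le
      · refine ⟨n - i, mem_univ _, mul_lt_mul_of_pos_right ?_ (hP _)⟩
        rw [add_sub_cancel]; exact lt_of_le_of_ne (hl n) hn.symm
    rw [he, ← Finset.mul_sum, sum_PZ hgp] at this
    by_contra hc
    have : e i ≤ -1 := by omega
    nlinarith
  · obtain ⟨n, hn⟩ := hu'
    have : ∑ j, f (i + j) * P g j < ∑ j : ZMod d, w * (P g j : ℤ) := by
      apply Finset.sum_lt_sum
      · intro j _; exact mul_le_mul_of_nonneg_right (hu _) (hP j).le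
      · refine ⟨n - i, mem_univ _, mul_lt_mul_of_pos_right ?_ (hP _)⟩
        rw [add_sub_cancel]; exact lt_of_le_of_ne (hu n) hn
    rw [he, ← Finset.mul_sum, sum_PZ hgp, mul_comm w] at this
    exact lt_of_mul_lt_mul_left this hM.le

lemma conv_sum (S : List ℕ) (hk : k = (S.map (fun j : ℕ => P g (j : ZMod d))).sum) (a : ZMod d → ℤ) :
    MZ d ∣ ∑ n, ((S.map (fun j : ℕ => a (n - (j : ZMod d)))).sum) * P g n - k * ∑ n, a n * P g n := by
  subst hk
  induction S with
  | nil => simp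
  | cons j S ih =>
    simp only [List.map_cons, List.sum_cons]
    have h1 := shift_sum (g := g) a (j : ZMod d)
    have := h1.add ih
    refine (dvd_of_eq rfl).trans (this.trans (dvd_of_eq ?_))
    simp only [add_mul, Finset.sum_add_distrib]
    push_cast
    ring
end

/-- Window automata. -/
structure Win (S : List ℕ) (p w m : ℕ) (St : Type) where
  al : St → ℕ → Bool
  el : St → ℕ → ℕ
  nxt : St → Bool → St
  bld : (ℕ → Bool) → (ℕ → ℕ) → St
  bld_al : ∀ f h j, 1 ≤ j → j ≤ m → al (bld f h) j = f j
  bld_el : ∀ f h, (∀ j < p, h j < w) → ∀ j < p, el (bld f h) j = h j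
  ext : ∀ s s', (∀ j, 1 ≤ j → j ≤ m → al s j = al s' j) → (∀ j < p, el s j = el s' j) → s = s'
  al_one : ∀ s b, al (nxt s b) 1 = b
  al_succ : ∀ s b j, 1 ≤ j → j < m → al (nxt s b) (j + 1) = al s j
  el_nxt : ∀ s b j, j + 1 < p → el (nxt s b) j = el s (j + 1)
  el_last : ∀ s b, el (nxt s b) (p - 1) = ((S.map (fun j => (al s j).toNat)).sum + el s 0) / 2
  el_lt : ∀ s j, j < p → el s j < w
  hS : ∀ j ∈ S, 1 ≤ j ∧ j ≤ m
  hw : w = S.length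
  hp : 1 ≤ p
  hm : 1 ≤ m

namespace Win
variable {S : List ℕ} {p w m : ℕ} {St : Type} (W : Win S p w m St)

def tt (s : St) : ℕ := (S.map (fun j => (W.al s j).toNat)).sum + W.el s 0
def c (s : St) : Bool := decide (W.tt s % 2 = 1)

variable {d : ℕ} [NeZero d] {g : ZMod d} {k : ℕ}

lemma walk_al {s : ZMod d → St} {a : ZMod d → Bool} (hs : ∀ n, s (n + 1) = W.nxt (s n) (a n)) :
    ∀ j, 1 ≤ j → j ≤ m → ∀ n, W.al (s n) j = a (n - j) := by
  intro j hj
  induction j, hj using Nat.le_induction with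
  | base =>
    intro _ n
    have := hs (n - 1)
    rw [sub_add_cancel] at this
    rw [this, W.al_one]; simp
  | succ j hj ih =>
    intro hm n
    have := hs (n - 1)
    rw [sub_add_cancel] at this
    rw [this, W.al_succ _ _ _ hj (by omega), ih (by omega)]
    congr 1; push_cast; ring

lemma walk_el {s : ZMod d → St} {a : ZMod d → Bool} (hs : ∀ n, s (n + 1) = W.nxt (s n) (a n)) :
    ∀ j, j < p → ∀ n, W.el (s n) j = W.el (s (n + j)) 0 := by
  intro j
  induction j with
  | zero => intro _ n; simp
  | succ j ih =>
    intro hj n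
    rw [← W.el_nxt (s n) (a n) j hj, ← hs, ih (by omega)]
    congr 2; push_cast; ring

lemma walk_eq {s : ZMod d → St} {a : ZMod d → Bool} (hs : ∀ n, s (n + 1) = W.nxt (s n) (a n)) (n : ZMod d) :
    ((S.map (fun j : ℕ => ((a (n - (j : ZMod d))).toNat : ℤ))).sum) - (W.c (s n)).toNat
      = 2 * (W.el (s (n + p)) 0 : ℤ) - W.el (s n) 0 := by
  have h1 : W.el (s (n + p)) 0 = W.tt (s n) / 2 := by
    have h2 := W.walk_el hs (p - 1) (by have := W.hp; omega) (n + 1)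
    have h3 : n + 1 + ((p - 1 : ℕ) : ZMod d) = n + p := by
      rw [Nat.cast_sub W.hp]; push_cast; ring
    rw [h3] at h2
    rw [← h2, hs, W.el_last]; rfl
  have h2 : ((S.map (fun j : ℕ => ((a (n - (j : ZMod d))).toNat : ℤ))).sum) + W.el (s n) 0 = W.tt (s n) := by
    unfold tt
    push_cast
    congr 1
    rw [List.map_map]
    congr 1
    apply List.map_congr_left
    intro j hj
    simp only [Function.comp]
    rw [W.walk_al hs j (W.hS j hj).1 (W.hS j hj).2]
  have h3 : (W.c (s n)).toNat = W.tt (s n) % 2 := by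
    unfold c
    rcases Nat.mod_two_eq_zero_or_one (W.tt (s n)) with h | h <;> simp [h]
  rw [h1, h3]
  omega

lemma list_sum_bound (S : List ℕ) (b : ℕ → Bool) : (S.map (fun j => (b j).toNat)).sum ≤ S.length := by
  induction S with
  | nil => simp
  | cons j S ih =>
    simp only [List.map_cons, List.sum_cons, List.length_cons]
    have := Bool.toNat_le (b j)
    omega

lemma list_sum_zero (S : List ℕ) (b : ℕ → Bool) (h : (S.map (fun j => (b j).toNat)).sum = 0) :
    ∀ j ∈ S, b j = false := by
  intro j hj
  have := List.sum_eq_zero_iff.1 h (b j).toNat (List.mem_map.2 ⟨j, hj, rfl⟩)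
  simpa using this

lemma list_sum_len (S : List ℕ) (b : ℕ → Bool) (h : (S.map (fun j => (b j).toNat)).sum = S.length) :
    ∀ j ∈ S, b j = true := by
  induction S with
  | nil => simp
  | cons j S ih =>
    simp only [List.map_cons, List.sum_cons, List.length_cons] at h
    have h1 := list_sum_bound S b
    have h2 := Bool.toNat_le (b j)
    have h3 : (b j).toNat = 1 := by omega
    intro i hi
    rcases List.mem_cons.1 hi with rfl | hi
    · simpa using h3
    · exact ih (by omega) i hi

lemma walk_exists (hd : 2 ≤ d) (hgp : g * (p : ZMod d) = 1) (hSne : S ≠ [])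
    (hk : k = (S.map (fun j : ℕ => P g (j : ZMod d))).sum) (a c : ZMod d → Bool)
    (ha0 : ∃ n, a n = true) (ha1 : ∃ n, a n = false)
    (h : MZ d ∣ k * ∑ n, ((a n).toNat : ℤ) * P g n - ∑ n, ((c n).toNat : ℤ) * P g n) :
    ∃ s : ZMod d → St, ∀ n, s (n + 1) = W.nxt (s n) (a n) ∧ W.c (s n) = c n := by
  set f : ZMod d → ℤ := fun n => ((S.map (fun j : ℕ => ((a (n - (j : ZMod d))).toNat : ℤ))).sum) - (c n).toNat with hf
  have hcast : ∀ n : ZMod d, ((S.map (fun j : ℕ => ((a (n - (j : ZMod d))).toNat : ℤ))).sum)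
      = (((S.map (fun j : ℕ => ((a (n - (j : ZMod d))).toNat))).sum : ℕ) : ℤ) := by
    intro n; push_cast; rw [List.map_map]; rfl
  have hb : ∀ n, f n = (((S.map (fun j : ℕ => ((a (n - (j : ZMod d))).toNat))).sum : ℕ) : ℤ) - (c n).toNat := by
    intro n; rw [hf]; simp only; rw [hcast]
  have hlen : ∀ n : ZMod d, (S.map (fun j : ℕ => ((a (n - (j : ZMod d))).toNat))).sum ≤ w := by
    intro n; rw [W.hw]; exact list_sum_bound S (fun j => a (n - (j : ZMod d)))
  obtain ⟨j0, hj0⟩ := List.exists_mem_of_ne_nil S hSne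
  have hdv : MZ d ∣ ∑ n, f n * P g n := by
    have h1 := (conv_sum (g := g) S hk (fun n => ((a n).toNat : ℤ))).add h
    refine h1.trans (dvd_of_eq ?_)
    rw [hf]
    simp only [sub_mul, Finset.sum_sub_distrib]
    ring
  obtain ⟨e, he1, he2⟩ := kernel_exists hd hgp f hdv
  have hc1 : ∀ n, ((c n).toNat : ℤ) ≤ 1 := fun n => by exact_mod_cast Bool.toNat_le (c n)
  have hbd := e_bound hd hgp f e w he2 (by
      intro n; rw [hb]; have := hc1 n; omega) (by
      intro n; rw [hb]; have := hlen n; omega) (by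
      obtain ⟨n, hn⟩ := ha0
      refine ⟨n + j0, ?_⟩
      rw [hb]; intro hh
      have := hc1 (n + j0)
      have h0 := list_sum_zero S (fun j => a (n + j0 - (j : ZMod d))) (by omega) j0 hj0
      simp only [add_sub_cancel_right] at h0
      rw [hn] at h0; cases h0) (by
      obtain ⟨n, hn⟩ := ha1
      refine ⟨n + j0, ?_⟩
      rw [hb]; intro hh
      have := hlen (n + j0)
      have hw := W.hw
      have h0 := list_sum_len S (fun j => a (n + j0 - (j : ZMod d))) (by omega) j0 hj0
      simp only [add_sub_cancel_right] at h0
      rw [hn] at h0; cases h0)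
  -- natural valued
  have hnat : ∀ i, ((e i).toNat : ℤ) = e i := fun i => Int.toNat_of_nonneg (hbd i).1
  have hlt : ∀ i, (e i).toNat < w := by intro i; have := (hbd i).2; have := hnat i; omega
  let s : ZMod d → St := fun n => W.bld (fun j => a (n - j)) (fun j => (e (n + j)).toNat)
  have sal : ∀ n j, 1 ≤ j → j ≤ m → W.al (s n) j = a (n - j) := fun n j h1 h2 => W.bld_al _ _ _ h1 h2
  have sel : ∀ n j, j < p → W.el (s n) j = (e (n + j)).toNat := fun n j h1 =>
    W.bld_el _ _ (fun j _ => hlt _) j h1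
  have htt : ∀ n, W.tt (s n) = (c n).toNat + 2 * (e (n + p)).toNat := by
    intro n
    unfold tt
    rw [sel n 0 W.hp]
    have h1 : (S.map (fun j => (W.al (s n) j).toNat)) = S.map (fun j : ℕ => ((a (n - (j : ZMod d))).toNat)) := by
      apply List.map_congr_left
      intro j hj
      rw [sal n j (W.hS j hj).1 (W.hS j hj).2]
    rw [h1]
    have h2 := he1 n
    rw [hb] at h2
    have h3 := hnat n
    have h4 := hnat (n + p)
    simp only [Nat.cast_zero, add_zero]
    omega
  refine ⟨s, fun n => ⟨?_, ?_⟩⟩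
  · apply W.ext
    · intro j h1 h2
      rcases Nat.eq_or_lt_of_le h1 with rfl | h1
      · rw [W.al_one, sal _ _ le_rfl h2]; simp
      · obtain ⟨j, rfl⟩ : ∃ i, j = i + 1 := ⟨j - 1, by omega⟩
        rw [W.al_succ _ _ _ (by omega) (by omega), sal _ _ (by omega) h2, sal _ _ (by omega) (by omega)]
        congr 1; push_cast; ring
    · intro j hj
      rcases Nat.lt_or_ge (j + 1) p with h1 | h1
      · rw [W.el_nxt _ _ _ h1, sel _ _ hj, sel _ _ h1]
        congr 2; push_cast; ring
      · have : j = p - 1 := by omega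
        subst this
        rw [W.el_last, sel _ _ hj]
        have h5 := htt n
        unfold tt at h5
        rw [h5]
        have h3 : n + 1 + ((p - 1 : ℕ) : ZMod d) = n + p := by
          rw [Nat.cast_sub W.hp]; push_cast; ring
        rw [h3]
        have := Bool.toNat_le (c n)
        have hcc : (c n).toNat < 2 := by omega
        omega
  · unfold Win.c
    rw [htt]
    cases c n <;> simp <;> omega

lemma walk_dvd (hgp : g * (p : ZMod d) = 1) (hk : k = (S.map (fun j : ℕ => P g (j : ZMod d))).sum)
    {s : ZMod d → St} {a : ZMod d → Bool} (hs : ∀ n, s (n + 1) = W.nxt (s n) (a n)) :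
    MZ d ∣ k * ∑ n, ((a n).toNat : ℤ) * P g n - ∑ n, ((W.c (s n)).toNat : ℤ) * P g n := by
  have h1 := kernel_sum hgp _ (fun n => (W.el (s n) 0 : ℤ)) (fun n => W.walk_eq hs n) 0
  have h2 : MZ d ∣ ∑ j : ZMod d, (((S.map (fun i : ℕ => ((a (j - (i : ZMod d))).toNat : ℤ))).sum) - (W.c (s j)).toNat) * (P g j : ℤ) := by
    simp only [zero_add] at h1
    rw [h1]; exact dvd_mul_right _ _
  have h3 := h2.sub (conv_sum (g := g) S hk (fun n => ((a n).toNat : ℤ)))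
  rw [← dvd_neg] at h3 ⊢
  refine h3.trans (dvd_of_eq ?_)
  simp only [sub_mul, Finset.sum_sub_distrib]
  ring

lemma walk_unique (hd : 2 ≤ d) (hgp : g * (p : ZMod d) = 1) {s s' : ZMod d → St} {a : ZMod d → Bool}
    (hs : ∀ n, s (n + 1) = W.nxt (s n) (a n)) (hs' : ∀ n, s' (n + 1) = W.nxt (s' n) (a n))
    (hc : ∀ n, W.c (s n) = W.c (s' n)) : s = s' := by
  have hM := MZ_pos hd
  have he : ∀ n, W.el (s n) 0 = W.el (s' n) 0 := by
    intro n
    have h1 := kernel_sum hgp _ (fun n => (W.el (s n) 0 : ℤ)) (fun n => W.walk_eq hs n) n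
    have h2 := kernel_sum hgp _ (fun n => (W.el (s' n) 0 : ℤ)) (fun n => W.walk_eq hs' n) n
    simp only [hc] at h1
    rw [h1] at h2
    have := mul_left_cancel₀ hM.ne' h2
    exact_mod_cast this
  funext n
  apply W.ext
  · intro j h1 h2
    rw [W.walk_al hs j h1 h2, W.walk_al hs' j h1 h2]
  · intro j hj
    rw [W.walk_el hs j hj, W.walk_el hs' j hj, he]
end Win
end GD

set_option linter.unusedSectionVars false
namespace GD
open Finset

section
variable {d : ℕ} [NeZero d] {g : ZMod d} {k : ℕ}

lemma sum_dec (A : Finset (ZMod d)) : ∑ n, ((decide (n ∈ A)).toNat : ℤ) * P g n = ex g A := by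
  unfold ex
  push_cast
  rw [← Finset.sum_filter_add_sum_filter_not univ (fun n => n ∈ A)]
  rw [Finset.sum_eq_zero (s := univ.filter (fun n => ¬ n ∈ A))]
  · rw [add_zero, Finset.filter_univ_mem]
    apply Finset.sum_congr rfl
    intro n hn; simp [hn]
  · intro n hn
    have : n ∉ A := (Finset.mem_filter.1 hn).2
    simp [this]

lemma sum_dec' (f : ZMod d → Bool) : ∑ n, ((f n).toNat : ℤ) * P g n = ex g (univ.filter fun n => f n = true) := by
  rw [← sum_dec]
  apply Finset.sum_congr rfl
  intro n _
  cases h : f n <;> simp [h]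

lemma dvd_iff_MZ (x : ℕ) : (2 ^ d - 1) ∣ x ↔ MZ d ∣ (x : ℤ) := by
  unfold MZ; exact Int.natCast_dvd_natCast.symm

lemma exZ_compl {p : ZMod d} (hgp : g * p = 1) (A : Finset (ZMod d)) : (ex g Aᶜ : ℤ) = MZ d - ex g A := by
  have := ex_compl hgp A
  unfold MZ; rw [← this]; push_cast; ring

/-- Allowed pairs (a,c) at position `n`. -/
def okp (p n : ℕ) (a c : Bool) : Bool :=
  if n = 0 then a && !c else if n = p then !a && c else !a || c

end

namespace Win
variable {S : List ℕ} {p w m : ℕ} {St : Type} (W : Win S p w m St) [Fintype St] [DecidableEq St]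
variable {d : ℕ} [NeZero d] {g : ZMod d} {k : ℕ}

/-- single transition relation -/
def R (ok : ℕ → Bool → Bool → Bool) (n : ℕ) (x y : St) : Bool :=
  decide (y = W.nxt x (W.al y 1)) && ok n (W.al y 1) (W.c x)

def CW (ok : ℕ → Bool → Bool → Bool) (d : ℕ) [NeZero d] : Finset (ZMod d → St) :=
  univ.filter fun s => ∀ n : ZMod d, W.R ok n.val (s n) (s (n + 1)) = true

lemma mem_CW (ok) (s : ZMod d → St) : s ∈ W.CW ok d ↔ ∀ n, s (n + 1) = W.nxt (s n) (W.al (s (n + 1)) 1) ∧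
    ok n.val (W.al (s (n + 1)) 1) (W.c (s n)) = true := by
  simp [CW, R]

lemma walk_mem_CW (ok) {s : ZMod d → St} {a c : ZMod d → Bool}
    (hs : ∀ n, s (n + 1) = W.nxt (s n) (a n) ∧ W.c (s n) = c n) (h : ∀ n, ok n.val (a n) (c n) = true) :
    s ∈ W.CW ok d := by
  rw [mem_CW]
  intro n
  have h1 : W.al (s (n + 1)) 1 = a n := by rw [(hs n).1, W.al_one]
  rw [h1, (hs n).2]
  exact ⟨(hs n).1, h n⟩

lemma card_Sol (hd : 2 ≤ d) (hpd : p < d) (hgp : g * (p : ZMod d) = 1) (hSne : S ≠ [])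
    (hk : k = (S.map (fun j : ℕ => P g (j : ZMod d))).sum) :
    (Sol g (p : ZMod d) k).card = (W.CW (okp p) d).card := by
  have hval : ∀ n : ZMod d, n.val = 0 ↔ n = 0 := fun n => ZMod.val_eq_zero n
  have hvalp : ∀ n : ZMod d, n.val = p ↔ n = p := by
    intro n
    constructor
    · intro h; rw [← h]; simp
    · rintro rfl; rw [ZMod.val_natCast, Nat.mod_eq_of_lt hpd]
  have hp0 : (p : ZMod d) ≠ 0 := by
    intro h
    have := (hvalp 0).2 h.symm
    rw [ZMod.val_zero] at this
    have := W.hp; omega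
  have okd : ∀ (n : ZMod d) (a c : Bool), okp p n.val a c = true ↔
      (if n = 0 then a = true ∧ c = false else if n = p then a = false ∧ c = true else (a = true → c = true)) := by
    intro n a c
    unfold okp
    simp only [hval, hvalp]
    split_ifs <;> cases a <;> cases c <;> simp
  symm
  apply Finset.card_bij (fun s _ => ((univ.filter fun n => n ≠ 0 ∧ W.c (s n) = false),
      (univ.filter fun n => n ≠ 0 ∧ W.al (s (n + 1)) 1 = true)))
  · intro s hs
    rw [mem_CW] at hs
    have hok := fun n => (okd _ _ _).1 (hs n).2
    have h0 := hok 0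
    have hpp := hok p
    simp only [if_true, hp0, if_false] at h0 hpp
    have hdv := W.walk_dvd hgp hk (fun n => (hs n).1)
    unfold Sol
    rw [Finset.mem_filter]
    refine ⟨mem_univ _, ?_, ⟨by simp, by simp⟩, ⟨by simp [hpp], by simp [hpp]⟩, ?_⟩
    · rw [Finset.disjoint_left]
      intro n h1 h2
      simp only [mem_filter, mem_univ, true_and] at h1 h2
      have := hok n
      rw [if_neg h1.1, h1.2, h2.2] at this
      split_ifs at this <;> simp_all
    · rw [dvd_iff_MZ]
      rw [sum_dec', sum_dec' (fun n => W.c (s n))] at hdv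
      have e1 : (univ.filter fun n : ZMod d => W.al (s (n + 1)) 1 = true)
          = insert 0 (univ.filter fun n => n ≠ 0 ∧ W.al (s (n + 1)) 1 = true) := by
        ext n; by_cases hn : n = 0
        · subst hn; simpa using h0.1
        · simp [hn]
      have e2 : (univ.filter fun n : ZMod d => W.c (s n) = true)
          = (insert 0 (univ.filter fun n => n ≠ 0 ∧ W.c (s n) = false))ᶜ := by
        ext n; by_cases hn : n = 0
        · subst hn; simpa using h0.2
        · simp [hn]
      rw [e1, e2, exZ_compl hgp, ex_insert g (by simp), ex_insert g (by simp), P_zero] at hdv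
      have := hdv.add (dvd_refl (MZ d))
      refine this.trans (dvd_of_eq ?_)
      push_cast; ring
  · intro s hs s' hs' h
    rw [mem_CW] at hs hs'
    have hok := fun n => (okd _ _ _).1 (hs n).2
    have hok' := fun n => (okd _ _ _).1 (hs' n).2
    rw [Prod.mk.injEq] at h
    have ha : ∀ n, W.al (s (n + 1)) 1 = W.al (s' (n + 1)) 1 := by
      intro n
      by_cases hn : n = 0
      · subst hn
        have h1 := hok 0; have h2 := hok' 0
        simp only [if_true] at h1 h2
        rw [h1.1, h2.1]
      · have := Finset.ext_iff.1 h.2 n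
        simp only [mem_filter, mem_univ, true_and, hn, not_false_eq_true, ne_eq] at this
        exact Bool.eq_iff_iff.2 this
    have hc : ∀ n, W.c (s n) = W.c (s' n) := by
      intro n
      by_cases hn : n = 0
      · subst hn
        have h1 := hok 0; have h2 := hok' 0
        simp only [if_true] at h1 h2
        rw [h1.2, h2.2]
      · have := Finset.ext_iff.1 h.1 n
        simp only [mem_filter, mem_univ, true_and, hn, not_false_eq_true, ne_eq] at this
        simpa using this
    refine W.walk_unique hd hgp (a := fun n => W.al (s (n + 1)) 1) (fun n => (hs n).1) ?_ hc
    intro n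
    simp only [ha]
    exact (hs' n).1
  · rintro ⟨A, B⟩ hAB
    unfold Sol at hAB
    simp only [mem_filter, mem_univ, true_and] at hAB
    obtain ⟨hdis, ⟨h0A, h0B⟩, ⟨hpA, hpB⟩, hdv⟩ := hAB
    obtain ⟨s, hs⟩ := W.walk_exists (k := k) hd hgp hSne hk (fun n => decide (n ∈ insert 0 B))
      (fun n => decide (n ∈ (insert 0 A)ᶜ)) ⟨0, by simp⟩ ⟨p, by simp [hp0, hpB]⟩ (by
        rw [sum_dec, sum_dec, exZ_compl hgp, ex_insert g h0A, ex_insert g h0B, P_zero]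
        rw [dvd_iff_MZ] at hdv
        have := hdv.sub (dvd_refl (MZ d))
        refine this.trans (dvd_of_eq ?_)
        push_cast; ring)
    have hal : ∀ n, W.al (s (n + 1)) 1 = decide (n ∈ insert 0 B) := by
      intro n; rw [(hs n).1, W.al_one]
    refine ⟨s, W.walk_mem_CW _ hs ?_, ?_⟩
    · intro n
      rw [okd]
      split_ifs with h1 h2
      · simp [h1]
      · subst h2; simp [hp0, hpA, hpB]
      · have := fun h : n ∈ B => Finset.disjoint_right.1 hdis h
        simp [h1]
        exact this
    · simp only [hal, (hs _).2]
      rw [Prod.mk.injEq]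
      constructor
      · ext n
        by_cases hn : n = 0
        · subst hn; simpa using h0A
        · simp [hn]
      · ext n
        by_cases hn : n = 0
        · subst hn; simpa using h0B
        · simp [hn]

lemma zero_lemma (hd : 2 ≤ d) (hodd : Odd d) (hgp : g * (p : ZMod d) = 1) (hSne : S ≠ [])
    (hk : k = (S.map (fun j : ℕ => P g (j : ZMod d))).sum) (r χ : St → ℕ)
    (hcert : ∀ s b, (b = true → W.c s = true) → r (W.nxt s b) ≤ r s ∧ (r (W.nxt s b) = r s →
      (χ s ≠ 2 ∧ χ s + χ (W.nxt s b) = 1) ∨ (χ s = 2 ∧ W.nxt s b = s))) : ZL g k := by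
  intro A B hdis hdv
  by_contra hcon
  rw [not_or] at hcon
  obtain ⟨hB0, hB1⟩ := hcon
  have ha0 : ∃ n, n ∈ B := Finset.nonempty_iff_ne_empty.2 hB0
  have ha1 : ∃ n, n ∉ B := by
    by_contra hh; push Not at hh; exact hB1 (Finset.eq_univ_iff_forall.2 hh)
  obtain ⟨s, hs⟩ := W.walk_exists (k := k) hd hgp hSne hk (fun n => decide (n ∈ B))
      (fun n => decide (n ∈ Aᶜ)) (by simpa using ha0) (by simpa using ha1) (by
        rw [sum_dec, sum_dec, exZ_compl hgp]
        rw [dvd_iff_MZ] at hdv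
        have := hdv.sub (dvd_refl (MZ d))
        refine this.trans (dvd_of_eq ?_)
        push_cast; ring)
  have hce : ∀ n, r (s (n + 1)) ≤ r (s n) ∧ (r (s (n + 1)) = r (s n) →
      (χ (s n) ≠ 2 ∧ χ (s n) + χ (s (n + 1)) = 1) ∨ (χ (s n) = 2 ∧ s (n + 1) = s n)) := by
    intro n
    have := hcert (s n) (decide (n ∈ B)) (by
      rw [(hs n).2]
      have := fun h : n ∈ B => Finset.disjoint_right.1 hdis h
      simpa using this)
    rwa [← (hs n).1] at this
  have hsh : ∀ f : ZMod d → ℕ, ∑ n, f (n + 1) = ∑ n, f n := fun f => Equiv.sum_comp (Equiv.addRight (1 : ZMod d)) f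
  have hreq : ∀ n, r (s (n + 1)) = r (s n) := by
    have := (Finset.sum_eq_sum_iff_of_le (s := univ) (fun n _ => (hce n).1)).1 (hsh (fun n => r (s n)))
    exact fun n => this n (mem_univ n)
  have hce2 := fun n => (hce n).2 (hreq n)
  by_cases hx : ∃ n, χ (s n) = 2
  · obtain ⟨n0, hn0⟩ := hx
    have hall : ∀ i : ℕ, s (n0 + i) = s n0 := by
      intro i
      induction i with
      | zero => simp
      | succ i ih =>
        have := hce2 (n0 + i)
        rw [ih] at this
        rcases this with h | h
        · exact absurd hn0 h.1
        · rw [← h.2]; congr 1; push_cast; ring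
    have hall' : ∀ n, s n = s n0 := by
      intro n
      have := hall (n - n0).val
      rwa [ZMod.natCast_zmod_val, add_sub_cancel] at this
    have hal : ∀ n, decide (n ∈ B) = W.al (s n0) 1 := by
      intro n; rw [← hall' (n + 1), (hs n).1, W.al_one]
    obtain ⟨n, hn⟩ := ha0
    obtain ⟨n', hn'⟩ := ha1
    have h1 := hal n
    have h2 := hal n'
    rw [← h2] at h1
    simp [hn, hn'] at h1
  · push Not at hx
    have h1 : ∀ n, χ (s n) + χ (s (n + 1)) = 1 := by
      intro n
      rcases hce2 n with h | h
      · exact h.2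
      · exact absurd h.1 (hx n)
    have h2 : ∑ n : ZMod d, (χ (s n) + χ (s (n + 1))) = d := by
      simp [h1, ZMod.card]
    rw [Finset.sum_add_distrib, hsh (fun n => χ (s n))] at h2
    obtain ⟨q, hq⟩ := hodd
    omega
end Win
end GD

set_option linter.unusedSectionVars false
namespace GD
open Finset

section
variable {St : Type} [Fintype St] [DecidableEq St]

def cntR (R : ℕ → St → St → Bool) : ℕ → ℕ → St → St → ℕ
  | _, 0, x, y => if x = y then 1 else 0
  | n, L + 1, x, y => ∑ z, if R n x z = true then cntR R (n + 1) L z y else 0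

def path (R : ℕ → St → St → Bool) : (n L : ℕ) → St → (Fin L → St) → St → Bool
  | n, 0, x, _, y => R n x y
  | n, L + 1, x, f, y => R n x (f 0) && path R (n + 1) L (f 0) (Fin.tail f) y

lemma cnt_path (R : ℕ → St → St → Bool) (n L : ℕ) (x y : St) :
    ∑ f : Fin L → St, (if path R n L x f y = true then 1 else 0) = cntR R n (L + 1) x y := by
  induction L generalizing n x with
  | zero =>
    have hp : ∀ f : Fin 0 → St, path R n 0 x f y = R n x y := fun f => by rw [path]
    rw [Finset.sum_congr rfl (fun f _ => by rw [hp f])]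
    simp only [cntR]
    rw [Finset.sum_eq_single y]
    · simp only [Finset.univ_unique, Finset.sum_singleton, if_true]
    · intro b _ hb; simp [hb]
    · simp
  | succ L ih =>
    rw [cntR, ← Equiv.sum_comp (Fin.consEquiv (fun _ => St)), Fintype.sum_prod_type]
    apply Finset.sum_congr rfl
    intro z _
    rw [← ih]
    have ht : ∀ f : Fin L → St, Fin.tail ((Fin.consEquiv (fun _ => St)) (z, f)) = f := by
      intro f; funext i; simp [Fin.tail]
    simp only [path, ht, Bool.and_eq_true]
    simp only [Fin.consEquiv_apply, Fin.cons_zero]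
    by_cases h : R n x z = true
    · simp [h]
    · simp [h]

lemma path_iff (R : ℕ → St → St → Bool) (n L : ℕ) (x y : St) (f : Fin L → St) :
    path R n L x f y = true ↔ ∀ i : Fin (L + 1), R (n + i) (Fin.cons (α := fun _ => St) x f i)
      (Fin.snoc (α := fun _ => St) f y i) = true := by
  induction L generalizing n x with
  | zero =>
    simp [path, Fin.snoc]
  | succ L ih =>
    rw [path, Bool.and_eq_true, ih, Fin.forall_fin_succ (n := L + 1)]
    refine and_congr ?_ (forall_congr' fun i => ?_)
    · have : Fin.snoc (α := fun _ => St) f y 0 = f 0 := by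
        simp [Fin.snoc]
      simp [this]
    · have h1 : Fin.cons (α := fun _ => St) (f 0) (Fin.tail f) i = f i := by
        rw [Fin.cons_self_tail]
      have h2 : Fin.snoc (α := fun _ => St) f y i.succ = Fin.snoc (α := fun _ => St) (Fin.tail f) y i := by
        conv_lhs => rw [← Fin.cons_self_tail f, ← Fin.cons_snoc_eq_snoc_cons]
        simp
      rw [h1, Fin.cons_succ, h2, Fin.val_succ]
      rw [show n + 1 + (i : ℕ) = n + (i + 1) by ring]

lemma closed_card (R : ℕ → St → St → Bool) (D : ℕ) :
    (univ.filter fun s : Fin (D + 1) → St => ∀ i : Fin (D + 1), R i (s i) (s (i + 1)) = true).card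
      = ∑ x, cntR R 0 (D + 1) x x := by
  rw [Finset.card_filter, ← Equiv.sum_comp (Fin.consEquiv (fun _ => St)), Fintype.sum_prod_type]
  apply Finset.sum_congr rfl
  intro x _
  rw [← cnt_path]
  apply Finset.sum_congr rfl
  intro f _
  congr 1
  rw [path_iff]
  refine propext (forall_congr' fun i => ?_)
  simp only [Fin.consEquiv_apply, zero_add]
  have : Fin.snoc (α := fun _ => St) f x i = Fin.cons (α := fun _ => St) x f (i + 1) := by
    induction i using Fin.lastCases with
    | last => simp
    | cast i => simp
  rw [this]

end

namespace Win
variable {S : List ℕ} {p w m : ℕ} {St : Type} (W : Win S p w m St) [Fintype St] [DecidableEq St]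

lemma card_CW (ok) (d : ℕ) [NeZero d] : (W.CW ok d).card = ∑ x, cntR (W.R ok) 0 d x x := by
  obtain ⟨D, rfl⟩ : ∃ D, d = D + 1 := ⟨d - 1, by have := NeZero.ne d; omega⟩
  rw [← closed_card]
  refine Finset.card_bij (fun s _ => (s : Fin (D + 1) → St)) ?_ ?_ ?_
  · intro s hs
    exact Finset.mem_filter.2 ⟨Finset.mem_univ _, (Finset.mem_filter.1 hs).2⟩
  · intro s _ s' _ h; exact h
  · intro s hs
    exact ⟨s, Finset.mem_filter.2 ⟨Finset.mem_univ _, (Finset.mem_filter.1 hs).2⟩, rfl⟩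

lemma sum_R (ok) (n : ℕ) (x : St) (F : St → ℕ) :
    (∑ z, if W.R ok n x z = true then F z else 0) =
      (if ok n false (W.c x) = true then F (W.nxt x false) else 0)
      + (if ok n true (W.c x) = true then F (W.nxt x true) else 0) := by
  have hne : W.nxt x false ≠ W.nxt x true := by
    intro h
    have := congrArg (fun s => W.al s 1) h
    simp [W.al_one] at this
  rw [← Finset.sum_subset (Finset.subset_univ {W.nxt x false, W.nxt x true})]
  · rw [Finset.sum_pair hne]
    simp [R, W.al_one]
  · intro z _ hz
    simp only [mem_insert, mem_singleton, not_or] at hz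
    have : W.R ok n x z = false := by
      unfold R
      rcases h : W.al z 1 with _ | _
      · simp [hz.1]
      · simp [hz.2]
    simp [this]

/-- normal successors -/
def nxN (s : St) : List St := if W.c s then [W.nxt s false, W.nxt s true] else [W.nxt s false]
def nx0 (s : St) : List St := if W.c s then [] else [W.nxt s true]
def nxp (s : St) : List St := if W.c s then [W.nxt s false] else []

def cntN : ℕ → St → St → ℕ
  | 0, x, y => if x = y then 1 else 0
  | L + 1, x, y => ((W.nxN x).map (fun z => cntN L z y)).sum

/-- endpoints after `i` normal steps -/
def endN : ℕ → St → List St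
  | 0, x => [x]
  | i + 1, x => (W.nxN x).flatMap (endN i)

/-- endpoints of the special block -/
def endX (x : St) : List St := (W.nx0 x).flatMap fun y => (W.endN (p - 1) y).flatMap W.nxp

lemma cntR_normal (n L : ℕ) (hn : p < n) (x y : St) : cntR (W.R (okp p)) n L x y = W.cntN L x y := by
  induction L generalizing n x with
  | zero => rfl
  | succ L ih =>
    rw [cntR, sum_R, cntN]
    simp only [ih (n + 1) (by omega)]
    unfold okp nxN
    simp only [show n ≠ 0 by omega, show n ≠ p by omega, if_false]
    cases W.c x <;> simp

lemma sum_flatMap' {α β : Type} (l : List α) (f : α → List β) (F : β → ℕ) :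
    ((l.flatMap f).map F).sum = (l.map (fun a => ((f a).map F).sum)).sum := by
  induction l with
  | nil => simp
  | cons a l ih => simp [ih]

lemma cntR_mid (L : ℕ) (y : St) (i n : ℕ) (hn : n + i = p) (h0 : 1 ≤ n) (x : St) :
    cntR (W.R (okp p)) n (i + 1 + L) x y =
      ((W.endN i x).map (fun z => ((W.nxp z).map (fun q => W.cntN L q y)).sum)).sum := by
  induction i generalizing n x with
  | zero =>
    rw [show 0 + 1 + L = L + 1 by ring, cntR, sum_R]
    simp only [W.cntR_normal (n + 1) L (by omega)]
    unfold okp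
    simp only [show n ≠ 0 by omega, show n = p by omega, if_false, if_true]
    simp only [endN, List.map_cons, List.map_nil, List.sum_cons, List.sum_nil, nxp]
    have : p ≠ 0 := by omega
    cases W.c x <;> simp [this]
  | succ i ih =>
    rw [show i + 1 + 1 + L = (i + 1 + L) + 1 by ring, cntR, sum_R]
    simp only [ih (n + 1) (by omega) (by omega)]
    unfold okp
    simp only [show n ≠ 0 by omega, show n ≠ p by omega, if_false]
    rw [endN, sum_flatMap']
    unfold nxN
    cases W.c x <;> simp

lemma cntR_X (L : ℕ) (x y : St) :
    cntR (W.R (okp p)) 0 (p + 1 + L) x y = ((W.endX x).map (fun q => W.cntN L q y)).sum := by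
  have hp := W.hp
  rw [show p + 1 + L = (p - 1 + 1 + L) + 1 by omega, cntR, sum_R]
  simp only [zero_add, W.cntR_mid L y (p - 1) 1 (by omega) le_rfl]
  unfold endX
  rw [sum_flatMap']
  simp only [sum_flatMap']
  unfold okp nx0
  cases W.c x <;> simp

/-- The number of solutions for word length `p + 1 + L`. -/
def N (L : ℕ) : ℕ := ∑ x, ((W.endX x).map (fun q => W.cntN L q x)).sum

lemma card_Sol_N {d L : ℕ} [NeZero d] {g : ZMod d} {k : ℕ} (hL : d = p + 1 + L)
    (hgp : g * (p : ZMod d) = 1) (hSne : S ≠ [])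
    (hk : k = (S.map (fun j : ℕ => P g (j : ZMod d))).sum) : (Sol g (p : ZMod d) k).card = W.N L := by
  have hp := W.hp
  rw [W.card_Sol (by omega) (by omega) hgp hSne hk, card_CW]
  unfold N
  apply Finset.sum_congr rfl
  intro x _
  rw [← cntR_X, ← hL]

end Win
end GD

set_option linter.unusedSectionVars false
namespace GD
open Finset

/-- Packing base. -/
def BB : ℕ := 2 ^ 64

def comb : List ℕ → (ℕ → ℕ) → ℕ
  | [], _ => 0
  | c :: cs, f => c * f 0 + comb cs (fun i => f (i + 1))

lemma comb_mono (cs : List ℕ) {f f' : ℕ → ℕ} (h : ∀ i, f i ≤ f' i) : comb cs f ≤ comb cs f' := by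
  induction cs generalizing f f' with
  | nil => simp [comb]
  | cons c cs ih =>
    simp only [comb]
    exact Nat.add_le_add (Nat.mul_le_mul_left _ (h 0)) (ih fun i => h (i + 1))

lemma comb_sum {ι : Type} (s : Finset ι) (cs : List ℕ) (f : ι → ℕ → ℕ) :
    comb cs (fun i => ∑ x ∈ s, f x i) = ∑ x ∈ s, comb cs (f x) := by
  induction cs generalizing f with
  | nil => simp [comb]
  | cons c cs ih =>
    simp only [comb]
    rw [ih (fun x i => f x (i + 1)), Finset.mul_sum, ← Finset.sum_add_distrib]

lemma comb_mul (cs : List ℕ) (f : ℕ → ℕ) (b : ℕ) : comb cs (fun i => f i * b) = comb cs f * b := by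
  induction cs generalizing f with
  | nil => simp [comb]
  | cons c cs ih =>
    simp only [comb]
    rw [ih (fun i => f (i + 1))]; ring

lemma comb_list {α : Type} (l : List α) (cs : List ℕ) (f : α → ℕ → ℕ) :
    comb cs (fun i => (l.map (fun x => f x i)).sum) = (l.map (fun x => comb cs (f x))).sum := by
  induction l with
  | nil =>
    simp only [List.map_nil, List.sum_nil]
    have := comb_mul cs (fun _ => 0) 0
    simpa using this
  | cons a l ih =>
    simp only [List.map_cons, List.sum_cons, ← ih]
    have := comb_sum (ι := Bool) univ cs (fun b i => if b then f a i else (l.map (fun x => f x i)).sum)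
    simpa using this

lemma dig_aux (n : ℕ) (f : ℕ → ℕ) (b : ℕ) (hb : 0 < b) (h : ∀ i, f i < b) (y : ℕ) (hy : y < n) :
    (∑ i ∈ range n, f i * b ^ i) / b ^ y % b = f y := by
  induction n generalizing f y with
  | zero => omega
  | succ n ih =>
    rw [Finset.sum_range_succ', pow_zero, mul_one]
    have e : ∑ i ∈ range n, f (i + 1) * b ^ (i + 1) = b * ∑ i ∈ range n, f (i + 1) * b ^ i := by
      rw [Finset.mul_sum]; apply Finset.sum_congr rfl; intro i _; ring
    rw [e]
    cases y with
    | zero => rw [pow_zero, Nat.div_one, Nat.mul_add_mod, Nat.mod_eq_of_lt (h 0)]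
    | succ y =>
      rw [pow_succ', ← Nat.div_div_eq_div_mul, Nat.mul_add_div hb, Nat.div_eq_of_lt (h 0), add_zero]
      exact ih (fun i => f (i + 1)) (fun i => h _) y (by omega)

lemma dig {n : ℕ} (f : Fin n → ℕ) (h : ∀ i, f i < BB) (y : Fin n) :
    (∑ i, f i * BB ^ i.val) / BB ^ y.val % BB = f y := by
  have hB : 0 < BB := by unfold BB; norm_num
  have := dig_aux n (fun i => if hi : i < n then f ⟨i, hi⟩ else 0) BB hB (by
    intro i; split_ifs <;> simp [h, hB]) y.val y.isLt
  rw [Finset.sum_range] at this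
  simpa using this

namespace Win
variable {S : List ℕ} {p w m n : ℕ} (W : Win S p w m (Fin n))

def stepL (V : List ℕ) : List ℕ :=
  (List.finRange n).map (fun q => ((W.nxN q).map (fun z => V.getD z.val 0)).sum)

def FL : ℕ → List ℕ
  | 0 => (List.finRange n).map (fun q => BB ^ q.val)
  | L + 1 => W.stepL (FL L)

lemma getD_finRange (f : Fin n → ℕ) (q : Fin n) : ((List.finRange n).map f).getD q.val 0 = f q := by
  rw [List.getD_eq_getElem _ _ (by simp)]
  simp

lemma FL_spec (L : ℕ) (q : Fin n) : (W.FL L).getD q.val 0 = ∑ x, W.cntN L q x * BB ^ x.val := by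
  induction L generalizing q with
  | zero =>
    rw [FL, getD_finRange]
    simp [cntN]
  | succ L ih =>
    rw [FL, stepL, getD_finRange]
    simp only [ih, cntN]
    generalize W.nxN q = l
    induction l with
    | nil => simp
    | cons a l ih2 =>
      simp only [List.map_cons, List.sum_cons, ih2, add_mul, Finset.sum_add_distrib]

lemma cntN_le (L : ℕ) (q x : Fin n) : W.cntN L q x ≤ 2 ^ L := by
  induction L generalizing q with
  | zero => unfold cntN; split_ifs <;> simp
  | succ L ih =>
    unfold cntN nxN
    split_ifs
    · simp only [List.map_cons, List.map_nil, List.sum_cons, List.sum_nil]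
      have := ih (W.nxt q false); have := ih (W.nxt q true)
      rw [pow_succ]; omega
    · simp only [List.map_cons, List.map_nil, List.sum_cons, List.sum_nil]
      have := ih (W.nxt q false)
      rw [pow_succ]; omega

lemma comb_cnt (cp cm : List ℕ) (hcp : comb cp (fun i => 2 ^ i) < BB) (hcm : comb cm (fun i => 2 ^ i) < BB)
    (h : ∀ q : Fin n, comb cp (fun i => (W.FL i).getD q.val 0) = comb cm (fun i => (W.FL i).getD q.val 0))
    (L : ℕ) (q x : Fin n) :
    comb cp (fun i => W.cntN (L + i) q x) = comb cm (fun i => W.cntN (L + i) q x) := by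
  induction L generalizing q with
  | zero =>
    have e : ∀ cs, comb cs (fun i => (W.FL i).getD q.val 0) = ∑ x, comb cs (fun i => W.cntN i q x) * BB ^ x.val := by
      intro cs
      simp only [FL_spec]
      rw [comb_sum univ cs (fun x i => W.cntN i q x * BB ^ x.val)]
      apply Finset.sum_congr rfl; intro x _; rw [comb_mul]
    have h1 := h q
    rw [e, e] at h1
    have hb : ∀ cs, comb cs (fun i => 2 ^ i) < BB → ∀ x, comb cs (fun i => W.cntN i q x) < BB := fun cs hcs x =>
      lt_of_le_of_lt (comb_mono cs (fun i => W.cntN_le i q x)) hcs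
    have h2 := dig _ (hb cp hcp) x
    have h3 := dig _ (hb cm hcm) x
    rw [h1, h3] at h2
    simpa using h2.symm
  | succ L ih =>
    have e : ∀ i, L + 1 + i = (L + i) + 1 := fun i => by ring
    simp only [e, cntN]
    rw [comb_list _ _ (fun z i => W.cntN (L + i) z x), comb_list _ _ (fun z i => W.cntN (L + i) z x)]
    simp only [ih]

lemma comb_N (cp cm : List ℕ) (hcp : comb cp (fun i => 2 ^ i) < BB) (hcm : comb cm (fun i => 2 ^ i) < BB)
    (h : ∀ q : Fin n, comb cp (fun i => (W.FL i).getD q.val 0) = comb cm (fun i => (W.FL i).getD q.val 0))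
    (L : ℕ) : comb cp (fun i => W.N (L + i)) = comb cm (fun i => W.N (L + i)) := by
  unfold N
  rw [comb_sum univ cp (fun x i => ((W.endX x).map (fun q => W.cntN (L + i) q x)).sum),
    comb_sum univ cm (fun x i => ((W.endX x).map (fun q => W.cntN (L + i) q x)).sum)]
  apply Finset.sum_congr rfl
  intro x _
  rw [comb_list _ _ (fun q i => W.cntN (L + i) q x), comb_list _ _ (fun q i => W.cntN (L + i) q x)]
  simp only [W.comb_cnt cp cm hcp hcm h]

def NL (L : ℕ) : ℕ :=
  ((List.finRange n).map (fun x => ((W.endX x).map (fun q => (W.FL L).getD q.val 0 / BB ^ x.val % BB)).sum)).sum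

lemma N_eq (L : ℕ) (hL : L < 64) : W.N L = W.NL L := by
  unfold N NL
  rw [← List.sum_ofFn, List.ofFn_eq_map]
  congr 1
  apply List.map_congr_left
  intro x _
  congr 1
  apply List.map_congr_left
  intro q _
  rw [FL_spec, dig]
  intro i
  refine lt_of_le_of_lt (W.cntN_le L q i) ?_
  unfold BB
  exact Nat.pow_lt_pow_right (by norm_num) hL
end Win

/-! generic arithmetic for the instances -/
def alv (s j : ℕ) : Bool := decide (s / 2 ^ (j - 1) % 2 = 1)
def elv (m w s j : ℕ) : ℕ := s / 2 ^ m / w ^ j % w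
def nxv (S : List ℕ) (p w m s : ℕ) (b : Bool) : ℕ :=
  b.toNat + 2 * (s % 2 ^ (m - 1)) + 2 ^ m * (s / 2 ^ m / w +
    w ^ (p - 1) * (((S.map (fun j => (alv s j).toNat)).sum + elv m w s 0) / 2))

end GD

set_option linter.unusedSectionVars false
namespace GD
open Finset

/-- regular hyperoval automaton -/
def WR : Win [1] 1 1 1 (Fin 2) where
  al s j := alv s.val j
  el _ _ := 0
  nxt _ b := ⟨b.toNat, by cases b <;> decide⟩
  bld f _ := ⟨(f 1).toNat, by cases f 1 <;> decide⟩
  bld_al f h j h1 h2 := by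
    have : j = 1 := by omega
    subst this
    simp only [alv]; cases f 1 <;> decide
  bld_el f h hh j hj := by have := hh j hj; omega
  ext s s' h _ := by
    have := h 1 le_rfl le_rfl
    revert this; revert s s'; decide
  al_one s b := by revert s b; decide
  al_succ s b j h1 h2 := by omega
  el_nxt s b j h := by omega
  el_last s b := by revert s b; decide
  el_lt s j h := by decide
  hS := by decide
  hw := by decide
  hp := by decide
  hm := by decide

def bA (a1 a2 : Bool) (e0 : Fin 2) : Fin 8 := Fin.ofNat 8 (a1.toNat + 2 * a2.toNat + 4 * e0.val)

/-- Segre automaton -/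
def WA : Win [1, 2] 1 2 2 (Fin 8) where
  al s j := alv s.val j
  el s j := elv 2 2 s.val j
  nxt s b := Fin.ofNat 8 (nxv [1, 2] 1 2 2 s.val b)
  bld f h := bA (f 1) (f 2) (Fin.ofNat 2 (h 0))
  bld_al f h j h1 h2 := by
    generalize Fin.ofNat 2 (h 0) = e0
    interval_cases j <;> generalize f 1 = a1 <;> generalize f 2 = a2 <;> revert a1 a2 e0 <;> decide
  bld_el f h hh j hj := by
    have h0 : (Fin.ofNat 2 (h 0)).val = h 0 := Nat.mod_eq_of_lt (hh 0 (by omega))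
    interval_cases j
    rw [← h0, Fin.ofNat_val_eq_self]
    generalize Fin.ofNat 2 (h 0) = e0
    generalize f 1 = a1
    generalize f 2 = a2
    revert a1 a2 e0; decide
  ext s s' h1 h2 := by
    have h11 := h1 1 (by decide) (by decide)
    have h12 := h1 2 (by decide) (by decide)
    have h20 := h2 0 (by decide)
    have e : ∀ s : Fin 8, bA (alv s.val 1) (alv s.val 2) (Fin.ofNat 2 (elv 2 2 s.val 0)) = s := by decide
    rw [← e s, ← e s', h11, h12, h20]
  al_one s b := by revert s b; decide
  al_succ s b j h1 h2 := by interval_cases j; revert s b; decide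
  el_nxt s b j h := by omega
  el_last s b := by revert s b; decide
  el_lt s j h := Nat.mod_lt _ (by decide)
  hS := by decide
  hw := by decide
  hp := by decide
  hm := by decide

def bB (a1 a2 : Bool) (e0 e1 e2 e3 : Fin 2) : Fin 64 :=
  Fin.ofNat 64 (a1.toNat + 2 * a2.toNat + 4 * (e0.val + 2 * e1.val + 4 * e2.val + 8 * e3.val))

/-- Glynn type (I) automaton -/
def WB : Win [1, 2] 4 2 2 (Fin 64) where
  al s j := alv s.val j
  el s j := elv 2 2 s.val j
  nxt s b := Fin.ofNat 64 (nxv [1, 2] 4 2 2 s.val b)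
  bld f h := bB (f 1) (f 2) (Fin.ofNat 2 (h 0)) (Fin.ofNat 2 (h 1)) (Fin.ofNat 2 (h 2)) (Fin.ofNat 2 (h 3))
  bld_al f h j h1 h2 := by
    generalize Fin.ofNat 2 (h 0) = e0
    generalize Fin.ofNat 2 (h 1) = e1
    generalize Fin.ofNat 2 (h 2) = e2
    generalize Fin.ofNat 2 (h 3) = e3
    interval_cases j <;> generalize f 1 = a1 <;> generalize f 2 = a2 <;> revert a1 a2 e0 e1 e2 e3 <;> decide +kernel
  bld_el f h hh j hj := by
    have key : ∀ j, j < 4 → (Fin.ofNat 2 (h j)).val = h j := fun j hj => Nat.mod_eq_of_lt (hh j hj)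
    rw [← key j hj]
    generalize e0' : Fin.ofNat 2 (h 0) = e0
    generalize e1' : Fin.ofNat 2 (h 1) = e1
    generalize e2' : Fin.ofNat 2 (h 2) = e2
    generalize e3' : Fin.ofNat 2 (h 3) = e3
    generalize f 1 = a1
    generalize f 2 = a2
    interval_cases j
    · rw [e0']; clear e0' e1' e2' e3'; revert a1 a2 e0 e1 e2 e3; decide +kernel
    · rw [e1']; clear e0' e1' e2' e3'; revert a1 a2 e0 e1 e2 e3; decide +kernel
    · rw [e2']; clear e0' e1' e2' e3'; revert a1 a2 e0 e1 e2 e3; decide +kernel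
    · rw [e3']; clear e0' e1' e2' e3'; revert a1 a2 e0 e1 e2 e3; decide +kernel
  ext s s' h1 h2 := by
    have h11 := h1 1 (by decide) (by decide)
    have h12 := h1 2 (by decide) (by decide)
    have h20 := h2 0 (by decide)
    have h21 := h2 1 (by decide)
    have h22 := h2 2 (by decide)
    have h23 := h2 3 (by decide)
    have e : ∀ s : Fin 64, bB (alv s.val 1) (alv s.val 2) (Fin.ofNat 2 (elv 2 2 s.val 0))
      (Fin.ofNat 2 (elv 2 2 s.val 1)) (Fin.ofNat 2 (elv 2 2 s.val 2)) (Fin.ofNat 2 (elv 2 2 s.val 3)) = s := by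
      decide +kernel
    rw [← e s, ← e s', h11, h12, h20, h21, h22, h23]
  al_one s b := by revert s b; decide +kernel
  al_succ s b j h1 h2 := by interval_cases j; revert s b; decide +kernel
  el_nxt s b j h := by
    have : j < 3 := by omega
    interval_cases j <;> revert s b <;> decide +kernel
  el_last s b := by revert s b; decide +kernel
  el_lt s j h := Nat.mod_lt _ (by decide)
  hS := by decide
  hw := by decide
  hp := by decide
  hm := by decide

def bC (a1 a2 a3 a4 : Bool) (e0 e1 : Fin 3) : Fin 144 :=
  Fin.ofNat 144 (a1.toNat + 2 * a2.toNat + 4 * a3.toNat + 8 * a4.toNat + 16 * (e0.val + 3 * e1.val))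

/-- Glynn type (II) automaton -/
def WC : Win [1, 3, 4] 2 3 4 (Fin 144) where
  al s j := alv s.val j
  el s j := elv 4 3 s.val j
  nxt s b := Fin.ofNat 144 (nxv [1, 3, 4] 2 3 4 s.val b)
  bld f h := bC (f 1) (f 2) (f 3) (f 4) (Fin.ofNat 3 (h 0)) (Fin.ofNat 3 (h 1))
  bld_al f h j h1 h2 := by
    generalize Fin.ofNat 3 (h 0) = e0
    generalize Fin.ofNat 3 (h 1) = e1
    interval_cases j <;> generalize f 1 = a1 <;> generalize f 2 = a2 <;> generalize f 3 = a3 <;>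
      generalize f 4 = a4 <;> revert a1 a2 a3 a4 e0 e1 <;> decide +kernel
  bld_el f h hh j hj := by
    have key : ∀ j, j < 2 → (Fin.ofNat 3 (h j)).val = h j := fun j hj => Nat.mod_eq_of_lt (hh j hj)
    rw [← key j hj]
    generalize e0' : Fin.ofNat 3 (h 0) = e0
    generalize e1' : Fin.ofNat 3 (h 1) = e1
    generalize f 1 = a1
    generalize f 2 = a2
    generalize f 3 = a3
    generalize f 4 = a4
    interval_cases j
    · rw [e0']; clear e0' e1'; revert a1 a2 a3 a4 e0 e1; decide +kernel
    · rw [e1']; clear e0' e1'; revert a1 a2 a3 a4 e0 e1; decide +kernel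
  ext s s' h1 h2 := by
    have h11 := h1 1 (by decide) (by decide)
    have h12 := h1 2 (by decide) (by decide)
    have h13 := h1 3 (by decide) (by decide)
    have h14 := h1 4 (by decide) (by decide)
    have h20 := h2 0 (by decide)
    have h21 := h2 1 (by decide)
    have e : ∀ s : Fin 144, bC (alv s.val 1) (alv s.val 2) (alv s.val 3) (alv s.val 4)
      (Fin.ofNat 3 (elv 4 3 s.val 0)) (Fin.ofNat 3 (elv 4 3 s.val 1)) = s := by
      decide +kernel
    rw [← e s, ← e s', h11, h12, h13, h14, h20, h21]
  al_one s b := by revert s b; decide +kernel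
  al_succ s b j h1 h2 := by
    interval_cases j <;> revert s b <;> decide +kernel
  el_nxt s b j h := by
    have : j < 1 := by omega
    interval_cases j; revert s b; decide +kernel
  el_last s b := by revert s b; decide +kernel
  el_lt s j h := Nat.mod_lt _ (by decide)
  hS := by decide
  hw := by decide
  hp := by decide
  hm := by decide

end GD

set_option linter.unusedSectionVars false
namespace GD
open Finset

/-- Force evaluation of a number before passing it on. -/
def frc {α : Type} (n : ℕ) (f : ℕ → α) : α := Nat.rec (f 0) (fun m _ => f (Nat.succ m)) n

lemma frc_eq {α : Type} (n : ℕ) (f : ℕ → α) : frc n f = f n := by cases n <;> rfl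

/-- List lookup. -/
def look (l : List ℕ) : ℕ → ℕ := List.rec (fun _ => 0) (fun a _ ih j => Nat.rec a (fun m _ => ih m) j) l

lemma look_eq (l : List ℕ) (j : ℕ) : look l j = l.getD j 0 := by
  induction l generalizing j with
  | nil => rfl
  | cons a l ih =>
    cases j with
    | zero => rfl
    | succ j => rw [List.getD_cons_succ, ← ih]; rfl

def getS (V : List ℕ) (js : List ℕ) : ℕ := List.rec 0 (fun j _ ih => Nat.add (look V j) ih) js

lemma getS_eq (V js : List ℕ) : getS V js = (js.map (fun j => V.getD j 0)).sum := by
  induction js with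
  | nil => rfl
  | cons j js ih => rw [List.map_cons, List.sum_cons, ← ih, ← look_eq]; rfl

def stp (V : List ℕ) : List (List ℕ) → (List ℕ → Bool) → Bool
  | [], k => k []
  | js :: t, k => frc (getS V js) fun v => stp V t fun r => k (v :: r)

lemma stp_eq (V : List ℕ) (T : List (List ℕ)) (k : List ℕ → Bool) : stp V T k = k (T.map (getS V)) := by
  induction T generalizing k with
  | nil => rfl
  | cons js t ih => rw [stp, frc_eq, ih]; rfl

def zipAdd : List ℕ → ℕ → List ℕ → (List ℕ → Bool) → Bool
  | a :: as, c, b :: bs, k => frc (Nat.add a (Nat.mul c b)) fun v => zipAdd as c bs fun r => k (v :: r)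
  | _, _, _, k => k []

lemma zipAdd_eq (A : List ℕ) (c : ℕ) (V : List ℕ) (k : List ℕ → Bool) :
    zipAdd A c V k = k (List.zipWith (fun a b => a + c * b) A V) := by
  induction A generalizing V k with
  | nil => cases V <;> rfl
  | cons a A ih =>
    cases V with
    | nil => rfl
    | cons b V => rw [zipAdd, frc_eq, ih]; rfl

lemma zipAdd_getD (A V : List ℕ) (c n : ℕ) (hA : A.length = n) (hV : V.length = n) (q : ℕ) :
    (List.zipWith (fun a b => a + c * b) A V).getD q 0 = A.getD q 0 + c * V.getD q 0 := by
  by_cases hq : q < n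
  · rw [List.getD_eq_getElem _ _ (by simp; omega), List.getD_eq_getElem _ _ (by omega),
      List.getD_eq_getElem _ _ (by omega), List.getElem_zipWith]
  · rw [List.getD_eq_default _ _ (by simp; omega), List.getD_eq_default _ _ (by omega),
      List.getD_eq_default _ _ (by omega)]; simp

/-- Annihilation check. -/
def goC (T : List (List ℕ)) : List ℕ → List ℕ → List ℕ → List ℕ → List ℕ → Bool
  | c :: cs, m :: ms, V, A, B =>
    zipAdd A c V fun A' => zipAdd B m V fun B' => stp V T fun V' => goC T cs ms V' A' B'
  | [], [], _, A, B => A == B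
  | _, _, _, _, _ => false

/-- Sum of selected digits. -/
def digS (V : List ℕ) (E : List (ℕ × ℕ)) : ℕ :=
  List.rec 0 (fun e _ ih => Nat.add (Nat.mod (Nat.div (look V e.2) (Nat.pow BB e.1)) BB) ih) E

lemma digS_eq (V : List ℕ) (E : List (ℕ × ℕ)) :
    digS V E = (E.map (fun e => V.getD e.2 0 / BB ^ e.1 % BB)).sum := by
  induction E with
  | nil => rfl
  | cons e E ih => rw [List.map_cons, List.sum_cons, ← ih, ← look_eq]; rfl

def goV (T : List (List ℕ)) (E : List (ℕ × ℕ)) : List ℕ → List ℕ → Bool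
  | [], _ => true
  | x :: xs, V => (Nat.beq (digS V E) x) && stp V T fun V' => goV T E xs V'

namespace Win
variable {S : List ℕ} {p w m n : ℕ} (W : Win S p w m (Fin n))

def tab : List (List ℕ) := (List.finRange n).map (fun q => (W.nxN q).map Fin.val)
def etab : List (ℕ × ℕ) := (List.finRange n).flatMap (fun x => (W.endX x).map (fun q => (x.val, q.val)))

lemma step_eq (V : List ℕ) : W.tab.map (getS V) = W.stepL V := by
  unfold tab stepL
  rw [List.map_map]
  apply List.map_congr_left
  intro q _
  simp only [Function.comp, getS_eq, List.map_map]
  rfl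

lemma FL_len (L : ℕ) : (W.FL L).length = n := by
  cases L <;> simp [FL, stepL]

lemma goC_spec (cs ms : List ℕ) (i : ℕ) (A B : List ℕ) (hA : A.length = n) (hB : B.length = n)
    (h : goC W.tab cs ms (W.FL i) A B = true) (q : ℕ) :
    A.getD q 0 + comb cs (fun j => (W.FL (i + j)).getD q 0) =
      B.getD q 0 + comb ms (fun j => (W.FL (i + j)).getD q 0) := by
  induction cs generalizing ms i A B with
  | nil =>
    cases ms with
    | nil =>
      simp only [goC, beq_iff_eq] at h
      rw [h]
    | cons => simp [goC] at h
  | cons c cs ih =>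
    cases ms with
    | nil => simp [goC] at h
    | cons m ms =>
      rw [goC, zipAdd_eq, zipAdd_eq, stp_eq, step_eq] at h
      have := ih ms (i + 1) _ _ (by simp [hA, FL_len]) (by simp [hB, FL_len]) h
      rw [zipAdd_getD _ _ _ n hA (W.FL_len i), zipAdd_getD _ _ _ n hB (W.FL_len i)] at this
      simp only [comb, add_zero]
      have e : (fun j => (W.FL (i + (j + 1))).getD q 0) = fun j => (W.FL (i + 1 + j)).getD q 0 := by
        funext j; rw [show i + (j + 1) = i + 1 + j by ring]
      rw [e, ← add_assoc, ← add_assoc, this]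

lemma goV_spec (xs : List ℕ) (i : ℕ) (h : goV W.tab W.etab xs (W.FL i) = true) (j : ℕ) (hj : j < xs.length) :
    W.NL (i + j) = xs.getD j 0 := by
  induction xs generalizing i j with
  | nil => simp at hj
  | cons x xs ih =>
    rw [goV, stp_eq, step_eq, Bool.and_eq_true] at h
    cases j with
    | zero =>
      have := Nat.eq_of_beq_eq_true h.1
      rw [digS_eq] at this
      rw [List.getD_cons_zero, ← this]
      unfold NL etab
      rw [add_zero, List.map_flatMap, List.flatMap, List.sum_flatten, List.map_map]
      simp only [List.map_map, Function.comp_def]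
    | succ j =>
      rw [List.getD_cons_succ, ← ih (i + 1) h.2 j (by simpa using hj)]
      congr 1; ring

lemma comb_of (T : List (List ℕ)) (hT : W.tab = T) (cp cm : List ℕ)
    (h : goC T cp cm (W.FL 0) (List.replicate n 0) (List.replicate n 0) = true)
    (hcp : comb cp (fun i => 2 ^ i) < BB) (hcm : comb cm (fun i => 2 ^ i) < BB) (L : ℕ) :
    comb cp (fun i => W.N (L + i)) = comb cm (fun i => W.N (L + i)) := by
  subst hT
  refine W.comb_N cp cm hcp hcm (fun q => ?_) L
  have := W.goC_spec cp cm 0 _ _ (by simp) (by simp) h q.val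
  simpa using this

lemma vals_of (T : List (List ℕ)) (hT : W.tab = T) (E : List (ℕ × ℕ)) (hE : W.etab = E) (xs : List ℕ)
    (h : goV T E xs (W.FL 0) = true) (i : ℕ) (hi : i < xs.length) (hl : xs.length < 64) : W.N i = xs.getD i 0 := by
  subst hT hE
  rw [W.N_eq i (by omega)]
  simpa using W.goV_spec xs 0 h i hi
end Win
end GD

set_option linter.unusedSectionVars false
namespace GD
open Finset

def cpA : List ℕ := [0, 0, 2, 0, 2, 0, 0, 1]
def cmA : List ℕ := [0, 1, 0, 2, 0, 0, 2, 0]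
def tabA : List (List ℕ) := [
  [0], [2, 3], [0, 1], [6], [0, 1], [6], [4], [6, 7]]
lemma tabA_ok : WA.tab = tabA := by decide +kernel
def etabA : List (ℕ × ℕ) := [
  (0, 2), (3, 6), (5, 6)]
lemma etabA_ok : WA.etab = etabA := by decide +kernel

lemma chkA : goC tabA cpA cmA (WA.FL 0) (List.replicate 8 0) (List.replicate 8 0) = true := by
  decide +kernel

lemma recA (L : ℕ) : comb cpA (fun i => WA.N (L + i)) = comb cmA (fun i => WA.N (L + i)) :=
  WA.comb_of tabA tabA_ok _ _ chkA (by decide +kernel) (by decide +kernel) L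

def nsA : List ℕ := [0, 1, 1, 3, 2, 5, 4, 9, 7, 15, 12, 25, 20]
lemma valsA : goV tabA etabA nsA (WA.FL 0) = true := by
  decide +kernel

lemma vA (i : ℕ) (hi : i < 13) : WA.N i = [0, 1, 1, 3, 2, 5, 4, 9, 7, 15, 12, 25, 20].getD i 0 :=
  WA.vals_of tabA tabA_ok etabA etabA_ok nsA valsA i hi (by decide)

def rA : List ℕ := [0, 1, 1, 1, 1, 2, 1, 3]
def xA : List ℕ := [2, 0, 1, 1, 1, 0, 0, 2]
lemma certA : ∀ (s : Fin 8) (b : Bool), (b = true → WA.c s = true) →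
    rA.getD (WA.nxt s b).val 0 ≤ rA.getD s.val 0 ∧ (rA.getD (WA.nxt s b).val 0 = rA.getD s.val 0 →
      (xA.getD s.val 0 ≠ 2 ∧ xA.getD s.val 0 + xA.getD (WA.nxt s b).val 0 = 1) ∨
      (xA.getD s.val 0 = 2 ∧ WA.nxt s b = s)) := by
  decide +kernel

def cpB : List ℕ := [0, 0, 0, 0, 0, 0, 0, 0, 0, 0, 0, 0, 1, 0, 0, 0, 1, 0, 0, 0, 0, 3, 1, 0, 0, 2, 1, 0, 2, 0, 0, 1]
def cmB : List ℕ := [0, 0, 0, 0, 0, 0, 0, 0, 0, 0, 0, 0, 0, 1, 0, 0, 0, 1, 0, 0, 3, 0, 0, 1, 2, 0, 0, 1, 0, 2, 1, 0]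
def tabB : List (List ℕ) := [
  [0], [2, 3], [0, 1], [34], [0, 1], [34], [32], [34, 35], [4], [6, 7], [4, 5], [38], [4, 5], [38],
  [36], [38, 39], [8], [10, 11], [8, 9], [42], [8, 9], [42], [40], [42, 43], [12], [14, 15],
  [12, 13], [46], [12, 13], [46], [44], [46, 47], [16], [18, 19], [16, 17], [50], [16, 17], [50],
  [48], [50, 51], [20], [22, 23], [20, 21], [54], [20, 21], [54], [52], [54, 55], [24], [26, 27],
  [24, 25], [58], [24, 25], [58], [56], [58, 59], [28], [30, 31], [28, 29], [62], [28, 29], [62],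
  [60], [62, 63]]
lemma tabB_ok : WB.tab = tabB := by decide +kernel
def etabB : List (ℕ × ℕ) := [
  (0, 0), (0, 10), (3, 4), (3, 38), (5, 4), (5, 38), (6, 0), (6, 34), (6, 8), (8, 4), (11, 4),
  (11, 38), (11, 12), (13, 4), (13, 38), (13, 12), (14, 4), (14, 38), (16, 10), (16, 24), (19, 12),
  (21, 12), (22, 8), (22, 8), (27, 12), (27, 12), (29, 12), (29, 12), (30, 12), (32, 2), (32, 16),
  (35, 4), (37, 4), (38, 0), (38, 24), (40, 6), (40, 20), (43, 4), (43, 28), (45, 4), (45, 28),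
  (46, 4), (48, 10), (48, 24), (51, 12), (53, 12), (54, 8), (54, 24), (54, 58), (56, 14), (59, 12),
  (59, 28), (59, 62), (61, 12), (61, 28), (61, 62), (62, 12)]
lemma etabB_ok : WB.etab = etabB := by decide +kernel

lemma chkB : goC tabB cpB cmB (WB.FL 0) (List.replicate 64 0) (List.replicate 64 0) = true := by
  decide +kernel

lemma recB (L : ℕ) : comb cpB (fun i => WB.N (L + i)) = comb cmB (fun i => WB.N (L + i)) :=
  WB.comb_of tabB tabB_ok _ _ chkB (by decide +kernel) (by decide +kernel) L

def nsB : List ℕ := [1, 1, 3, 3, 7, 6, 13, 12, 23, 21, 45, 41, 87, 79, 167, 152, 321, 292, 619, 563, 1193, 1085, 2299, 2091, 4431, 4030, 8541, 7768, 16463, 14973, 31733, 28861, 61167, 55631, 117903, 107232, 227265, 206696, 438067, 398419, 844401]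
lemma valsB : goV tabB etabB nsB (WB.FL 0) = true := by
  decide +kernel

lemma vB (i : ℕ) (hi : i < 41) : WB.N i = [1, 1, 3, 3, 7, 6, 13, 12, 23, 21, 45, 41, 87, 79, 167, 152, 321, 292, 619, 563, 1193, 1085, 2299, 2091, 4431, 4030, 8541, 7768, 16463, 14973, 31733, 28861, 61167, 55631, 117903, 107232, 227265, 206696, 438067, 398419, 844401].getD i 0 :=
  WB.vals_of tabB tabB_ok etabB etabB_ok nsB valsB i hi (by decide)

def rB : List ℕ := [0, 1, 1, 1, 1, 1, 3, 10, 1, 11, 1, 1, 1, 6, 5, 8, 1, 1, 12, 15, 13, 14, 17, 21, 1, 8, 22, 23, 7, 8, 25, 31, 2, 32, 1, 9, 4, 33, 1, 8, 16, 34, 14, 20, 24, 35, 8, 30, 1, 36, 8, 8, 8, 37, 19, 29, 18, 38, 8, 28, 26, 39, 27, 40]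
def xB : List ℕ := [2, 0, 1, 1, 1, 1, 0, 0, 0, 0, 0, 0, 0, 0, 0, 0, 1, 1, 0, 0, 0, 0, 0, 0, 1, 1, 0, 0, 0, 0, 0, 0, 0, 0, 0, 0, 0, 0, 1, 1, 0, 0, 1, 0, 0, 0, 1, 0, 0, 0, 0, 0, 0, 0, 0, 0, 0, 0, 1, 0, 0, 0, 0, 2]
lemma certB : ∀ (s : Fin 64) (b : Bool), (b = true → WB.c s = true) →
    rB.getD (WB.nxt s b).val 0 ≤ rB.getD s.val 0 ∧ (rB.getD (WB.nxt s b).val 0 = rB.getD s.val 0 →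
      (xB.getD s.val 0 ≠ 2 ∧ xB.getD s.val 0 + xB.getD (WB.nxt s b).val 0 = 1) ∨
      (xB.getD s.val 0 = 2 ∧ WB.nxt s b = s)) := by
  decide +kernel

def cpC : List ℕ := [0, 0, 0, 0, 0, 0, 0, 0, 0, 0, 0, 1, 0, 1, 0, 0, 4, 0, 2, 4, 0, 1, 0, 0, 1]
def cmC : List ℕ := [0, 0, 0, 0, 0, 0, 0, 0, 0, 0, 0, 0, 1, 0, 1, 4, 0, 2, 0, 0, 4, 0, 1, 1, 0]
def tabC : List (List ℕ) := [
  [0], [2, 3], [4], [6, 7], [8, 9], [58], [12, 13], [62], [0, 1], [50], [4, 5], [54], [56],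
  [58, 59], [60], [62, 63], [0, 1], [50], [4, 5], [54], [56], [58, 59], [60], [62, 63], [48],
  [50, 51], [52], [54, 55], [56, 57], [106], [60, 61], [110], [48], [50, 51], [52], [54, 55],
  [56, 57], [106], [60, 61], [110], [48, 49], [98], [52, 53], [102], [104], [106, 107], [108],
  [110, 111], [16], [18, 19], [20], [22, 23], [24, 25], [74], [28, 29], [78], [16, 17], [66],
  [20, 21], [70], [72], [74, 75], [76], [78, 79], [16, 17], [66], [20, 21], [70], [72], [74, 75],
  [76], [78, 79], [64], [66, 67], [68], [70, 71], [72, 73], [122], [76, 77], [126], [64], [66, 67],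
  [68], [70, 71], [72, 73], [122], [76, 77], [126], [64, 65], [114], [68, 69], [118], [120],
  [122, 123], [124], [126, 127], [32], [34, 35], [36], [38, 39], [40, 41], [90], [44, 45], [94],
  [32, 33], [82], [36, 37], [86], [88], [90, 91], [92], [94, 95], [32, 33], [82], [36, 37], [86],
  [88], [90, 91], [92], [94, 95], [80], [82, 83], [84], [86, 87], [88, 89], [138], [92, 93], [142],
  [80], [82, 83], [84], [86, 87], [88, 89], [138], [92, 93], [142], [80, 81], [130], [84, 85],
  [134], [136], [138, 139], [140], [142, 143]]
lemma tabC_ok : WC.tab = tabC := by decide +kernel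
def etabC : List (ℕ × ℕ) := [
  (0, 6), (2, 20), (7, 76), (9, 62), (11, 76), (12, 20), (14, 70), (17, 62), (19, 76), (20, 20),
  (22, 70), (24, 4), (29, 76), (31, 126), (32, 4), (37, 76), (39, 126), (41, 60), (46, 68),
  (50, 20), (53, 78), (55, 92), (59, 76), (60, 20), (67, 76), (68, 20), (72, 20), (74, 70),
  (77, 76), (80, 20), (82, 70), (85, 76), (89, 76), (91, 126), (92, 70), (94, 84), (96, 22),
  (98, 36), (103, 92), (105, 78), (107, 92), (108, 36), (110, 86), (113, 78), (115, 92), (116, 36),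
  (118, 86), (120, 20), (125, 92), (127, 142), (128, 20), (133, 92), (135, 142), (137, 76),
  (142, 84)]
lemma etabC_ok : WC.etab = etabC := by decide +kernel

lemma chkC : goC tabC cpC cmC (WC.FL 0) (List.replicate 144 0) (List.replicate 144 0) = true := by
  decide +kernel

lemma recC (L : ℕ) : comb cpC (fun i => WC.N (L + i)) = comb cmC (fun i => WC.N (L + i)) :=
  WC.comb_of tabC tabC_ok _ _ chkC (by decide +kernel) (by decide +kernel) L

def nsC : List ℕ := [1, 0, 1, 1, 5, 1, 7, 4, 21, 7, 37, 18, 89, 35, 173, 79, 383, 160, 777, 345, 1665, 712, 3441, 1509, 7277, 3141, 15159, 6612, 31885, 13815, 66645, 29002, 139865, 60695]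
lemma valsC : goV tabC etabC nsC (WC.FL 0) = true := by
  decide +kernel

lemma vC (i : ℕ) (hi : i < 34) : WC.N i = [1, 0, 1, 1, 5, 1, 7, 4, 21, 7, 37, 18, 89, 35, 173, 79, 383, 160, 777, 345, 1665, 712, 3441, 1509, 7277, 3141, 15159, 6612, 31885, 13815, 66645, 29002, 139865, 60695].getD i 0 :=
  WC.vals_of tabC tabC_ok etabC etabC_ok nsC valsC i hi (by decide)

def rC : List ℕ := [0, 1, 1, 1, 1, 2, 1, 1, 1, 1, 3, 10, 1, 1, 12, 24, 1, 1, 25, 26, 1, 1, 27, 28, 30, 32, 34, 36, 5, 8, 42, 44, 45, 46, 47, 48, 6, 7, 49, 50, 52, 54, 56, 62, 58, 60, 66, 78, 29, 51, 1, 31, 33, 55, 9, 35, 1, 4, 1, 1, 11, 41, 1, 23, 1, 63, 1, 1, 37, 79, 1, 39, 1, 1, 38, 40, 1, 15, 16, 22, 17, 71, 80, 81, 13, 82, 20, 21, 64, 68, 83, 85, 19, 21, 70, 76, 86, 87, 53, 88, 89, 90, 61, 91, 57, 92, 7, 59, 65, 93, 43, 77, 94, 95, 67, 96, 97, 98, 84,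 99, 18, 100, 14, 21, 69, 102, 21, 75, 103, 104, 105, 106, 107, 108, 109, 110, 72, 111, 101, 112, 73, 113, 74, 114]
def xC : List ℕ := [2, 0, 1, 1, 0, 0, 0, 0, 1, 1, 0, 0, 1, 1, 0, 0, 1, 1, 0, 0, 1, 1, 0, 0, 0, 0, 0, 0, 0, 0, 0, 0, 0, 0, 0, 0, 0, 0, 0, 0, 0, 0, 0, 0, 0, 0, 0, 0, 0, 0, 0, 0, 0, 0, 0, 0, 0, 0, 0, 0, 0, 0, 1, 0, 0, 0, 0, 0, 0, 0, 1, 0, 1, 1, 0, 0, 0, 0, 0, 0, 0, 0, 0, 0, 0, 0, 0, 0, 0, 0, 0, 0, 0, 0, 0, 0, 0, 0, 0, 0, 0, 0, 0, 0, 0, 0, 1, 0, 0, 0, 0, 0, 0, 0, 0, 0, 0, 0, 0, 0, 0, 0, 0, 1, 0, 0, 1, 0, 0, 0, 0, 0, 0, 0, 0, 0, 0, 0, 0, 0, 0, 0, 0, 2]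
lemma certC : ∀ (s : Fin 144) (b : Bool), (b = true → WC.c s = true) →
    rC.getD (WC.nxt s b).val 0 ≤ rC.getD s.val 0 ∧ (rC.getD (WC.nxt s b).val 0 = rC.getD s.val 0 →
      (xC.getD s.val 0 ≠ 2 ∧ xC.getD s.val 0 + xC.getD (WC.nxt s b).val 0 = 1) ∨
      (xC.getD s.val 0 = 2 ∧ WC.nxt s b = s)) := by
  decide +kernel

end GD

set_option linter.unusedSectionVars false
namespace GD
open Finset

lemma chkR : ∀ q : Fin 2, comb [1, 0, 1] (fun i => (WR.FL i).getD q.val 0) = comb [0, 2, 0] (fun i => (WR.FL i).getD q.val 0) := by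
  decide +kernel

lemma recR (L : ℕ) : comb [1, 0, 1] (fun i => WR.N (L + i)) = comb [0, 2, 0] (fun i => WR.N (L + i)) :=
  WR.comb_N _ _ (by decide +kernel) (by decide +kernel) chkR L

lemma NR_aux (L : ℕ) : WR.N (L + 1) = 1 ∧ WR.N (L + 2) = 1 := by
  induction L with
  | zero => rw [WR.N_eq _ (by omega), WR.N_eq _ (by omega)]; decide +kernel
  | succ L ih =>
    have := recR (L + 1)
    simp only [comb, zero_mul, zero_add, add_zero, one_mul, add_assoc, Nat.reduceAdd] at *
    omega

lemma NR (L : ℕ) : WR.N (L + 1) = 1 := (NR_aux L).1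

def rR : List ℕ := [0, 1]
def xR : List ℕ := [2, 2]
lemma certR : ∀ (s : Fin 2) (b : Bool), (b = true → WR.c s = true) →
    rR.getD (WR.nxt s b).val 0 ≤ rR.getD s.val 0 ∧ (rR.getD (WR.nxt s b).val 0 = rR.getD s.val 0 →
      (xR.getD s.val 0 ≠ 2 ∧ xR.getD s.val 0 + xR.getD (WR.nxt s b).val 0 = 1) ∨
      (xR.getD s.val 0 = 2 ∧ WR.nxt s b = s)) := by
  decide +kernel

lemma sA (L : ℕ) : (WA.N (L + 6) : ℤ) + WA.N L = 2 * WA.N (L + 4) := by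
  induction L using Nat.strong_induction_on with
  | _ L ih =>
    by_cases h : L < 7
    · interval_cases L <;> simp [vA]
    · obtain ⟨n, rfl⟩ : ∃ n, L = n + 7 := ⟨L - 7, by omega⟩
      have r0 := recA n
      have r1 := recA (n + 4)
      have r2 := recA (n + 6)
      simp only [comb, cpA, cmA, zero_mul, zero_add, add_zero, one_mul, add_assoc, Nat.reduceAdd] at r0 r1 r2
      have i1 := ih (n + 1) (by omega)
      have i2 := ih (n + 2) (by omega)
      have i3 := ih (n + 3) (by omega)
      have i4 := ih (n + 4) (by omega)
      have i6 := ih (n + 6) (by omega)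
      simp only [add_assoc, Nat.reduceAdd] at *
      omega

lemma sB (L : ℕ) : (WB.N (L + 10) : ℤ) + WB.N L = 2 * WB.N (L + 8) := by
  induction L using Nat.strong_induction_on with
  | _ L ih =>
    by_cases h : L < 31
    · interval_cases L <;> simp [vB]
    · obtain ⟨n, rfl⟩ : ∃ n, L = n + 31 := ⟨L - 31, by omega⟩
      have r0 := recB n
      have r1 := recB (n + 8)
      have r2 := recB (n + 10)
      simp only [comb, cpB, cmB, zero_mul, zero_add, add_zero, one_mul, add_assoc, Nat.reduceAdd] at r0 r1 r2
      have i12 := ih (n + 12) (by omega)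
      have i13 := ih (n + 13) (by omega)
      have i16 := ih (n + 16) (by omega)
      have i17 := ih (n + 17) (by omega)
      have i20 := ih (n + 20) (by omega)
      have i21 := ih (n + 21) (by omega)
      have i22 := ih (n + 22) (by omega)
      have i23 := ih (n + 23) (by omega)
      have i24 := ih (n + 24) (by omega)
      have i25 := ih (n + 25) (by omega)
      have i26 := ih (n + 26) (by omega)
      have i27 := ih (n + 27) (by omega)
      have i28 := ih (n + 28) (by omega)
      have i29 := ih (n + 29) (by omega)
      have i30 := ih (n + 30) (by omega)
      clear ih
      simp only [add_assoc, Nat.reduceAdd] at *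
      zify at r0 r1 r2
      linarith

lemma sC (L : ℕ) : (WC.N (L + 10) : ℤ) + 4 * WC.N (L + 4) = 2 * WC.N (L + 8) + 2 * WC.N (L + 6) + WC.N L := by
  induction L using Nat.strong_induction_on with
  | _ L ih =>
    by_cases h : L < 24
    · interval_cases L <;> simp [vC]
    · obtain ⟨n, rfl⟩ : ∃ n, L = n + 24 := ⟨L - 24, by omega⟩
      have r0 := recC n
      have r1 := recC (n + 4)
      have r2 := recC (n + 6)
      have r3 := recC (n + 8)
      have r4 := recC (n + 10)
      simp only [comb, cpC, cmC, zero_mul, zero_add, add_zero, one_mul, add_assoc, Nat.reduceAdd] at r0 r1 r2 r3 r4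
      have i11 := ih (n + 11) (by omega)
      have i12 := ih (n + 12) (by omega)
      have i13 := ih (n + 13) (by omega)
      have i14 := ih (n + 14) (by omega)
      have i15 := ih (n + 15) (by omega)
      have i16 := ih (n + 16) (by omega)
      have i17 := ih (n + 17) (by omega)
      have i18 := ih (n + 18) (by omega)
      have i19 := ih (n + 19) (by omega)
      have i20 := ih (n + 20) (by omega)
      have i21 := ih (n + 21) (by omega)
      have i22 := ih (n + 22) (by omega)
      have i23 := ih (n + 23) (by omega)
      clear ih
      simp only [add_assoc, Nat.reduceAdd] at *
      zify at r0 r1 r2 r3 r4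
      linarith

/-! Values along the relevant arithmetic progression. -/
def sqA (n : ℕ) : ℤ := WA.N (2 * n + 9)
def sqB (n : ℕ) : ℤ := WB.N (2 * n + 6)
def sqC (n : ℕ) : ℤ := WC.N (2 * n + 8)

lemma sqA_rec (n : ℕ) : sqA (n + 2) = sqA (n + 1) + sqA n + 1 := by
  induction n with
  | zero => simp [sqA, vA]; have := sA 7; simp [vA] at this; omega
  | succ n ih =>
    have h := sA (2 * n + 9)
    unfold sqA at *
    simp only [mul_add, add_assoc, Nat.reduceMul, Nat.reduceAdd] at *
    omega

lemma sqB_rec (n : ℕ) : sqB (n + 4) + 1 = sqB (n + 3) + sqB (n + 2) + sqB (n + 1) + sqB n := by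
  induction n with
  | zero => simp [sqB, vB]
  | succ n ih =>
    have h := sB (2 * n + 6)
    unfold sqB at *
    simp only [mul_add, add_assoc, Nat.reduceMul, Nat.reduceAdd] at *
    omega

lemma sqC_rec (n : ℕ) : sqC (n + 5) + 4 * sqC (n + 2) = 2 * sqC (n + 4) + 2 * sqC (n + 3) + sqC n := by
  have h := sC (2 * n + 8)
  unfold sqC at *
  simp only [mul_add, add_assoc, Nat.reduceMul, Nat.reduceAdd] at *
  omega

lemma sqB_le (n : ℕ) : sqB (n + 1) ≤ 2 * sqB n := by
  have nn : ∀ n, 0 ≤ sqB n := fun n => Int.natCast_nonneg _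
  by_cases h : n < 5
  · interval_cases n <;> simp [sqB, vB]
  · obtain ⟨m, rfl⟩ : ∃ m, n = m + 5 := ⟨n - 5, by omega⟩
    have h1 := sqB_rec (m + 1)
    have h2 := sqB_rec (m + 2)
    have := nn (m + 1)
    simp only [add_assoc, Nat.reduceAdd] at *
    omega

lemma sqC_ge (n : ℕ) : 2 * sqC (n + 3) ≤ sqC (n + 4) := by
  have nn : ∀ n, 0 ≤ sqC n := fun n => Int.natCast_nonneg _
  induction n using Nat.strong_induction_on with
  | _ n ih =>
    by_cases h : n < 2
    · interval_cases n <;> simp [sqC, vC]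
    · obtain ⟨m, rfl⟩ : ∃ m, n = m + 2 := ⟨n - 2, by omega⟩
      have h1 := sqC_rec (m + 1)
      have h2 := ih m (by omega)
      have := nn (m + 1)
      simp only [add_assoc, Nat.reduceAdd] at *
      omega

lemma sqB_lt_sqC (n : ℕ) : sqB n < sqC n := by
  by_cases h : n < 3
  · interval_cases n <;> simp [sqB, sqC, vB, vC]
  · obtain ⟨m, rfl⟩ : ∃ m, n = m + 3 := ⟨n - 3, by omega⟩
    clear h
    induction m with
    | zero => simp [sqB, sqC, vB, vC]
    | succ m ih =>
      have h1 := sqB_le (m + 3)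
      have h2 := sqC_ge m
      simp only [add_assoc, Nat.reduceAdd] at *
      omega

lemma sqA_val : sqA 0 = 15 ∧ sqA 1 = 25 ∧ sqA 2 = 41 ∧ sqA 3 = 67 := by
  have h0 : sqA 0 = 15 := by simp [sqA, vA]
  have h1 : sqA 1 = 25 := by simp [sqA, vA]
  have h2 := sqA_rec 0
  have h3 := sqA_rec 1
  simp only [Nat.reduceAdd, zero_add] at *
  omega

lemma sqA_lt_sqB (n : ℕ) : sqA (n + 2) < sqB (n + 2) ∧ sqA (n + 3) < sqB (n + 3) := by
  have nn : ∀ n, 0 < sqB n := by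
    intro n
    have h : ∀ n, 0 < sqB n ∧ 0 < sqB (n + 1) ∧ 0 < sqB (n + 2) ∧ 0 < sqB (n + 3) := by
      intro n
      induction n with
      | zero => simp [sqB, vB]
      | succ n ih =>
        have := sqB_rec n
        simp only [add_assoc, Nat.reduceAdd] at *
        omega
    exact (h n).1
  induction n with
  | zero =>
    obtain ⟨-, -, h2, h3⟩ := sqA_val
    simp only [zero_add]
    rw [h2, h3]
    simp [sqB, vB]
  | succ n ih =>
    have h1 := sqA_rec (n + 2)
    have h2 := sqB_rec n
    have := nn n
    have := nn (n + 1)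
    simp only [add_assoc, Nat.reduceAdd] at *
    omega

lemma fin_ineq (n : ℕ) : 1 < sqA n ∧ 1 < sqB n ∧ 1 < sqC n ∧ sqA n ≠ sqB n ∧ sqA n ≠ sqC n ∧ sqB n ≠ sqC n := by
  obtain ⟨a0, a1, -, -⟩ := sqA_val
  have hA : ∀ n, 1 < sqA n := by
    have h : ∀ n, 1 < sqA n ∧ 1 < sqA (n + 1) := by
      intro n
      induction n with
      | zero => simp only [zero_add]; omega
      | succ n ih => have := sqA_rec n; simp only [add_assoc, Nat.reduceAdd] at *; omega
    exact fun n => (h n).1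
  have hn := hA n
  have hBC := sqB_lt_sqC n
  by_cases h : n < 2
  · interval_cases n
    · have h1 : sqB 0 = 13 := by simp [sqB, vB]
      have h2 : sqC 0 = 21 := by simp [sqC, vC]
      omega
    · have h1 : sqB 1 = 23 := by simp [sqB, vB]
      have h2 : sqC 1 = 37 := by simp [sqC, vC]
      omega
  · obtain ⟨m, rfl⟩ : ∃ m, n = m + 2 := ⟨n - 2, by omega⟩
    have := (sqA_lt_sqB m).1
    omega
end GD

namespace GD
open Finset

/-- The normalised size of the support. -/
def HasInv (k d : ℕ) (N : ℕ) : Prop :=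
  ∃ _ : NeZero d, ∃ g p : ZMod d, 1 ≤ k ∧ g * p = 1 ∧ ZL g k ∧ (Sol g p k).card = N

lemma inv_eq {d k₁ k₂ N₁ N₂ : ℕ} (hd : 2 ≤ d) (h₁ : HasInv k₁ d N₁) (h₂ : HasInv k₂ d N₂)
    (h : EquivDS (Dset k₁ d) (Dset k₂ d)) : N₁ = N₂ := by
  classical
  obtain ⟨t, ht, a, h⟩ := h
  obtain ⟨i1, g1, p1, hk1, hg1, hz1, rfl⟩ := h₁
  obtain ⟨i2, g2, p2, hk2, hg2, hz2, rfl⟩ := h₂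
  letI : Fintype (GaloisField 2 d) := Fintype.ofFinite _
  have hF : Fintype.card (GaloisField 2 d) = 2 ^ d := by
    rw [← Nat.card_eq_fintype_card]; exact GaloisField.card 2 d (by omega)
  haveI : NeZero (2 ^ d - 1) := ⟨by
    have : 2 ^ 2 ≤ 2 ^ d := Nat.pow_le_pow_right (by decide) hd
    omega⟩
  have e := supp_equiv hd hF (Dset k₁ d) (Dset k₂ d) t ht a h
  unfold Dset at e
  rw [card_supp hd hF hk1 hg1 hz1, card_supp hd hF hk2 hg2 hz2] at e
  exact Nat.eq_of_mul_eq_mul_left (by omega) e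

lemma P_nat {d : ℕ} [NeZero d] (g j e : ℕ) (h : g * j % d = e) : P (g : ZMod d) (j : ZMod d) = 2 ^ e := by
  unfold P
  rw [← Nat.cast_mul, ZMod.val_natCast, h]

lemma g_nat {d : ℕ} (hd : 2 ≤ d) (g p : ℕ) (h : g * p % d = 1) : (g : ZMod d) * (p : ZMod d) = 1 := by
  rw [← Nat.cast_mul, ← Nat.cast_one, ZMod.natCast_eq_natCast_iff', h, Nat.mod_eq_of_lt (by omega)]

lemma mod_of {a d q e : ℕ} (h : a = d * q + e) (he : e < d) : a % d = e := by
  subst h; rw [Nat.mul_add_mod, Nat.mod_eq_of_lt he]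

lemma invR (n : ℕ) : HasInv 2 (2 * n + 11) 1 := by
  haveI : NeZero (2 * n + 11) := ⟨by omega⟩
  have hodd : Odd (2 * n + 11) := ⟨n + 5, by ring⟩
  have hg : ((1 : ℕ) : ZMod (2 * n + 11)) * ((1 : ℕ) : ZMod (2 * n + 11)) = 1 :=
    g_nat (by omega) 1 1 (Nat.mod_eq_of_lt (by omega))
  have hk : 2 = (([1] : List ℕ).map (fun j : ℕ => P ((1 : ℕ) : ZMod (2 * n + 11)) (j : ZMod (2 * n + 11)))).sum := by
    simp only [List.map_cons, List.map_nil, List.sum_cons, List.sum_nil]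
    rw [P_nat 1 1 1 (Nat.mod_eq_of_lt (by omega))]
    rfl
  refine ⟨inferInstance, (1 : ℕ), (1 : ℕ), by omega, hg, ?_, ?_⟩
  · exact WR.zero_lemma (by omega) hodd hg (by simp) hk (fun s => rR.getD s.val 0) (fun s => xR.getD s.val 0) certR
  · rw [WR.card_Sol_N (L := 2 * n + 8 + 1) (by omega) hg (by simp) hk, NR]

lemma invA (n : ℕ) : HasInv 6 (2 * n + 11) (WA.N (2 * n + 9)) := by
  haveI : NeZero (2 * n + 11) := ⟨by omega⟩
  have hodd : Odd (2 * n + 11) := ⟨n + 5, by ring⟩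
  have hg : ((1 : ℕ) : ZMod (2 * n + 11)) * ((1 : ℕ) : ZMod (2 * n + 11)) = 1 :=
    g_nat (by omega) 1 1 (Nat.mod_eq_of_lt (by omega))
  have hk : 6 = (([1, 2] : List ℕ).map (fun j : ℕ => P ((1 : ℕ) : ZMod (2 * n + 11)) (j : ZMod (2 * n + 11)))).sum := by
    simp only [List.map_cons, List.map_nil, List.sum_cons, List.sum_nil]
    rw [P_nat 1 1 1 (Nat.mod_eq_of_lt (by omega)), P_nat 1 2 2 (Nat.mod_eq_of_lt (by omega))]
    rfl
  refine ⟨inferInstance, (1 : ℕ), (1 : ℕ), by omega, hg, ?_, ?_⟩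
  · exact WA.zero_lemma (by omega) hodd hg (by simp) hk (fun s => rA.getD s.val 0) (fun s => xA.getD s.val 0) certA
  · rw [WA.card_Sol_N (L := 2 * n + 9) (by omega) hg (by simp) hk]

lemma invB (n g : ℕ) (h1 : g * 1 % (2 * n + 11) = g) (h2 : g * 2 % (2 * n + 11) = n + 6)
    (h4 : g * 4 % (2 * n + 11) = 1) : HasInv (2 ^ (n + 6) + 2 ^ g) (2 * n + 11) (WB.N (2 * n + 6)) := by
  haveI : NeZero (2 * n + 11) := ⟨by omega⟩
  have hodd : Odd (2 * n + 11) := ⟨n + 5, by ring⟩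
  have hg : (g : ZMod (2 * n + 11)) * ((4 : ℕ) : ZMod (2 * n + 11)) = 1 := g_nat (by omega) g 4 h4
  have hk : 2 ^ (n + 6) + 2 ^ g = (([1, 2] : List ℕ).map (fun j : ℕ => P (g : ZMod (2 * n + 11)) (j : ZMod (2 * n + 11)))).sum := by
    simp only [List.map_cons, List.map_nil, List.sum_cons, List.sum_nil]
    rw [P_nat g 1 g h1, P_nat g 2 _ h2]
    ring
  refine ⟨inferInstance, (g : ℕ), (4 : ℕ), ?_, hg, ?_, ?_⟩
  · exact le_trans (Nat.one_le_two_pow (n := n + 6)) (Nat.le_add_right _ _)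
  · exact WB.zero_lemma (by omega) hodd hg (by simp) hk (fun s => rB.getD s.val 0) (fun s => xB.getD s.val 0) certB
  · rw [WB.card_Sol_N (L := 2 * n + 6) (by omega) hg (by simp) hk]

lemma invC (n : ℕ) : HasInv (3 * 2 ^ (n + 6) + 4) (2 * n + 11) (WC.N (2 * n + 8)) := by
  haveI : NeZero (2 * n + 11) := ⟨by omega⟩
  have hodd : Odd (2 * n + 11) := ⟨n + 5, by ring⟩
  have hg : ((n + 6 : ℕ) : ZMod (2 * n + 11)) * ((2 : ℕ) : ZMod (2 * n + 11)) = 1 :=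
    g_nat (by omega) (n + 6) 2 (mod_of (q := 1) (by ring) (by omega))
  have hk : 3 * 2 ^ (n + 6) + 4 = (([1, 3, 4] : List ℕ).map (fun j : ℕ => P ((n + 6 : ℕ) : ZMod (2 * n + 11)) (j : ZMod (2 * n + 11)))).sum := by
    simp only [List.map_cons, List.map_nil, List.sum_cons, List.sum_nil]
    rw [P_nat (n + 6) 1 (n + 6) (mod_of (q := 0) (by ring) (by omega)),
      P_nat (n + 6) 3 (n + 7) (mod_of (q := 1) (by ring) (by omega)),
      P_nat (n + 6) 4 2 (mod_of (q := 2) (by ring) (by omega))]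
    ring
  refine ⟨inferInstance, (n + 6 : ℕ), (2 : ℕ), by omega, hg, ?_, ?_⟩
  · exact WC.zero_lemma (by omega) hodd hg (by simp) hk (fun s => rC.getD s.val 0) (fun s => xC.getD s.val 0) certC
  · rw [WC.card_Sol_N (L := 2 * n + 8) (by omega) hg (by simp) hk]

end GD

/-- For odd `d ≥ 11`, the difference sets arising from the regular, Segre, Glynn type (I)
and type (II) hyperovals are pairwise inequivalent. -/
theorem stmt_14 (d : ℕ) (hodd : Odd d) (hd : 11 ≤ d)
    (σ γ : ℕ) (hσ : σ = 2 ^ ((d + 1) / 2))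
    (hγ : γ = if d % 4 = 1 then 2 ^ ((3 * d + 1) / 4) else 2 ^ ((d + 1) / 4)) :
    ¬ EquivDS (Dset 2 d) (Dset 6 d) ∧
    ¬ EquivDS (Dset 2 d) (Dset (σ + γ) d) ∧
    ¬ EquivDS (Dset 2 d) (Dset (3 * σ + 4) d) ∧
    ¬ EquivDS (Dset 6 d) (Dset (σ + γ) d) ∧
    ¬ EquivDS (Dset 6 d) (Dset (3 * σ + 4) d) ∧
    ¬ EquivDS (Dset (σ + γ) d) (Dset (3 * σ + 4) d) := by
  obtain ⟨n, rfl⟩ : ∃ n, d = 2 * n + 11 := by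
    obtain ⟨m, rfl⟩ := hodd
    exact ⟨m - 5, by omega⟩
  have hσ' : σ = 2 ^ (n + 6) := by rw [hσ]; congr 1; omega
  have hR := GD.invR n
  have hA := GD.invA n
  have hB : GD.HasInv (σ + γ) (2 * n + 11) (GD.WB.N (2 * n + 6)) := by
    rw [hσ', hγ]
    split_ifs with h4
    · obtain ⟨m, rfl⟩ : ∃ m, n = 2 * m + 1 := ⟨(n - 1) / 2, by omega⟩
      rw [show (3 * (2 * (2 * m + 1) + 11) + 1) / 4 = 3 * m + 10 by omega]
      exact GD.invB _ _ (GD.mod_of (q := 0) (by ring) (by omega)) (GD.mod_of (q := 1) (by ring) (by omega))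
        (GD.mod_of (q := 3) (by ring) (by omega))
    · obtain ⟨m, rfl⟩ : ∃ m, n = 2 * m := ⟨n / 2, by omega⟩
      rw [show (2 * (2 * m) + 11 + 1) / 4 = m + 3 by omega]
      exact GD.invB _ _ (GD.mod_of (q := 0) (by ring) (by omega)) (GD.mod_of (q := 0) (by ring) (by omega))
        (GD.mod_of (q := 1) (by ring) (by omega))
  have hC : GD.HasInv (3 * σ + 4) (2 * n + 11) (GD.WC.N (2 * n + 8)) := by
    rw [hσ']; exact GD.invC n
  obtain ⟨h1, h2, h3, h4, h5, h6⟩ := GD.fin_ineq n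
  simp only [GD.sqA, GD.sqB, GD.sqC] at h1 h2 h3 h4 h5 h6
  refine ⟨fun h => ?_, fun h => ?_, fun h => ?_, fun h => ?_, fun h => ?_, fun h => ?_⟩
  · have := GD.inv_eq (by omega) hR hA h; omega
  · have := GD.inv_eq (by omega) hR hB h; omega
  · have := GD.inv_eq (by omega) hR hC h; omega
  · have := GD.inv_eq (by omega) hA hB h; omega
  · have := GD.inv_eq (by omega) hA hC h; omega
  · have := GD.inv_eq (by omega) hB hC h; omega
end

section
/- Let d ≥ 7 be odd and suppose 2^d−1 is prime. Let α be a generator of F_{2^d}^* and let Q_d = {α^r : 0 < r < 2^d−1, r is a square modulo 2^d−1} be the quadratic residue difference set. Let σ = 2^{(d+1)/2}, and γ = 2^{(3d+1)/4} if d ≡ 1 (mod 4), γ = 2^{(d+1)/4} if d ≡ 3 (mod 4). Then Q_d is not equivalent to D_{k,d} for any k ∈ {2^i : 1 ≤ i < d, gcd(i,d) = 1} ∪ {6, σ+γ, 3σ+4}. -/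
open Finset in
lemma pow_inj_aux {F : Type*} [Field F] [Fintype F] {p n : ℕ} (hF : Fintype.card F = p + 1)
    (hn : Nat.Coprime n p) {z w : F} (hz : z ≠ 0) (hw : w ≠ 0) (h : z ^ n = w ^ n) : z = w := by
  have h1 : (z / w) ^ n = 1 := by
    rw [div_pow, h, div_self (pow_ne_zero _ hw)]
  have h2 : (z / w) ^ p = 1 := by
    have := FiniteField.pow_card_sub_one_eq_one (z / w) (div_ne_zero hz hw)
    rwa [hF, Nat.add_sub_cancel] at this
  have h3 : (z / w) ^ (Nat.gcd n p) = 1 := pow_gcd_eq_one.2 ⟨h1, h2⟩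
  rw [hn, pow_one] at h3
  exact (div_eq_one_iff_eq hw).1 h3

open Finset in
lemma offdiag_card {F : Type*} [Field F] [Fintype F] [DecidableEq F] [CharP F 2] {p n : ℕ}
    (hF : Fintype.card F = p + 1) (hn : Nat.Coprime n p) :
    #{q : F × F | q.1 ≠ q.2 ∧ q.1 + q.1 ^ (n + 1) = q.2 + q.2 ^ (n + 1)} ≤ p + 1 := by
  rw [← hF, ← Finset.card_univ]
  refine Finset.card_le_card_of_injOn (fun q => q.1 / (q.1 + q.2)) (by simp) ?_
  have key : ∀ x y : F, x ≠ y → x + x ^ (n + 1) = y + y ^ (n + 1) →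
      (x + y) ^ n * ((x / (x + y)) ^ (n + 1) + (1 + x / (x + y)) ^ (n + 1)) = 1 := by
    intro x y hxy h
    have hz : x + y ≠ 0 := by
      intro h0
      exact hxy ((CharTwo.add_eq_zero).1 h0)
    have e1 : 1 + x / (x + y) = y / (x + y) := by
      field_simp
      have : x + x = 0 := CharTwo.add_self_eq_zero x
      linear_combination this
    rw [e1, div_pow, div_pow, ← add_div, mul_div_assoc', div_eq_one_iff_eq (pow_ne_zero _ hz), pow_succ (x + y)]
    congr 1
    have a1 : x + x = 0 := CharTwo.add_self_eq_zero x
    have a2 := CharTwo.add_self_eq_zero (y ^ (n + 1))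
    linear_combination h - a1 + a2
  rintro ⟨x, y⟩ hx ⟨x', y'⟩ hx' hs
  simp only [coe_filter, mem_univ, true_and, Set.mem_ofPred_eq] at hx hx' hs
  have hz : x + y ≠ 0 := fun h0 => hx.1 ((CharTwo.add_eq_zero).1 h0)
  have hz' : x' + y' ≠ 0 := fun h0 => hx'.1 ((CharTwo.add_eq_zero).1 h0)
  have k1 := key x y hx.1 hx.2
  have k2 := key x' y' hx'.1 hx'.2
  rw [← hs] at k2
  have hne : ((x / (x + y)) ^ (n + 1) + (1 + x / (x + y)) ^ (n + 1)) ≠ 0 := by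
    intro h0
    rw [h0, mul_zero] at k1
    exact zero_ne_one k1
  have hzz : x + y = x' + y' :=
    pow_inj_aux hF hn hz hz' (mul_right_cancel₀ hne (k1.trans k2.symm))
  rw [hzz] at hs
  have hxx : x = x' := by
    rwa [div_left_inj' hz'] at hs
  subst hxx
  rw [add_left_cancel hzz]

open Finset in
lemma fiber_two {F : Type*} [Field F] [Fintype F] [DecidableEq F] [CharP F 2] {p n : ℕ}
    (hF : Fintype.card F = p + 1) (hn : Nat.Coprime n p)
    (hI : 2 * #(univ.image (fun x : F => x + x ^ (n + 1))) = p + 1) :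
    ∀ v ∈ univ.image (fun x : F => x + x ^ (n + 1)), #{x : F | x + x ^ (n + 1) = v} = 2 := by
  set τ : F → F := fun x => x + x ^ (n + 1) with hτ
  set I := univ.image τ with hIdef
  have h1 : ∑ v ∈ I, #{x : F | τ x = v} = p + 1 := by
    rw [← hF, ← Finset.card_univ]
    exact (card_eq_sum_card_image τ univ).symm
  have h2 : ∑ v ∈ I, #{x : F | τ x = v} ^ 2 ≤ 2 * (p + 1) := by
    have e : ∑ v ∈ I, #{x : F | τ x = v} ^ 2 = #{q : F × F | τ q.1 = τ q.2} := by
      rw [card_eq_sum_card_fiberwise (f := fun q => τ q.1) (t := I)]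
      · refine sum_congr rfl fun v _ => ?_
        rw [sq, ← card_product]
        congr 1
        ext ⟨x, y⟩
        simp only [mem_product, mem_filter, mem_univ, true_and]
        constructor
        · rintro ⟨a, b⟩; exact ⟨a.trans b.symm, a⟩
        · rintro ⟨a, b⟩; exact ⟨b, a ▸ b⟩
      · intro q _
        simp [hIdef]
    rw [e]
    have hsub : ({q : F × F | τ q.1 = τ q.2} : Finset (F × F)) ⊆
        (univ.image fun x : F => (x, x)) ∪
          ({q : F × F | q.1 ≠ q.2 ∧ q.1 + q.1 ^ (n + 1) = q.2 + q.2 ^ (n + 1)} : Finset (F × F)) := by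
      rintro ⟨x, y⟩ h
      simp only [mem_filter, mem_univ, true_and, mem_union, mem_image, Prod.mk.injEq] at h ⊢
      by_cases hxy : x = y
      · left; exact ⟨x, rfl, hxy⟩
      · right; exact ⟨hxy, h⟩
    refine (card_le_card hsub).trans ((card_union_le _ _).trans ?_)
    have := offdiag_card (n := n) hF hn
    have h3 : #(univ.image fun x : F => (x, x)) ≤ p + 1 := by
      rw [← hF, ← Finset.card_univ]; exact card_image_le
    omega
  have h3 : ∑ v ∈ I, ((#{x : F | τ x = v} : ℤ) - 2) ^ 2 ≤ 0 := by
    have e : ∑ v ∈ I, ((#{x : F | τ x = v} : ℤ) - 2) ^ 2 =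
        ((∑ v ∈ I, #{x : F | τ x = v} ^ 2 : ℕ) : ℤ) - 4 * ((∑ v ∈ I, #{x : F | τ x = v} : ℕ) : ℤ)
          + 4 * (#I : ℤ) := by
      push_cast
      rw [mul_sum, ← sum_sub_distrib]
      have : (4 * (#I : ℤ)) = ∑ v ∈ I, (4 : ℤ) := by simp [mul_comm]
      rw [this, ← sum_add_distrib]
      refine sum_congr rfl fun v _ => by ring
    rw [e]
    omega
  have h4 := (sum_eq_zero_iff_of_nonneg (fun v _ => sq_nonneg _)).1
    (le_antisymm h3 (sum_nonneg fun v _ => sq_nonneg _))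
  intro v hv
  have := h4 v hv
  rw [sq_eq_zero_iff] at this
  simp only [hτ] at this
  omega

open Finset in
lemma teich_sum {F : Type*} [Field F] [Fintype F] [CharP F 2] {p m : ℕ}
    (hF : Fintype.card F = p + 1) (hm : ¬ p ∣ m) :
    ∑ x : F, (WittVector.teichmuller 2 x) ^ m = 0 := by
  classical
  obtain ⟨g, hg⟩ := IsCyclic.exists_generator (α := Fˣ)
  have hcard : orderOf g = p := by
    rw [orderOf_eq_card_of_forall_mem_zpowers hg, Nat.card_eq_fintype_card, Fintype.card_units, hF,
      Nat.add_sub_cancel]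
  have hg1 : (g : F) ^ m ≠ 1 := by
    intro h
    apply hm
    rw [← hcard]
    exact orderOf_dvd_of_pow_eq_one (Units.ext (by simpa using h))
  have h1 : (WittVector.teichmuller 2 (g : F)) ^ m * ∑ x : F, (WittVector.teichmuller 2 x) ^ m =
      ∑ x : F, (WittVector.teichmuller 2 x) ^ m := by
    rw [mul_sum, ← Equiv.sum_comp (Units.mulLeft g) (fun x : F => (WittVector.teichmuller 2 x) ^ m)]
    refine sum_congr rfl fun x _ => ?_
    rw [← mul_pow, ← map_mul]
    rfl
  have h2 : (WittVector.teichmuller 2 (g : F)) ^ m ≠ 1 := by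
    intro h
    apply hg1
    have := congrArg WittVector.constantCoeff h
    rw [map_pow, map_one] at this
    exact this
  have h3 : ((WittVector.teichmuller 2 (g : F)) ^ m - 1) *
      ∑ x : F, (WittVector.teichmuller 2 x) ^ m = 0 := by
    rw [sub_mul, h1, one_mul, sub_self]
  exact (mul_eq_zero.1 h3).resolve_left (sub_ne_zero.2 h2)

open Finset in
lemma Szero {F : Type*} [Field F] [Fintype F] [DecidableEq F] [CharP F 2] {p n j : ℕ}
    (hF : Fintype.card F = p + 1) 
    (h2 : ∀ v ∈ univ.image (fun x : F => x + x ^ (n + 1)), #{x : F | x + x ^ (n + 1) = v} = 2)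
    (hj : ∀ i ≤ 2 * j, ¬ p ∣ 2 * j + n * i) :
    ∑ v ∈ univ.image (fun x : F => x + x ^ (n + 1)), v ^ j = 0 := by
  set τ : F → F := fun x => x + x ^ (n + 1) with hτ
  set I := univ.image τ with hIdef
  set ω := WittVector.teichmuller (R := F) 2 with hω
  have two_ne : (2 : WittVector 2 F) ≠ 0 := by
    exact_mod_cast WittVector.p_nonzero 2 F
  have hdvd : ∀ y : WittVector 2 F, WittVector.constantCoeff y = 0 → ∃ z, y = 2 * z := by
    intro y hy
    have := (WittVector.mem_span_p_iff_coeff_zero_eq_zero (p := 2) y).2 hy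
    rw [Ideal.mem_span_singleton] at this
    obtain ⟨z, hz⟩ := this
    exact ⟨z, by exact_mod_cast hz⟩
  have hc : ∀ x, WittVector.constantCoeff (ω x) = x := fun x => WittVector.teichmuller_coeff_zero 2 x
  have s1 : ∑ x : F, (ω x + ω x ^ (n + 1)) ^ (2 * j) = 0 := by
    have : ∀ x : F, (ω x + ω x ^ (n + 1)) ^ (2 * j) =
        ∑ i ∈ range (2 * j + 1), ((2 * j).choose i : WittVector 2 F) * ω x ^ (2 * j + n * i) := by
      intro x
      rw [add_comm, add_pow]
      refine sum_congr rfl fun i hi => ?_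
      rw [← pow_mul, ← pow_add, mul_comm]
      congr 2
      have : i ≤ 2 * j := by simpa [Nat.lt_succ_iff] using hi
      zify [this]; ring
    simp_rw [this]
    rw [sum_comm]
    refine sum_eq_zero fun i hi => ?_
    rw [← mul_sum, teich_sum hF (hj i (by simpa [Nat.lt_succ_iff] using hi)), mul_zero]
  have s2 : ∀ x : F, ∃ z, (ω x + ω x ^ (n + 1)) ^ (2 * j) = ω (τ x) ^ (2 * j) + 4 * z := by
    intro x
    obtain ⟨y, hy⟩ := hdvd (ω x + ω x ^ (n + 1) - ω (τ x)) (by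
      simp only [map_sub, map_add, map_pow, hc, hτ, sub_self])
    have e : (ω x + ω x ^ (n + 1)) ^ 2 - ω (τ x) ^ 2 = 4 * (y * ω (τ x) + y ^ 2) := by
      rw [sub_eq_iff_eq_add.1 hy]; ring
    rw [pow_mul, pow_mul]
    have := sub_dvd_pow_sub_pow ((ω x + ω x ^ (n + 1)) ^ 2) (ω (τ x) ^ 2) j
    rw [e] at this
    obtain ⟨c, hc'⟩ := (Dvd.intro _ rfl).trans this
    exact ⟨c, by rw [← hc']; ring⟩
  choose z hz using s2
  have s3 : ∑ x : F, ω (τ x) ^ (2 * j) = 2 * ∑ v ∈ I, ω v ^ (2 * j) := by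
    rw [← sum_fiberwise_of_maps_to (s := univ) (t := I) (g := τ) (fun x _ => by simp [hIdef]), mul_sum]
    refine sum_congr rfl fun v hv => ?_
    have : ∀ x ∈ ({x : F | τ x = v} : Finset F), ω (τ x) ^ (2 * j) = ω v ^ (2 * j) := by
      intro x hx
      rw [(mem_filter.1 hx).2]
    rw [sum_congr rfl this, sum_const, h2 v hv, nsmul_eq_mul]
    norm_num
  have s4 : 2 * (∑ v ∈ I, ω v ^ (2 * j) + 2 * ∑ x, z x) = 0 := by
    rw [← s1]
    simp_rw [hz]
    rw [sum_add_distrib, s3, ← mul_sum]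
    ring
  have s5 := (mul_eq_zero.1 s4).resolve_left two_ne
  have s6 := congrArg WittVector.constantCoeff s5
  simp only [map_add, map_sum, map_pow, map_mul, hc, map_zero, map_ofNat] at s6
  have t0 : (2 : F) = 0 := CharTwo.two_eq_zero
  have t1 : ∑ x ∈ I, x ^ (2 * j) = 0 := by
    linear_combination s6 - (∑ x, WittVector.constantCoeff (z x)) * t0
  have s7 : (∑ v ∈ I, v ^ j) ^ 2 = 0 := by
    rw [← t1, sum_pow_char 2]
    refine sum_congr rfl fun v _ => by rw [← pow_mul, mul_comm]
  exact pow_eq_zero_iff (two_ne_zero) |>.1 s7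

open Finset in
lemma split_sum {p : ℕ} [Fact p.Prime] (h3 : ¬ IsSquare (3 : ZMod p)) {M : Type*} [AddCommMonoid M]
    [DecidablePred (fun r : ZMod p => r ≠ 0 ∧ IsSquare r)]
    (g : ZMod p → M) :
    ∑ r, g r = g 0 + (∑ r with r ≠ 0 ∧ IsSquare r, g r + ∑ r with r ≠ 0 ∧ IsSquare r, g (3 * r)) := by
  classical
  have h30 : (3 : ZMod p) ≠ 0 := by
    intro h; rw [h] at h3; exact h3 (IsSquare.zero)
  have hp2 : ringChar (ZMod p) ≠ 2 := by
    rw [ZMod.ringChar_zmod_n]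
    intro h2
    subst h2
    exact h3 ⟨1, by clear h3; decide +revert⟩
  have e1 : ∑ r with r ≠ 0 ∧ IsSquare r, g (3 * r) =
      ∑ r : ZMod p with r ≠ 0 ∧ ¬ IsSquare r, g r := by
    refine sum_nbij (fun r => 3 * r) ?_ ?_ ?_ ?_
    · intro r hr
      simp only [mem_filter, mem_univ, true_and] at hr ⊢
      refine ⟨mul_ne_zero h30 hr.1, fun h => h3 ?_⟩
      have := h.div hr.2
      rwa [mul_div_cancel_right₀ _ hr.1] at this
    · intro a _ b _ h
      exact mul_left_cancel₀ h30 h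
    · intro r hr
      simp only [coe_filter, mem_univ, true_and, Set.mem_ofPred_eq] at hr
      refine ⟨r / 3, ?_, by field_simp⟩
      simp only [coe_filter, mem_univ, true_and, Set.mem_ofPred_eq]
      have hr3 : r / 3 ≠ 0 := div_ne_zero hr.1 h30
      refine ⟨hr3, ?_⟩
      have a1 := (quadraticChar_neg_one_iff_not_isSquare (F := ZMod p)).2 hr.2
      have a2 := (quadraticChar_neg_one_iff_not_isSquare (F := ZMod p)).2 h3
      have a3 : quadraticChar (ZMod p) r = quadraticChar (ZMod p) (r / 3) * quadraticChar (ZMod p) 3 := by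
        rw [← map_mul, div_mul_cancel₀ _ h30]
      rw [a1, a2] at a3
      exact (quadraticChar_one_iff_isSquare hr3).1 (by linarith)
    · intro _ _; rfl
  rw [e1, ← add_sum_erase univ g (mem_univ 0)]
  congr 1
  rw [← sum_filter_add_sum_filter_not (univ.erase 0) (fun r => IsSquare r)]
  congr 1
  · refine sum_congr ?_ fun _ _ => rfl
    ext r; simp
  · refine sum_congr ?_ fun _ _ => rfl
    ext r; simp

lemma three_nonsq {p : ℕ} [Fact p.Prime] (h4 : p % 4 = 3) (h3 : p % 3 = 1) :
    ¬ IsSquare (3 : ZMod p) := by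
  have : Fact (Nat.Prime 3) := ⟨by norm_num⟩
  have := ZMod.exists_sq_eq_prime_iff_of_mod_four_eq_three (p := p) (q := 3) h4 (by norm_num)
    (by rintro rfl; omega)
  push_cast at this
  rw [this, not_not]
  have : (p : ZMod 3) = 1 := by
    have := (ZMod.natCast_eq_natCast_iff p 1 3).2 h3
    simpa using this
  rw [this]
  exact IsSquare.one

open Finset in
/-- The core contradiction. -/
lemma core (d n j : ℕ) (hd : d ≠ 0) (hp : Nat.Prime (2 ^ d - 1)) (h4 : (2 ^ d - 1) % 4 = 3)
    (h3 : (2 ^ d - 1) % 3 = 1)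
    (α : (GaloisField 2 d)ˣ) (hα : ∀ x : (GaloisField 2 d)ˣ, x ∈ Subgroup.zpowers α)
    (hn : ¬ (2 ^ d - 1) ∣ n)
    (hj : j ≡ 3 * n [MOD 2 ^ d - 1])
    (h1 : ∀ i ≤ 2 * n, ¬ (2 ^ d - 1) ∣ 2 * n + n * i)
    (h2 : ∀ i ≤ 2 * j, ¬ (2 ^ d - 1) ∣ 2 * j + n * i) :
    ¬ EquivDS
      {u : (GaloisField 2 d)ˣ | ∃ r : ℕ, 0 < r ∧ r < 2 ^ d - 1 ∧
        (∃ b : ℕ, b ^ 2 ≡ r [MOD 2 ^ d - 1]) ∧ u = α ^ r}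
      (Dset (n + 1) d) := by
  classical
  rintro ⟨t, ht, a, hQ⟩
  have hZ : ((2 : ℤ) ^ d - 1) = ((2 ^ d - 1 : ℕ) : ℤ) := by
    push_cast [Nat.one_le_two_pow]; rfl
  rw [hZ] at ht
  have : Fintype (GaloisField 2 d) := Fintype.ofFinite _
  have hF0 : Fintype.card (GaloisField 2 d) = 2 ^ d := by
    rw [← Nat.card_eq_fintype_card, GaloisField.card 2 d hd]
  have hF : Fintype.card (GaloisField 2 d) = (2 ^ d - 1) + 1 := by
    rw [hF0]; have := Nat.one_le_two_pow (n := d); omega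
  generalize 2 ^ d - 1 = p at *
  have : Fact p.Prime := ⟨hp⟩
  have hns := three_nonsq h4 h3
  have hord : orderOf α = p := by
    rw [orderOf_eq_card_of_forall_mem_zpowers hα, Nat.card_eq_fintype_card, Fintype.card_units, hF,
      Nat.add_sub_cancel]
  have hup : ∀ u : (GaloisField 2 d)ˣ, u ^ p = 1 := by
    intro u
    have := pow_card_eq_one (x := u)
    rwa [Fintype.card_units, hF, Nat.add_sub_cancel] at this
  set R : Finset (ZMod p) := {r | r ≠ 0 ∧ IsSquare r} with hR
  -- the quadratic residues set
  have hQ' : {u : (GaloisField 2 d)ˣ | ∃ r : ℕ, 0 < r ∧ r < p ∧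
        (∃ b : ℕ, b ^ 2 ≡ r [MOD p]) ∧ u = α ^ r} = ((R.image fun r => α ^ r.val : Finset _) : Set _) := by
    ext u
    simp only [Set.mem_ofPred_eq, coe_image, Set.mem_image, mem_coe, hR, mem_filter, mem_univ, true_and]
    constructor
    · rintro ⟨r, h0, hlt, ⟨b, hb⟩, rfl⟩
      refine ⟨(r : ZMod p), ⟨?_, ?_⟩, ?_⟩
      · rw [Ne, ZMod.natCast_eq_zero_iff]
        exact Nat.not_dvd_of_pos_of_lt h0 hlt
      · have := (ZMod.natCast_eq_natCast_iff _ _ _).2 hb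
        rw [← this]
        push_cast
        exact IsSquare.sq _
      · rw [ZMod.val_cast_of_lt hlt]
    · rintro ⟨r, ⟨h0, b, hb⟩, rfl⟩
      refine ⟨r.val, ?_, ZMod.val_lt r, ⟨b.val, ?_⟩, rfl⟩
      · rw [Nat.pos_iff_ne_zero, Ne, ZMod.val_eq_zero]; exact h0
      · rw [← ZMod.natCast_eq_natCast_iff]
        push_cast
        rw [ZMod.natCast_zmod_val, ZMod.natCast_zmod_val, hb, sq]
  rw [hQ'] at hQ
  have hRinj : Function.Injective (fun r : ZMod p => α ^ r.val) := by
    intro r s h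
    have := pow_inj_mod.1 h
    rw [hord, Nat.mod_eq_of_lt (ZMod.val_lt r), Nat.mod_eq_of_lt (ZMod.val_lt s)] at this
    exact ZMod.val_injective p this
  have hRcard : 2 * #R + 1 = p := by
    have := split_sum hns (fun _ => (1 : ℕ))
    simp only [sum_const, card_univ, ZMod.card, smul_eq_mul, mul_one] at this
    rw [← hR] at this
    omega
  -- the set D
  set D : Finset (GaloisField 2 d)ˣ := {u | u ∈ Dset (n + 1) d} with hD
  have hQD : (R.image fun r => α ^ r.val) = D.image (fun x => x ^ t * a) := by
    apply Finset.coe_injective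
    rw [hQ, coe_image]
    congr 1
    ext u; simp [hD]
  obtain ⟨s, hs⟩ : ∃ s : ℕ, (p : ℤ) ∣ t * s - 1 := by
    have ht0 : ((t : ℤ) : ZMod p) ≠ 0 := by
      rw [Ne, ZMod.intCast_zmod_eq_zero_iff_dvd]
      intro h
      have : (p : ℤ) ∣ ((t.gcd p : ℕ) : ℤ) := Int.dvd_coe_gcd h (dvd_refl _)
      rw [ht] at this
      have := Int.natCast_dvd_natCast.1 this
      exact hp.one_lt.ne' (Nat.dvd_one.1 this)
    refine ⟨((t : ZMod p)⁻¹).val, ?_⟩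
    rw [← ZMod.intCast_zmod_eq_zero_iff_dvd]
    push_cast
    rw [ZMod.natCast_zmod_val, mul_inv_cancel₀ ht0, sub_self]
  have hts : ∀ x : (GaloisField 2 d)ˣ, (x ^ t) ^ s = x := by
    intro x
    obtain ⟨c, hc⟩ := hs
    rw [← zpow_natCast, ← zpow_mul, sub_eq_iff_eq_add.1 hc, zpow_add, zpow_mul, zpow_natCast, hup,
      one_zpow, one_mul, zpow_one]
  have hDinj : Function.Injective (fun x : (GaloisField 2 d)ˣ => x ^ t * a) := by
    intro x y h
    have h' : x ^ t = y ^ t := mul_right_cancel h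
    rw [← hts x, h', hts y]
  have hDcard : #D = #R := by
    rw [← card_image_of_injective D hDinj, ← hQD, card_image_of_injective R hRinj]
  have hDmem : ∀ u, u ∈ D ↔ ∃ x : GaloisField 2 d, x + x ^ (n + 1) = (u : GaloisField 2 d) := by
    intro u
    rw [hD, mem_filter]
    exact ⟨fun h => h.2, fun h => ⟨mem_univ _, h⟩⟩
  have hI : univ.image (fun x : GaloisField 2 d => x + x ^ (n + 1)) =
      insert 0 (D.image fun u : (GaloisField 2 d)ˣ => (u : GaloisField 2 d)) := by
    ext v
    simp only [mem_image, mem_univ, true_and, mem_insert, hDmem]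
    constructor
    · rintro ⟨x, rfl⟩
      by_cases h : x + x ^ (n + 1) = 0
      · left; exact h
      · right; exact ⟨Units.mk0 _ h, ⟨x, rfl⟩, rfl⟩
    · rintro (rfl | ⟨u, ⟨x, hx⟩, rfl⟩)
      · exact ⟨0, by simp⟩
      · exact ⟨x, hx⟩
  have hnot0 : (0 : GaloisField 2 d) ∉ (D.image fun u : (GaloisField 2 d)ˣ => (u : GaloisField 2 d)) := by
    simp
  have hIcard : 2 * #(univ.image (fun x : GaloisField 2 d => x + x ^ (n + 1))) = p + 1 := by
    rw [hI, card_insert_of_notMem hnot0, card_image_of_injective _ Units.val_injective, hDcard]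
    omega
  have hcop : Nat.Coprime n p := ((Nat.Prime.coprime_iff_not_dvd hp).2 hn).symm
  have hfib := fiber_two hF hcop hIcard
  -- transfer to Q
  have trans : ∀ l : ℕ, (∀ i ≤ 2 * l, ¬ p ∣ 2 * l + n * i) →
      ∑ r ∈ R, ((α ^ (r.val * (s * l)) : (GaloisField 2 d)ˣ) : GaloisField 2 d) = 0 := by
    intro l hl
    have hl0 : l ≠ 0 := by
      rintro rfl
      exact hl 0 (by simp) (by simp)
    have S := Szero hF hfib hl
    rw [hI, sum_insert hnot0, zero_pow hl0, zero_add, sum_image (by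
      intro x _ y _ h; exact Units.ext h)] at S
    have e : ∑ u ∈ (R.image fun r => α ^ r.val), ((u ^ (s * l) : (GaloisField 2 d)ˣ) : GaloisField 2 d)
        = ∑ r ∈ R, ((α ^ (r.val * (s * l)) : (GaloisField 2 d)ˣ) : GaloisField 2 d) := by
      rw [sum_image (fun x _ y _ h => hRinj h)]
      refine sum_congr rfl fun r _ => by rw [pow_mul α]
    rw [← e, hQD, sum_image (fun x _ y _ h => hDinj h)]
    have e2 : ∀ x ∈ D, (((x ^ t * a) ^ (s * l) : (GaloisField 2 d)ˣ) : GaloisField 2 d) =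
        ((a ^ (s * l) : (GaloisField 2 d)ˣ) : GaloisField 2 d) * (x : GaloisField 2 d) ^ l := by
      intro x _
      rw [mul_pow, pow_mul (x ^ t), hts, mul_comm]
      push_cast
      rfl
    rw [sum_congr rfl e2, ← mul_sum, S, mul_zero]
  have A := trans n h1
  have B := trans j h2
  set g : ZMod p → GaloisField 2 d := fun r => ((α ^ (r.val * (s * n)) : (GaloisField 2 d)ˣ) : GaloisField 2 d) with hg
  have hpow : ∀ x y : ℕ, (x : ZMod p) = y → α ^ x = α ^ y := by
    intro x y h
    rw [pow_inj_mod, hord]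
    exact (ZMod.natCast_eq_natCast_iff _ _ _).1 h
  have hB' : ∑ r ∈ R, g (3 * r) = 0 := by
    rw [← B]
    refine sum_congr rfl fun r _ => ?_
    simp only [hg]
    congr 1
    apply hpow
    have hj' := (ZMod.natCast_eq_natCast_iff _ _ _).2 hj
    push_cast at hj' ⊢
    rw [hj']
    simp only [ZMod.natCast_zmod_val]
    ring
  have hall := split_sum hns g
  rw [← hR, hB', A] at hall
  have hg0 : g 0 = 1 := by simp [hg]
  have hg1 : g 1 ≠ 1 := by
    intro h
    simp only [hg] at h
    have h' : α ^ ((1 : ZMod p).val * (s * n)) = 1 := Units.ext h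
    have hod := orderOf_dvd_of_pow_eq_one h'
    have : Fact (1 < p) := ⟨hp.one_lt⟩
    rw [hord, ZMod.val_one, one_mul, hp.dvd_mul] at hod
    rcases hod with h | h
    · have : (p : ℤ) ∣ 1 := by
        have h5 : (p : ℤ) ∣ t * s := (Int.natCast_dvd_natCast.2 h).mul_left t
        have := dvd_sub h5 hs
        simpa using this
      have := Int.natCast_dvd_natCast.1 (by simpa using this : (p : ℤ) ∣ ((1 : ℕ) : ℤ))
      exact hp.one_lt.ne' (Nat.dvd_one.1 this)
    · exact hn h
  have hsum : g 1 * ∑ r, g r = ∑ r, g r := by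
    rw [mul_sum, ← Equiv.sum_comp (Equiv.addLeft (1 : ZMod p)) g]
    refine sum_congr rfl fun r _ => ?_
    simp only [hg, Equiv.coe_addLeft]
    rw [← Units.val_mul, ← pow_add]
    congr 1
    apply hpow
    push_cast
    simp only [ZMod.natCast_zmod_val]
    ring
  rw [hall, hg0] at hsum
  apply hg1
  simpa using hsum

lemma Dset_pow (d i : ℕ) (hd : d ≠ 0) (hi : i ≤ d) : Dset (2 ^ i) d = Dset (2 ^ (d - i)) d := by
  have : Fintype (GaloisField 2 d) := Fintype.ofFinite _
  have hF0 : Fintype.card (GaloisField 2 d) = 2 ^ d := by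
    rw [← Nat.card_eq_fintype_card, GaloisField.card 2 d hd]
  have key : ∀ x : GaloisField 2 d, x ^ 2 ^ d = x := by
    intro x
    have := FiniteField.pow_card x
    rwa [hF0] at this
  ext u
  constructor
  · rintro ⟨x, hx⟩
    refine ⟨x ^ 2 ^ i, ?_⟩
    rw [← pow_mul, ← pow_add, Nat.add_sub_cancel' hi, key, add_comm, hx]
  · rintro ⟨x, hx⟩
    refine ⟨x ^ 2 ^ (d - i), ?_⟩
    rw [← pow_mul, ← pow_add, Nat.sub_add_cancel hi, key, add_comm, hx]

/-- For odd `d ≥ 7` with `2^d - 1` prime, the quadratic residue difference set `Q_d` is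
inequivalent to every difference set `D_{k,d}` arising from the known monomial
hyperovals (regular/translation, Segre, Glynn type (I) and type (II)). -/
theorem stmt_15 (d : ℕ) (hodd : Odd d) (hd : 7 ≤ d) (hp : Nat.Prime (2 ^ d - 1))
    (α : (GaloisField 2 d)ˣ) (hα : ∀ x : (GaloisField 2 d)ˣ, x ∈ Subgroup.zpowers α)
    (k : ℕ)
    (hk : (∃ i : ℕ, 1 ≤ i ∧ i < d ∧ Nat.Coprime i d ∧ k = 2 ^ i) ∨ k = 6 ∨
      k = 2 ^ ((d + 1) / 2) +
        (if d % 4 = 1 then 2 ^ ((3 * d + 1) / 4) else 2 ^ ((d + 1) / 4)) ∨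
      k = 3 * 2 ^ ((d + 1) / 2) + 4) :
    ¬ EquivDS
      {u : (GaloisField 2 d)ˣ | ∃ r : ℕ, 0 < r ∧ r < 2 ^ d - 1 ∧
        (∃ b : ℕ, b ^ 2 ≡ r [MOD 2 ^ d - 1]) ∧ u = α ^ r}
      (Dset k d) := by
  have hd0 : d ≠ 0 := by omega
  have h4 : (2 ^ d - 1) % 4 = 3 := by
    obtain ⟨e, rfl⟩ : ∃ e, d = e + 2 := ⟨d - 2, by omega⟩
    rw [pow_add]
    have := Nat.one_le_two_pow (n := e)
    omega
  have h3 : (2 ^ d - 1) % 3 = 1 := by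
    obtain ⟨m, rfl⟩ := hodd
    have : 2 ^ (2 * m + 1) % 3 = 2 := by
      rw [pow_succ, pow_mul, Nat.mul_mod, Nat.pow_mod]
      norm_num
    generalize 2 ^ (2 * m + 1) = N at this ⊢
    omega
  have h128 : 128 ≤ 2 ^ d := by
    calc 128 = 2 ^ 7 := by norm_num
      _ ≤ 2 ^ d := Nat.pow_le_pow_right (by norm_num) hd
  -- main case
  have main : ∀ k : ℕ, 2 ≤ k → 6 * k < 2 ^ d - 1 → ¬ EquivDS
      {u : (GaloisField 2 d)ˣ | ∃ r : ℕ, 0 < r ∧ r < 2 ^ d - 1 ∧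
        (∃ b : ℕ, b ^ 2 ≡ r [MOD 2 ^ d - 1]) ∧ u = α ^ r}
      (Dset k d) := by
    intro k hk2 hk6
    obtain ⟨n, rfl⟩ : ∃ n, k = n + 1 := ⟨k - 1, by omega⟩
    have hn : ¬ (2 ^ d - 1) ∣ n := Nat.not_dvd_of_pos_of_lt (by omega) (by omega)
    refine core d n (3 * n) hd0 hp h4 h3 α hα hn rfl ?_ ?_
    · intro i hi h
      rw [show 2 * n + n * i = n * (i + 2) by ring, hp.dvd_mul] at h
      exact Nat.not_dvd_of_pos_of_lt (by omega) (by omega) (h.resolve_left hn)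
    · intro i hi h
      rw [show 2 * (3 * n) + n * i = n * (i + 6) by ring, hp.dvd_mul] at h
      exact Nat.not_dvd_of_pos_of_lt (by omega) (by omega) (h.resolve_left hn)
  have hpl : ∀ a b : ℕ, a + b ≤ d → 2 ^ a * 2 ^ b ≤ 2 ^ d := by
    intro a b h
    rw [← pow_add]
    exact Nat.pow_le_pow_right (by norm_num) h
  rcases hk with ⟨i, hi1, hid, -, rfl⟩ | rfl | rfl | rfl
  · by_cases h : i + 3 ≤ d
    · have h1 := Nat.pow_le_pow_right (n := 2) (by norm_num) hi1
      have h2 := hpl i 3 h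
      exact main _ (by omega) (by omega)
    · rw [Dset_pow d i hd0 hid.le]
      have h1 := Nat.pow_le_pow_right (n := 2) (by norm_num) (show 1 ≤ d - i by omega)
      have h2 := hpl (d - i) 3 (by omega)
      exact main _ (by omega) (by omega)
  · exact main 6 (by norm_num) (by omega)
  · by_cases hd7 : d = 7
    · subst hd7
      exact main _ (by norm_num) (by norm_num)
    have h9 : d ≠ 9 := by rintro rfl; norm_num at hp
    have hd11 : 11 ≤ d := by
      obtain ⟨m, rfl⟩ := hodd
      omega
    have a1 := hpl ((d + 1) / 2) 4 (by omega)
    have b1 := Nat.pow_le_pow_right (n := 2) (by norm_num) (show 1 ≤ (d + 1) / 2 by omega)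
    split_ifs with hm
    · have a2 := hpl ((3 * d + 1) / 4) 3 (by omega)
      have a3 := hpl ((d + 1) / 2) 6 (by omega)
      exact main _ (by omega) (by omega)
    · have a2 := hpl ((d + 1) / 4) 4 (by omega)
      exact main _ (by omega) (by omega)
  · by_cases hd7 : d = 7
    · subst hd7
      refine core 7 51 26 hd0 hp h4 h3 α hα (by decide) (by decide) ?_ ?_
      · norm_num; decide
      · norm_num; decide
    have h9 : d ≠ 9 := by rintro rfl; norm_num at hp
    have h11 : d ≠ 11 := by rintro rfl; norm_num at hp
    have hd13 : 13 ≤ d := by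
      obtain ⟨m, rfl⟩ := hodd
      omega
    have a1 := hpl ((d + 1) / 2) 6 (by omega)
    have b1 := Nat.pow_le_pow_right (n := 2) (by norm_num) (show 7 ≤ (d + 1) / 2 by omega)
    exact main _ (by omega) (by omega)
end
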